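/- arXiv:2108.10412 — 2 statements merged into one kernel-verified Lean document; each statement's English description precedes it below -/
import Mathlib

section
/- Let n ≥ 1, p ∈ [1/2,∞], p₁,p₂ ∈ [1,∞], and a,a₁,a₂ ≥ 0 satisfy 1/p = 1/p₁ + 1/p₂ and a/p = a₁/p₁ + a₂/p₂, and let s ∈ ℝ satisfy s ≤ max{0, n(1/p − 1)} and s ∉ 2ℕ. Then there is NO constant C > 0 such that ‖J^s(fg)‖_{L^p_{⟨x⟩^a}} ≤ C ( ‖J^s f‖_{L^{p₁}_{⟨x⟩^{a₁}}} ‖g‖_{L^{p₂}_{⟨x⟩^{a₂}}} + ‖f‖_{L^{p₁}_{⟨x⟩^{a₁}}} ‖J^s g‖_{L^{p₂}_{⟨x⟩^{a₂}}} ) holds for all f, g ∈ 𝒮(ℝⁿ). -/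
open MeasureTheory Real Complex
open scoped ENNReal NNReal RealInnerProductSpace

noncomputable section

abbrev Eu (n : ℕ) := EuclideanSpace ℝ (Fin n)

/-- The polynomial weight `⟨x⟩^a = (1+|x|²)^{a/2}` as an `ℝ≥0∞`-valued function. -/
def jweight {n : ℕ} (a : ℝ) (x : Eu n) : ℝ≥0∞ :=
  ENNReal.ofReal ((1 + ‖x‖ ^ 2) ^ (a / 2))

/-- Weighted Lebesgue (quasi-)norm `‖f‖_{L^p_{⟨x⟩^a}}`; for `p = ∞` the essential sup norm. -/
def wNorm {n : ℕ} {F : Type*} [NormedAddCommGroup F] (p : ℝ≥0∞) (a : ℝ)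
    (f : Eu n → F) : ℝ≥0∞ :=
  if p = ∞ then essSup (fun x => (‖f x‖₊ : ℝ≥0∞)) volume
  else (∫⁻ x, (‖f x‖₊ : ℝ≥0∞) ^ p.toReal * jweight a x) ^ (1 / p.toReal)

/-- The Fourier transform `f̂(ξ) = ∫ f(x) e^{-i x·ξ} dx`. -/
def FT {n : ℕ} (f : Eu n → ℂ) (ξ : Eu n) : ℂ :=
  ∫ x, f x * Complex.exp (-(Complex.I * ((⟪x, ξ⟫ : ℝ) : ℂ)))

/-- The inhomogeneous fractional derivative (Bessel potential) `J^s`. -/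
def Js {n : ℕ} (s : ℝ) (f : Eu n → ℂ) (x : Eu n) : ℂ :=
  ((((2 * Real.pi) ^ n)⁻¹ : ℝ) : ℂ) *
    ∫ ξ, (((1 + ‖ξ‖ ^ 2) ^ (s / 2) : ℝ) : ℂ) * FT f ξ *
      Complex.exp (Complex.I * ((⟪x, ξ⟫ : ℝ) : ℂ))


open Set Filter Topology
open scoped ContDiff FourierTransform Convolution

/-! ### Incomplete gamma function -/

lemma kp_integrableOn_rpow_unit {β : ℝ} (hβ : 0 < β) :
    IntegrableOn (fun t : ℝ => t ^ (β - 1)) (Ioc 0 1) := by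
  have := (intervalIntegral.intervalIntegrable_rpow' (a := 0) (b := 1) (r := β - 1) (by linarith))
  rwa [intervalIntegrable_iff_integrableOn_Ioc_of_le zero_le_one] at this

def kpK (β y : ℝ) : ℝ := ∫ t in Ioc (0:ℝ) 1, Real.exp (-t * y) * t ^ (β - 1)

lemma kp_exp_bound {t y M : ℝ} (ht : t ∈ Ioc (0:ℝ) 1) (hy : |y| ≤ M) :
    Real.exp (-t * y) ≤ Real.exp M := by
  apply Real.exp_le_exp.2
  have := neg_abs_le y
  have h0 := abs_nonneg y
  nlinarith [ht.1, ht.2]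

lemma kpK_integrable {β : ℝ} (hβ : 0 < β) (y : ℝ) :
    IntegrableOn (fun t : ℝ => Real.exp (-t * y) * t ^ (β - 1)) (Ioc 0 1) := by
  refine Integrable.mono' ((kp_integrableOn_rpow_unit hβ).const_mul (Real.exp |y|)) ?_ ?_
  · exact (Measurable.aestronglyMeasurable (by fun_prop))
  · refine (ae_restrict_iff' measurableSet_Ioc).2 (Eventually.of_forall fun t ht => ?_)
    rw [Real.norm_of_nonneg (mul_nonneg (Real.exp_pos _).le (Real.rpow_nonneg ht.1.le _))]
    exact mul_le_mul_of_nonneg_right (kp_exp_bound ht le_rfl) (Real.rpow_nonneg ht.1.le _)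

lemma kpK_hasDerivAt {β : ℝ} (hβ : 0 < β) (y : ℝ) :
    HasDerivAt (kpK β) (-kpK (β + 1) y) y := by
  have h := hasDerivAt_integral_of_dominated_loc_of_deriv_le (𝕜 := ℝ)
    (μ := volume.restrict (Ioc (0:ℝ) 1)) (x₀ := y)
    (F := fun y t => Real.exp (-t * y) * t ^ (β - 1))
    (F' := fun y t => -(Real.exp (-t * y) * t ^ (β + 1 - 1)))
    (bound := fun t => Real.exp (|y| + 1) * t ^ (β + 1 - 1))
    (s := Metric.ball y 1) (Metric.ball_mem_nhds y one_pos) ?_ ?_ ?_ ?_ ?_ ?_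
  · have h2 := h.2
    rw [integral_neg] at h2
    exact h2
  · exact Eventually.of_forall fun y => (kpK_integrable hβ y).1
  · exact kpK_integrable hβ y
  · exact (kpK_integrable (by linarith : 0 < β + 1) y).1.neg
  · refine (ae_restrict_iff' measurableSet_Ioc).2 (Eventually.of_forall fun t ht z hz => ?_)
    rw [norm_neg, Real.norm_of_nonneg (mul_nonneg (Real.exp_pos _).le (Real.rpow_nonneg ht.1.le _))]
    refine mul_le_mul_of_nonneg_right (kp_exp_bound ht ?_) (Real.rpow_nonneg ht.1.le _)
    rw [Metric.mem_ball, Real.dist_eq] at hz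
    have := abs_sub_abs_le_abs_sub z y
    linarith
  · exact (kp_integrableOn_rpow_unit (by linarith : 0 < β + 1)).const_mul _
  · refine (ae_restrict_iff' measurableSet_Ioc).2 (Eventually.of_forall fun t ht z hz => ?_)
    have h1 : HasDerivAt (fun z => Real.exp (-t * z)) (Real.exp (-t * z) * (-t)) z := by
      have := ((hasDerivAt_id z).const_mul (-t)).exp
      simpa using this
    refine (h1.mul_const (t ^ (β - 1))).congr_deriv ?_
    have : t ^ (β + 1 - 1) = t * t ^ (β - 1) := by
      rw [show β + 1 - 1 = 1 + (β - 1) by ring, Real.rpow_add ht.1, Real.rpow_one]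
    rw [this]; ring

lemma kpK_contDiff_nat (m : ℕ) : ∀ β : ℝ, 0 < β → ContDiff ℝ m (kpK β) := by
  induction m with
  | zero =>
    intro β hβ
    rw [Nat.cast_zero, contDiff_zero]
    exact continuous_iff_continuousAt.2 fun y => (kpK_hasDerivAt hβ y).continuousAt
  | succ m ih =>
    intro β hβ
    push_cast
    rw [contDiff_succ_iff_deriv]
    refine ⟨fun y => (kpK_hasDerivAt hβ y).differentiableAt, by simp, ?_⟩
    have : deriv (kpK β) = fun y => -kpK (β + 1) y := by
      ext y; exact (kpK_hasDerivAt hβ y).deriv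
    rw [this]
    exact (ih (β + 1) (by linarith)).neg

lemma kpK_contDiff {β : ℝ} (hβ : 0 < β) : ContDiff ℝ ∞ (kpK β) :=
  contDiff_infty.2 fun m => kpK_contDiff_nat m β hβ

def kpI (α y : ℝ) : ℝ := ∫ t in Ioi (1:ℝ), Real.exp (-t * y) * t ^ (-α - 1)

lemma kp_integrable_exp_rpow (r : ℝ) {y : ℝ} (hy : 0 < y) :
    IntegrableOn (fun t : ℝ => Real.exp (-t * y) * t ^ r) (Ioi 1) := by
  have : (fun t : ℝ => Real.exp (-t * y) * t ^ r) =O[atTop] fun t => Real.exp (-(y/2) * t) := by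
    have h1 := (isLittleO_rpow_exp_pos_mul_atTop r (show 0 < y / 2 by linarith)).isBigO
    have h2 := (Asymptotics.isBigO_refl (fun t : ℝ => Real.exp (-t * y)) atTop).mul h1
    refine h2.congr_right fun t => ?_
    rw [← Real.exp_add]; ring_nf
  refine integrable_of_isBigO_exp_neg (b := y / 2) (by linarith) ?_ this
  apply ContinuousOn.mul (by fun_prop)
  intro t ht
  exact (Real.continuousAt_rpow_const _ _ (Or.inl (by have : (1:ℝ) ≤ t := ht; linarith))).continuousWithinAt

lemma kpI_rec {α y : ℝ} (hα : α ≠ 0) (hy : 0 < y) :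
    kpI α y = Real.exp (-y) / α - y / α * kpI (α - 1) y := by
  have hu : ∀ t ∈ Ioi (1:ℝ), HasDerivAt (fun t => Real.exp (-t * y)) (-y * Real.exp (-t * y)) t := by
    intro t _
    have := ((hasDerivAt_id t).neg.mul_const y).exp
    refine this.congr_deriv ?_
    simp only [Pi.neg_apply, id]; ring
  have hv : ∀ t ∈ Ioi (1:ℝ), HasDerivAt (fun t : ℝ => t ^ (-α) / (-α)) (t ^ (-α - 1)) t := by
    intro t ht
    have ht0 : t ≠ 0 := by have : (1:ℝ) < t := ht; linarith
    have := (Real.hasDerivAt_rpow_const (x := t) (p := -α) (Or.inl ht0)).div_const (-α)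
    refine this.congr_deriv ?_
    field_simp
  have key := integral_Ioi_mul_deriv_eq_deriv_mul (a := (1:ℝ)) (a' := Real.exp (-y) / (-α)) (b' := 0) hu hv
    ?_ ?_ ?_ ?_
  · have e1 : ∫ t in Ioi (1:ℝ), -y * Real.exp (-t * y) * (t ^ (-α) / (-α))
        = y / α * kpI (α - 1) y := by
      rw [kpI, ← integral_const_mul]
      congr 1; ext t
      rw [show -(α - 1) - 1 = -α by ring]
      field_simp
    rw [kpI, key, e1]
    field_simp
    ring
  · exact kp_integrable_exp_rpow _ hy
  · have := (kp_integrable_exp_rpow (-α) hy).const_mul (y / α)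
    refine IntegrableOn.congr_fun this (fun t _ => ?_) measurableSet_Ioi
    simp only [Pi.mul_apply]
    field_simp
  · have : ContinuousAt (fun t : ℝ => Real.exp (-t * y) * (t ^ (-α) / (-α))) 1 := by
      apply ContinuousAt.mul (by fun_prop)
      exact (Real.continuousAt_rpow_const _ _ (Or.inl one_ne_zero)).div_const _
    have h2 := this.tendsto.mono_left (nhdsWithin_le_nhds (s := Ioi 1))
    rw [Real.one_rpow, show Real.exp (-1 * y) * (1 / -α) = Real.exp (-y) / -α by
      rw [neg_one_mul]; ring] at h2
    exact h2
  · have h1 := (isLittleO_rpow_exp_pos_mul_atTop (-α) hy).tendsto_div_nhds_zero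
    have h2 := h1.div_const (-α)
    simp only [zero_div] at h2
    refine h2.congr fun t => ?_
    simp only [Pi.mul_apply]
    rw [show -t * y = -(y * t) by ring, Real.exp_neg]
    field_simp

lemma kp_key_aux (m : ℕ) : ∀ α : ℝ, α < m → (∀ k : ℕ, α ≠ k) →
    ∃ (c : ℝ) (W : ℝ → ℝ), ContDiff ℝ ∞ W ∧ ∀ y > 0, c * y ^ α = W y + kpI α y := by
  induction m with
  | zero =>
    intro α hα _
    rw [Nat.cast_zero] at hα
    refine ⟨Real.Gamma (-α), kpK (-α), kpK_contDiff (by linarith), fun y hy => ?_⟩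
    have h1 := Real.integral_rpow_mul_exp_neg_mul_Ioi (a := -α) (by linarith) hy
    have hk := kpK_integrable (β := -α) (by linarith) y
    have hi := kp_integrable_exp_rpow (-α - 1) hy
    rw [kpK, kpI, ← setIntegral_union Ioc_disjoint_Ioi_same measurableSet_Ioi hk hi,
      Ioc_union_Ioi_eq_Ioi zero_le_one]
    rw [one_div, Real.inv_rpow hy.le, Real.rpow_neg hy.le, inv_inv] at h1
    rw [mul_comm, ← h1]
    congr 1; ext t
    rw [mul_comm]; ring_nf
  | succ m ih =>
    intro α hα hk
    have h0 : α ≠ 0 := by simpa using hk 0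
    obtain ⟨c, W, hW, h⟩ := ih (α - 1) (by push_cast at hα; linarith) (fun k hk' => hk (k + 1) (by push_cast; linarith))
    refine ⟨-(c / α), fun y => -(Real.exp (-y) / α) - y / α * W y, by fun_prop, fun y hy => ?_⟩
    rw [kpI_rec h0 hy]
    have h2 := h y hy
    have h3 : y ^ α = y * y ^ (α - 1) := by
      rw [Real.rpow_sub_one hy.ne']; field_simp
    rw [h3]
    have h4 : kpI (α - 1) y = c * y ^ (α - 1) - W y := by linarith
    rw [h4]; field_simp; ring

lemma kp_key (α : ℝ) (hα : ∀ k : ℕ, α ≠ k) :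
    ∃ (c : ℝ) (W : ℝ → ℝ), ContDiff ℝ ∞ W ∧ ∀ y > 0, c * y ^ α = W y + kpI α y := by
  obtain ⟨m, hm⟩ := exists_nat_gt α
  exact kp_key_aux m α hm hα


/-! ### Fourier integrals -/

def kpIF {n : ℕ} (Ψ : Eu n → ℂ) (x : Eu n) : ℂ :=
  ∫ ξ, Ψ ξ * Complex.exp (Complex.I * ((⟪x, ξ⟫ : ℝ) : ℂ))

lemma kpIF_eq_fourier {n : ℕ} (Ψ : Eu n → ℂ) (x : Eu n) :
    kpIF Ψ x = 𝓕 Ψ (-((2 * π)⁻¹ • x)) := by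
  rw [Real.fourier_eq', kpIF]
  congr 1; ext ξ
  rw [smul_eq_mul, mul_comm]
  congr 2
  rw [inner_neg_right, inner_smul_right, real_inner_comm]
  push_cast
  have : (π : ℂ) ≠ 0 := by exact_mod_cast Real.pi_ne_zero
  field_simp

lemma kp_slice_bound {n : ℕ} {P : Type*} [NormedAddCommGroup P] [NormedSpace ℝ P]
    {G : P × Eu n → ℂ} (hG : ContDiff ℝ ∞ G) (p : P) (j : ℕ) (ξ : Eu n) :
    ‖iteratedFDeriv ℝ j (fun ξ => G (p, ξ)) ξ‖ ≤ ‖iteratedFDeriv ℝ j G (p, ξ)‖ := by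
  have hG2 : ContDiff ℝ ∞ (fun z : P × Eu n => G ((p, 0) + z)) := hG.comp (by fun_prop)
  have h1 : (fun ξ => G (p, ξ)) =
      (fun z : P × Eu n => G ((p, 0) + z)) ∘ (ContinuousLinearMap.inr ℝ P (Eu n)) := by
    ext ξ; simp
  rw [h1, ContinuousLinearMap.iteratedFDeriv_comp_right _ hG2 _ (i := j) (by exact_mod_cast le_top)]
  refine (ContinuousMultilinearMap.norm_compContinuousLinearMap_le _ _).trans ?_
  rw [iteratedFDeriv_comp_add_left']
  simp only [ContinuousLinearMap.inr_apply, Prod.mk_add_mk, add_zero, zero_add]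
  refine mul_le_of_le_one_right (norm_nonneg _) ?_
  apply Finset.prod_le_one
  · intros; exact norm_nonneg _
  · intros; exact ContinuousLinearMap.norm_inr_le_one ℝ P (Eu n)

lemma kp_decay {n : ℕ} {P : Type*} [NormedAddCommGroup P] [NormedSpace ℝ P]
    {S : Set P} (hS : IsCompact S) {G : P × Eu n → ℂ} (hG : ContDiff ℝ ∞ G) (R : ℝ)
    (hsupp : ∀ p ξ, R < ‖ξ‖ → G (p, ξ) = 0) (M : ℕ) :
    ∃ A : ℝ, 0 ≤ A ∧ ∀ p ∈ S, ∀ x : Eu n,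
      ‖kpIF (fun ξ => G (p, ξ)) x‖ ≤ A * ((1 + ‖x‖) ^ M)⁻¹ := by
  have hK : IsCompact (S ×ˢ Metric.closedBall (0 : Eu n) R) :=
    hS.prod (isCompact_closedBall _ _)
  have hB : ∀ j : ℕ, ∃ B : ℝ, ∀ z ∈ S ×ˢ Metric.closedBall (0 : Eu n) R,
      ‖iteratedFDeriv ℝ j G z‖ ≤ B := fun j =>
    hK.exists_bound_of_continuousOn
      (hG.continuous_iteratedFDeriv (m := j) (by exact_mod_cast le_top)).continuousOn
  choose B hB using hB
  have hts : ∀ p, tsupport (fun ξ => G (p, ξ)) ⊆ Metric.closedBall (0 : Eu n) R := by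
    intro p
    refine closure_minimal (fun ξ hξ => ?_) Metric.isClosed_closedBall
    by_contra h
    rw [mem_closedBall_zero_iff, not_le] at h
    exact hξ (hsupp p ξ h)
  have hsm : ∀ p, ContDiff ℝ ∞ (fun ξ => G (p, ξ)) := fun p => hG.comp (by fun_prop)
  have hts2 : ∀ p j, tsupport (iteratedFDeriv ℝ j (fun ξ => G (p, ξ))) ⊆
      Metric.closedBall (0 : Eu n) R := fun p j => (tsupport_iteratedFDeriv_subset j).trans (hts p)
  have hcs : ∀ p j, HasCompactSupport (iteratedFDeriv ℝ j (fun ξ => G (p, ξ))) := fun p j =>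
    HasCompactSupport.of_support_subset_isCompact (isCompact_closedBall (0 : Eu n) R)
      ((subset_tsupport _).trans (hts2 p j))
  have hcont : ∀ p (j : ℕ), Continuous (iteratedFDeriv ℝ j (fun ξ => G (p, ξ))) := fun p j =>
    (hsm p).continuous_iteratedFDeriv (by exact_mod_cast le_top)
  have hint : ∀ p (j : ℕ), Integrable (fun ξ => ‖iteratedFDeriv ℝ j (fun ξ => G (p, ξ)) ξ‖) :=
    fun p j => ((hcont p j).integrable_of_hasCompactSupport (hcs p j)).norm
  set V := (volume (Metric.closedBall (0 : Eu n) R)).toReal with hV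
  have hint2 : ∀ p ∈ S, ∀ j : ℕ,
      ∫ ξ, ‖iteratedFDeriv ℝ j (fun ξ => G (p, ξ)) ξ‖ ≤ |B j| * V := by
    intro p hp j
    rw [← setIntegral_eq_integral_of_forall_compl_eq_zero (s := Metric.closedBall (0 : Eu n) R)]
    · refine (le_abs_self _).trans ?_
      rw [← Real.norm_eq_abs]
      refine norm_setIntegral_le_of_norm_le_const (measure_closedBall_lt_top) ?_
      intro ξ hξ
      rw [norm_norm]
      exact ((kp_slice_bound hG p j ξ).trans (hB j _ ⟨hp, hξ⟩)).trans (le_abs_self _)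
    · intro ξ hξ
      rw [image_eq_zero_of_notMem_tsupport (fun h => hξ (hts2 p j h)), norm_zero]
  set D : ℝ := ∑ q ∈ Finset.range (0 + 1) ×ˢ Finset.range (M + 1), |B q.2| * V with hD
  have hD0 : 0 ≤ D := Finset.sum_nonneg fun q _ => by positivity
  have main : ∀ p ∈ S, ∀ w : Eu n, ∀ m ≤ M, ‖w‖ ^ m * ‖𝓕 (fun ξ => G (p, ξ)) w‖ ≤ 2 ^ m * D := by
    intro p hp w m hm
    have h := Real.pow_mul_norm_iteratedFDeriv_fourier_le (K := 0) (N := M)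
      (f := fun ξ => G (p, ξ)) ((hsm p).of_le (by exact_mod_cast le_top)) ?_ (k := 0) (n := m) le_rfl
      (by exact_mod_cast hm) w
    · rw [norm_iteratedFDeriv_zero] at h
      refine h.trans ?_
      simp only [pow_zero, one_mul, Nat.cast_zero, mul_zero, zero_add]
      refine mul_le_mul_of_nonneg_left ?_ (by positivity)
      refine le_trans ?_ (Finset.sum_le_sum_of_subset_of_nonneg (s := Finset.range (0 + 1) ×ˢ Finset.range (m + 1)) ?_ ?_)
      · refine Finset.sum_le_sum fun q hq => ?_
        have : q.1 = 0 := by simpa using (Finset.mem_product.1 hq).1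
        simpa [this] using hint2 p hp q.2
      · exact Finset.product_subset_product_right (Finset.range_mono (by omega))
      · intros; positivity
    · intro k m hk hm
      have : k = 0 := by simpa using hk
      simpa [this] using hint p m
  refine ⟨2 ^ (M - 1) * (D + (2 * π) ^ M * (2 ^ M * D)), by positivity, fun p hp x => ?_⟩
  rw [← div_eq_mul_inv, le_div_iff₀ (by positivity), mul_comm, kpIF_eq_fourier]
  set w : Eu n := -((2 * π)⁻¹ • x) with hw
  have hxw : ‖x‖ = 2 * π * ‖w‖ := by
    rw [hw, norm_neg, norm_smul, Real.norm_of_nonneg (by positivity)]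
    field_simp
  have h0 := main p hp w 0 (Nat.zero_le _)
  have hM := main p hp w M le_rfl
  simp only [pow_zero, one_mul] at h0
  calc (1 + ‖x‖) ^ M * ‖𝓕 (fun ξ => G (p, ξ)) w‖
      ≤ (2 ^ (M - 1) * (1 ^ M + ‖x‖ ^ M)) * ‖𝓕 (fun ξ => G (p, ξ)) w‖ := by
        gcongr; exact add_pow_le zero_le_one (norm_nonneg _) M
    _ = 2 ^ (M - 1) * (‖𝓕 (fun ξ => G (p, ξ)) w‖ +
          (2 * π) ^ M * (‖w‖ ^ M * ‖𝓕 (fun ξ => G (p, ξ)) w‖)) := by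
        rw [hxw, one_pow, mul_pow]; ring
    _ ≤ _ := by gcongr


/-! ### Weighted norms -/

lemma kp_wNorm_top {n : ℕ} (b : ℝ) (U : Eu n → ℂ) :
    wNorm ⊤ b U = essSup (fun x => (‖U x‖₊ : ℝ≥0∞)) volume := by
  simp [wNorm]

lemma kp_wNorm_ne_top {n : ℕ} {q : ℝ≥0∞} (hq : q ≠ ⊤) (b : ℝ) (U : Eu n → ℂ) :
    wNorm q b U = (∫⁻ x, (‖U x‖₊ : ℝ≥0∞) ^ q.toReal * jweight b x) ^ (1 / q.toReal) := by
  simp [wNorm, hq]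

lemma kp_wNorm_congr {n : ℕ} (q : ℝ≥0∞) (b : ℝ) {U V : Eu n → ℂ} (h : ∀ x, ‖U x‖ = ‖V x‖) :
    wNorm q b U = wNorm q b V := by
  have : ∀ x, ‖U x‖₊ = ‖V x‖₊ := fun x => NNReal.eq (h x)
  simp only [wNorm, this]

lemma kp_jweight_le {n : ℕ} {b : ℝ} (hb : 0 ≤ b) (x : Eu n) :
    jweight b x ≤ ENNReal.ofReal ((1 + ‖x‖) ^ b) := by
  rw [jweight]
  apply ENNReal.ofReal_le_ofReal
  have h0 := norm_nonneg x
  calc (1 + ‖x‖ ^ 2) ^ (b / 2) ≤ ((1 + ‖x‖) ^ 2) ^ (b / 2) := by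
        apply Real.rpow_le_rpow (by positivity) (by nlinarith) (by positivity)
    _ = (1 + ‖x‖) ^ b := by
        rw [← Real.rpow_natCast, ← Real.rpow_mul (by positivity)]
        congr 1; push_cast; ring

lemma kp_wNorm_le {n : ℕ} {q : ℝ≥0∞} (hq : q ≠ 0) {b : ℝ} (hb : 0 ≤ b) :
    ∃ (K : ℝ≥0∞) (M : ℕ), K ≠ ⊤ ∧ ∀ (U : Eu n → ℂ) (A : ℝ), 0 ≤ A →
      (∀ x, ‖U x‖ ≤ A * ((1 + ‖x‖) ^ M)⁻¹) → wNorm q b U ≤ ENNReal.ofReal A * K := by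
  by_cases hqt : q = ⊤
  · refine ⟨1, 0, by simp, fun U A hA hU => ?_⟩
    subst hqt
    rw [kp_wNorm_top, mul_one]
    refine essSup_le_of_ae_le _ (Eventually.of_forall fun x => ?_)
    have := hU x
    simp only [pow_zero, inv_one, mul_one] at this
    change (‖U x‖₊ : ℝ≥0∞) ≤ _
    rw [← enorm_eq_nnnorm, ← ofReal_norm]
    exact ENNReal.ofReal_le_ofReal this
  · set r := q.toReal with hr
    have hr0 : 0 < r := ENNReal.toReal_pos hq hqt
    obtain ⟨M, hM⟩ := exists_nat_ge ((b + (n + 1)) / r)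
    rw [div_le_iff₀ hr0] at hM
    have hint : Integrable (fun x : Eu n => (1 + ‖x‖) ^ (-((n : ℝ) + 1))) :=
      integrable_one_add_norm (by simp)
    set J : ℝ≥0∞ := ∫⁻ x : Eu n, ENNReal.ofReal ((1 + ‖x‖) ^ (-((n : ℝ) + 1))) with hJ
    have hJt : J ≠ ⊤ := hint.lintegral_lt_top.ne
    refine ⟨J ^ (1 / r), M, ENNReal.rpow_ne_top_of_nonneg (by positivity) hJt, fun U A hA hU => ?_⟩
    rw [kp_wNorm_ne_top hqt, ← hr]
    have hpt : ∀ x : Eu n, (‖U x‖₊ : ℝ≥0∞) ^ r * jweight b x ≤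
        ENNReal.ofReal A ^ r * ENNReal.ofReal ((1 + ‖x‖) ^ (-((n : ℝ) + 1))) := by
      intro x
      have hx1 : (1:ℝ) ≤ 1 + ‖x‖ := by linarith [norm_nonneg x]
      refine (mul_le_mul' le_rfl (kp_jweight_le hb x)).trans ?_
      rw [← enorm_eq_nnnorm, ← ofReal_norm, ENNReal.ofReal_rpow_of_nonneg (norm_nonneg _) hr0.le,
        ENNReal.ofReal_rpow_of_nonneg hA hr0.le, ← ENNReal.ofReal_mul (by positivity),
        ← ENNReal.ofReal_mul (by positivity)]
      apply ENNReal.ofReal_le_ofReal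
      calc ‖U x‖ ^ r * (1 + ‖x‖) ^ b
          ≤ (A * ((1 + ‖x‖) ^ M)⁻¹) ^ r * (1 + ‖x‖) ^ b := by
            gcongr; exact hU x
        _ = A ^ r * ((1 + ‖x‖) ^ (-(M * r) + b)) := by
            rw [Real.mul_rpow hA (by positivity), Real.rpow_add (by positivity),
              Real.rpow_neg (by positivity), Real.rpow_mul (by positivity), Real.rpow_natCast,
              Real.inv_rpow (by positivity), mul_assoc]
        _ ≤ _ := by
            gcongr
            linarith
    calc (∫⁻ x, (‖U x‖₊ : ℝ≥0∞) ^ r * jweight b x) ^ (1 / r)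
        ≤ (ENNReal.ofReal A ^ r * J) ^ (1 / r) := by
          apply ENNReal.rpow_le_rpow _ (by positivity)
          rw [hJ, ← lintegral_const_mul' _ _ (ENNReal.rpow_ne_top_of_nonneg hr0.le ENNReal.ofReal_ne_top)]
          exact lintegral_mono hpt
      _ = _ := by
          rw [ENNReal.mul_rpow_of_nonneg _ _ (by positivity), ← ENNReal.rpow_mul,
            mul_one_div_cancel hr0.ne', ENNReal.rpow_one]

lemma kp_wNorm_const_mul {n : ℕ} {q : ℝ≥0∞} (hq : q ≠ 0) (b : ℝ) (U : Eu n → ℂ) {c : ℝ} (hc : 0 ≤ c) :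
    wNorm q b (fun x => (c : ℂ) * U x) = ENNReal.ofReal c * wNorm q b U := by
  have h : ∀ x, (‖(c : ℂ) * U x‖₊ : ℝ≥0∞) = ENNReal.ofReal c * ‖U x‖₊ := by
    intro x
    rw [nnnorm_mul, ENNReal.coe_mul]
    congr 1
    rw [← enorm_eq_nnnorm, ← ofReal_norm, Complex.norm_real, Real.norm_of_nonneg hc]
  by_cases hqt : q = ⊤
  · subst hqt
    rw [kp_wNorm_top, kp_wNorm_top]
    simp only [h]
    exact ENNReal.essSup_const_mul
  · have hr0 : 0 < q.toReal := ENNReal.toReal_pos hq hqt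
    rw [kp_wNorm_ne_top hqt, kp_wNorm_ne_top hqt]
    simp only [h]
    have : ∀ x : Eu n, (ENNReal.ofReal c * ‖U x‖₊) ^ q.toReal * jweight b x =
        ENNReal.ofReal c ^ q.toReal * ((‖U x‖₊ : ℝ≥0∞) ^ q.toReal * jweight b x) := by
      intro x
      rw [ENNReal.mul_rpow_of_nonneg _ _ hr0.le, mul_assoc]
    simp only [this]
    rw [lintegral_const_mul' _ _ (ENNReal.rpow_ne_top_of_nonneg hr0.le ENNReal.ofReal_ne_top),
      ENNReal.mul_rpow_of_nonneg _ _ (by positivity), ← ENNReal.rpow_mul,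
            mul_one_div_cancel hr0.ne', ENNReal.rpow_one]

lemma kp_lintegral_comp_smul {n : ℕ} (f : Eu n → ℝ≥0∞) {ν : ℝ} (hν : 0 < ν) :
    ∫⁻ x, f (ν • x) = ENNReal.ofReal ((ν ^ n)⁻¹) * ∫⁻ x, f x := by
  have h1 : MeasurableEmbedding (fun x : Eu n => ν • x) :=
    (Homeomorph.smulOfNeZero ν hν.ne').measurableEmbedding
  rw [← h1.lintegral_map f, Measure.map_addHaar_smul _ hν.ne', lintegral_smul_measure,
    abs_of_nonneg (by positivity), finrank_euclideanSpace_fin, smul_eq_mul]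

lemma kp_essSup_comp_smul {n : ℕ} (f : Eu n → ℝ≥0∞) {ν : ℝ} (hν : 0 < ν) :
    essSup (fun x => f (ν • x)) volume = essSup f volume := by
  have h1 : MeasurableEmbedding (fun x : Eu n => ν • x) :=
    (Homeomorph.smulOfNeZero ν hν.ne').measurableEmbedding
  have := h1.essSup_map_measure (μ := volume) (g := f)
  rw [Measure.map_addHaar_smul _ hν.ne'] at this
  refine this.symm.trans ?_
  rw [essSup, essSup, Measure.ae_ennreal_smul_measure_eq]
  simp only [ne_eq, ENNReal.ofReal_eq_zero, not_le]; positivity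

lemma kp_jweight_mono {n : ℕ} {b : ℝ} (hb : 0 ≤ b) {x y : Eu n} (h : ‖x‖ ≤ ‖y‖) :
    jweight b x ≤ jweight b y := by
  apply ENNReal.ofReal_le_ofReal
  apply Real.rpow_le_rpow (by positivity) _ (by positivity)
  gcongr

lemma kp_scale_aux {n : ℕ} {r ν : ℝ} (hr : 0 < r) (hν : 0 < ν) (X : ℝ≥0∞) :
    (ENNReal.ofReal ((ν ^ n)⁻¹) * X) ^ (1 / r) =
      ENNReal.ofReal (ν ^ (-((n : ℝ) * (1 / r)))) * X ^ (1 / r) := by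
  rw [ENNReal.mul_rpow_of_nonneg _ _ (by positivity), ENNReal.ofReal_rpow_of_pos (by positivity)]
  congr 2
  rw [Real.rpow_neg hν.le, Real.rpow_mul hν.le, Real.rpow_natCast, Real.inv_rpow (by positivity)]

lemma kp_wNorm_scale_le {n : ℕ} {q : ℝ≥0∞} (hq : q ≠ 0) {b : ℝ} (hb : 0 ≤ b) (U : Eu n → ℂ)
    {ν : ℝ} (hν : 1 ≤ ν) :
    wNorm q b (fun x => U (ν • x)) ≤
      ENNReal.ofReal (ν ^ (-((n : ℝ) * (1 / q.toReal)))) * wNorm q b U := by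
  have hν0 : 0 < ν := by linarith
  by_cases hqt : q = ⊤
  · subst hqt
    rw [kp_wNorm_top, kp_wNorm_top, kp_essSup_comp_smul (fun x => (‖U x‖₊ : ℝ≥0∞)) hν0]
    simp
  · have hr0 : 0 < q.toReal := ENNReal.toReal_pos hq hqt
    rw [kp_wNorm_ne_top hqt, kp_wNorm_ne_top hqt, ← kp_scale_aux hr0 hν0]
    apply ENNReal.rpow_le_rpow _ (by positivity)
    rw [← kp_lintegral_comp_smul _ hν0]
    refine lintegral_mono fun x => mul_le_mul' le_rfl (kp_jweight_mono hb ?_)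
    rw [norm_smul, Real.norm_of_nonneg hν0.le]
    exact le_mul_of_one_le_left (norm_nonneg _) hν

lemma kp_wNorm_scale_ge {n : ℕ} {q : ℝ≥0∞} (hq : q ≠ 0) {b : ℝ} (hb : 0 ≤ b) (U : Eu n → ℂ)
    {ν : ℝ} (hν : 1 ≤ ν) :
    ENNReal.ofReal (ν ^ (-((n : ℝ) * (1 / q.toReal)))) * wNorm q 0 U ≤
      wNorm q b (fun x => U (ν • x)) := by
  have hν0 : 0 < ν := by linarith
  by_cases hqt : q = ⊤
  · subst hqt
    rw [kp_wNorm_top, kp_wNorm_top, kp_essSup_comp_smul (fun x => (‖U x‖₊ : ℝ≥0∞)) hν0]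
    simp
  · have hr0 : 0 < q.toReal := ENNReal.toReal_pos hq hqt
    rw [kp_wNorm_ne_top hqt, kp_wNorm_ne_top hqt, ← kp_scale_aux hr0 hν0]
    apply ENNReal.rpow_le_rpow _ (by positivity)
    rw [← kp_lintegral_comp_smul _ hν0]
    refine lintegral_mono fun x => mul_le_mul' le_rfl ?_
    simp only [jweight, zero_div, Real.rpow_zero]
    apply ENNReal.ofReal_le_ofReal
    apply Real.one_le_rpow _ (by positivity)
    have := sq_nonneg ‖x‖
    linarith


/-! ### Modulated and dilated functions -/

lemma kp_cov {n : ℕ} (F : Eu n → ℂ) (w : Eu n) {c : ℝ} (hc : 0 < c) :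
    ∫ ζ, F ζ = ((c ^ n : ℝ) : ℂ) * ∫ η, F (w + c • η) := by
  have h1 : ∫ η, F (w + c • η) = (c ^ n)⁻¹ • ∫ ζ, F (w + ζ) := by
    have := Measure.integral_comp_smul_of_nonneg (volume : Measure (Eu n)) (fun ζ => F (w + ζ)) c
      (hR := hc.le)
    rwa [finrank_euclideanSpace_fin] at this
  rw [h1, integral_add_left_eq_self F w, Complex.real_smul, ← mul_assoc, ← Complex.ofReal_mul,
    mul_inv_cancel₀ (by positivity), Complex.ofReal_one, one_mul]

lemma kp_schwartz {n : ℕ} {ψ : Eu n → ℂ} (hψ : ContDiff ℝ ∞ ψ) (hψc : HasCompactSupport ψ)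
    (v : Eu n) {ν : ℝ} (hν : 0 < ν) :
    ∃ f : SchwartzMap (Eu n) ℂ,
      (∀ x, f x = Complex.exp (Complex.I * ((⟪x, v⟫ : ℝ) : ℂ)) * kpIF ψ (ν • x)) ∧
      ∀ s x, Js s (⇑f) x = Complex.exp (Complex.I * ((⟪x, v⟫ : ℝ) : ℂ)) *
        kpIF (fun η => (((1 + ‖v + ν • η‖ ^ 2) ^ (s / 2) : ℝ) : ℂ) * ψ η) (ν • x) := by
  have hpi : (0:ℝ) < 2 * π := by positivity
  have hpiC : (π : ℂ) ≠ 0 := by exact_mod_cast Real.pi_ne_zero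
  have hνC : (ν : ℂ) ≠ 0 := by exact_mod_cast hν.ne'
  set Θ : Eu n → ℂ := fun ζ => (((2 * π / ν) ^ n : ℝ) : ℂ) * ψ (ν⁻¹ • ((2 * π) • ζ - v)) with hΘ
  have hΘs : ContDiff ℝ ∞ Θ := contDiff_const.mul (hψ.comp (by fun_prop))
  have hΘc : HasCompactSupport Θ := by
    apply HasCompactSupport.mul_left
    exact hψc.comp_homeomorph ((Homeomorph.smulOfNeZero (2 * π) hpi.ne').trans
      ((Homeomorph.subRight v).trans (Homeomorph.smulOfNeZero ν⁻¹ (inv_ne_zero hν.ne'))))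
  set Θs : SchwartzMap (Eu n) ℂ := hΘc.toSchwartzMap hΘs with hΘS
  have hΘa : ∀ ζ, Θs ζ = Θ ζ := fun ζ => rfl
  refine ⟨𝓕⁻ Θs, fun x => ?_, fun s x => ?_⟩
  · rw [SchwartzMap.fourierInv_coe, Real.fourierInv_eq']
    rw [kp_cov _ ((2 * π)⁻¹ • v) (c := ν / (2 * π)) (by positivity)]
    rw [kpIF, ← integral_const_mul, ← integral_const_mul]
    congr 1; ext η
    rw [hΘa, hΘ]
    have e1 : ν⁻¹ • ((2 * π) • ((2 * π)⁻¹ • v + (ν / (2 * π)) • η) - v) = η := by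
      rw [smul_add, smul_smul, smul_smul, mul_inv_cancel₀ hpi.ne', one_smul, add_sub_cancel_left,
        smul_smul]
      rw [show ν⁻¹ * (2 * π * (ν / (2 * π))) = 1 by field_simp, one_smul]
    simp only [e1]
    have e2 : Complex.exp (((2 * π * ⟪(2 * π)⁻¹ • v + (ν / (2 * π)) • η, x⟫ : ℝ) : ℂ) * Complex.I) =
        Complex.exp (Complex.I * ((⟪x, v⟫ : ℝ) : ℂ)) *
          Complex.exp (Complex.I * ((⟪ν • x, η⟫ : ℝ) : ℂ)) := by
      rw [← Complex.exp_add]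
      congr 1
      rw [inner_add_left, inner_smul_left, inner_smul_left, inner_smul_left, real_inner_comm x v,
        real_inner_comm x η]
      simp only [conj_trivial]
      push_cast
      field_simp
    rw [e2, smul_eq_mul]
    have e3 : (((ν / (2 * π)) ^ n : ℝ) : ℂ) * (((2 * π / ν) ^ n : ℝ) : ℂ) = 1 := by
      rw [← Complex.ofReal_mul, ← mul_pow, show ν / (2 * π) * (2 * π / ν) = 1 by field_simp]
      simp
    linear_combination (Complex.exp (Complex.I * ((⟪x, v⟫ : ℝ) : ℂ)) *
          Complex.exp (Complex.I * ((⟪ν • x, η⟫ : ℝ) : ℂ)) * ψ η) * e3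
  · have hFT : ∀ ξ, FT (⇑(𝓕⁻ Θs : SchwartzMap (Eu n) ℂ)) ξ = Θ ((2 * π)⁻¹ • ξ) := by
      intro ξ
      have h1 : 𝓕 (⇑(𝓕⁻ Θs : SchwartzMap (Eu n) ℂ)) ((2 * π)⁻¹ • ξ) = Θ ((2 * π)⁻¹ • ξ) := by
        rw [← SchwartzMap.fourier_coe, FourierTransform.fourier_fourierInv_eq]; rfl
      rw [← h1, Real.fourier_eq', FT]
      congr 1; ext y
      rw [smul_eq_mul, mul_comm]
      congr 2
      rw [inner_smul_right]
      push_cast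
      field_simp
    rw [Js]
    simp only [hFT]
    rw [kp_cov _ v hν, kpIF, ← integral_const_mul, ← integral_const_mul, ← integral_const_mul]
    congr 1; ext η
    rw [hΘ]
    have e1 : ν⁻¹ • ((2 * π) • ((2 * π)⁻¹ • (v + ν • η)) - v) = η := by
      rw [smul_smul, mul_inv_cancel₀ hpi.ne', one_smul, add_sub_cancel_left,
        smul_smul, inv_mul_cancel₀ hν.ne', one_smul]
    simp only [e1]
    have e2 : Complex.exp (Complex.I * ((⟪x, v + ν • η⟫ : ℝ) : ℂ)) =
        Complex.exp (Complex.I * ((⟪x, v⟫ : ℝ) : ℂ)) *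
          Complex.exp (Complex.I * ((⟪ν • x, η⟫ : ℝ) : ℂ)) := by
      rw [← Complex.exp_add]
      congr 1
      rw [inner_add_right, inner_smul_left, inner_smul_right]
      simp only [conj_trivial]
      push_cast
      ring
    rw [e2]
    have e3 : ((((2 * π) ^ n)⁻¹ : ℝ) : ℂ) * ((ν ^ n : ℝ) : ℂ) * (((2 * π / ν) ^ n : ℝ) : ℂ) = 1 := by
      rw [← Complex.ofReal_mul, ← Complex.ofReal_mul, div_pow]
      rw [show ((2 * π) ^ n)⁻¹ * ν ^ n * ((2 * π) ^ n / ν ^ n) = 1 by field_simp]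
      simp
    linear_combination (Complex.exp (Complex.I * ((⟪x, v⟫ : ℝ) : ℂ)) *
          Complex.exp (Complex.I * ((⟪ν • x, η⟫ : ℝ) : ℂ)) * ψ η *
          (((1 + ‖v + ν • η‖ ^ 2) ^ (s / 2) : ℝ) : ℂ)) * e3

lemma kpIF_continuous {n : ℕ} {Ψ : Eu n → ℂ} (h : Integrable Ψ) : Continuous (kpIF Ψ) := by
  refine continuous_of_dominated (bound := fun ξ => ‖Ψ ξ‖) ?_ ?_ h.norm ?_
  · intro x
    exact h.1.mul (Continuous.aestronglyMeasurable (by fun_prop))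
  · intro x
    refine Eventually.of_forall fun ξ => ?_
    rw [norm_mul, Complex.norm_exp_I_mul_ofReal, mul_one]
  · refine Eventually.of_forall fun ξ => ?_
    fun_prop

lemma kpIF_norm_le {n : ℕ} (Ψ : Eu n → ℂ) (x : Eu n) : ‖kpIF Ψ x‖ ≤ ∫ ξ, ‖Ψ ξ‖ := by
  refine (norm_integral_le_integral_norm _).trans (le_of_eq ?_)
  congr 1; ext ξ
  rw [norm_mul, Complex.norm_exp_I_mul_ofReal, mul_one]

lemma kp_bump (n : ℕ) : ∃ (ψ : Eu n → ℂ) (χ h : Eu n → ℝ),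
    ContDiff ℝ ∞ ψ ∧ HasCompactSupport ψ ∧ (∀ ξ, 1 / 2 < ‖ξ‖ → ψ ξ = 0) ∧
    ContDiff ℝ ∞ χ ∧ HasCompactSupport χ ∧ (∀ ξ, 0 ≤ χ ξ) ∧
    Continuous h ∧ (∀ x, 0 ≤ h x) ∧ 0 < h 0 ∧
    (∀ x, kpIF (fun ξ => (χ ξ : ℂ)) x = h x) ∧ ∀ x, kpIF ψ x * kpIF ψ x = h x := by
  let b : ContDiffBump (0 : Eu n) := ⟨1 / 4, 1 / 2, by norm_num, by norm_num⟩
  have hbs : ContDiff ℝ ∞ b := b.contDiff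
  have hbc : HasCompactSupport b := b.hasCompactSupport
  set ψ : Eu n → ℂ := fun ξ => (b ξ : ℂ) with hψ
  have hψs : ContDiff ℝ ∞ ψ := Complex.ofRealCLM.contDiff.comp hbs
  have hψc : HasCompactSupport ψ := hbc.comp_left (g := fun r : ℝ => (r : ℂ)) Complex.ofReal_zero
  have hψi : Integrable ψ := hψs.continuous.integrable_of_hasCompactSupport hψc
  set χ : Eu n → ℝ := (b : Eu n → ℝ) ⋆[ContinuousLinearMap.mul ℝ ℝ, volume] (b : Eu n → ℝ) with hχ
  have hreal : ∀ x, ((kpIF ψ x).re : ℂ) = kpIF ψ x := by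
    intro x
    rw [← Complex.conj_eq_iff_re, kpIF, ← integral_conj, ← integral_neg_eq_self]
    congr 1; ext ξ
    rw [map_mul, ← Complex.exp_conj, map_mul, Complex.conj_I, Complex.conj_ofReal, hψ]
    simp only [ContDiffBump.neg, Complex.conj_ofReal, inner_neg_right]
    push_cast
    ring_nf
  have hsq : ∀ x, kpIF ψ x * kpIF ψ x = (((kpIF ψ x).re ^ 2 : ℝ) : ℂ) := by
    intro x
    push_cast
    rw [hreal]; ring
  refine ⟨ψ, χ, fun x => (kpIF ψ x).re ^ 2, hψs, hψc, ?_, ?_, ?_, ?_, ?_, ?_, ?_, ?_, hsq⟩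
  · intro ξ hξ
    have : b ξ = 0 := b.zero_of_le_dist (by rw [dist_zero_right]; exact hξ.le)
    simp [hψ, this]
  · exact hbc.contDiff_convolution_right _ hbs.continuous.locallyIntegrable hbs
  · exact hbc.convolution _ hbc
  · intro ξ
    rw [hχ, convolution_def]
    exact integral_nonneg fun t => mul_nonneg b.nonneg b.nonneg
  · exact (Complex.continuous_re.comp (kpIF_continuous hψi)).pow 2
  · intro x; positivity
  · have h0 : kpIF ψ 0 = ((∫ ξ, b ξ : ℝ) : ℂ) := by
      rw [kpIF, ← integral_complex_ofReal]
      simp [hψ]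
    change 0 < (kpIF ψ 0).re ^ 2
    rw [h0, Complex.ofReal_re]
    have := b.integral_pos (μ := volume)
    positivity
  · intro x
    rw [← hsq x]
    have hi : Integrable (fun ξ => ψ ξ * Complex.exp (Complex.I * ((⟪x, ξ⟫ : ℝ) : ℂ))) :=
      (by fun_prop : Continuous _).integrable_of_hasCompactSupport hψc.mul_right
    have hc := integral_convolution (μ := volume) (ν := volume) (ContinuousLinearMap.mul ℝ ℂ) hi hi
    rw [ContinuousLinearMap.mul_apply'] at hc
    rw [kpIF, kpIF, ← hc]
    congr 1; ext ξ
    rw [hχ, convolution_def, convolution_def, ← integral_complex_ofReal, ← integral_mul_const]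
    congr 1; ext t
    simp only [ContinuousLinearMap.mul_apply', hψ]
    have e2 : Complex.exp (Complex.I * ((⟪x, ξ⟫ : ℝ) : ℂ)) =
        Complex.exp (Complex.I * ((⟪x, t⟫ : ℝ) : ℂ)) *
          Complex.exp (Complex.I * ((⟪x, ξ - t⟫ : ℝ) : ℂ)) := by
      rw [← Complex.exp_add]
      congr 1
      rw [inner_sub_right]
      push_cast
      ring
    rw [e2]
    push_cast
    ring


/-! ### Upper bounds -/

lemma kp_family {n : ℕ} {ψ : Eu n → ℂ} (hψ : ContDiff ℝ ∞ ψ)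
    (hψ0 : ∀ ξ, 1 / 2 < ‖ξ‖ → ψ ξ = 0) {e : Eu n} (he : ‖e‖ = 1) (s : ℝ) (M : ℕ) :
    ∃ A : ℝ, 0 ≤ A ∧ ∀ ε ∈ Icc (0:ℝ) 1, ∀ δ ∈ Icc (0:ℝ) 1, ∀ x : Eu n,
      ‖kpIF (fun η => (((ε ^ 2 + ‖e + δ • η‖ ^ 2) ^ (s / 2) : ℝ) : ℂ) * ψ η) x‖ ≤
        A * ((1 + ‖x‖) ^ M)⁻¹ := by
  set G : (ℝ × ℝ) × Eu n → ℂ := fun z =>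
    (((z.1.1 ^ 2 + ‖e + Real.sin z.1.2 • z.2‖ ^ 2) ^ (s / 2) : ℝ) : ℂ) * ψ z.2 with hGdef
  have hG : ContDiff ℝ ∞ G := by
    rw [contDiff_iff_contDiffAt]
    intro z
    by_cases hz : ‖z.2‖ < 1
    · apply ContDiffAt.mul
      · apply Complex.ofRealCLM.contDiff.contDiffAt.comp
        apply ContDiffAt.rpow_const_of_ne
        · apply ContDiff.contDiffAt
          apply ContDiff.add (by fun_prop)
          apply ContDiff.norm_sq ℝ
          apply ContDiff.add contDiff_const
          exact ContDiff.smul (Real.contDiff_sin.comp (by fun_prop)) (by fun_prop)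
        · have h1 : ‖Real.sin z.1.2 • z.2‖ < 1 := by
            rw [norm_smul, Real.norm_eq_abs]
            have := Real.abs_sin_le_one z.1.2
            nlinarith [norm_nonneg z.2]
          have h2 : 0 < ‖e + Real.sin z.1.2 • z.2‖ := by
            have := norm_sub_le (e + Real.sin z.1.2 • z.2) (Real.sin z.1.2 • z.2)
            rw [add_sub_cancel_right, he] at this
            linarith
          positivity
      · exact (hψ.comp (by fun_prop)).contDiffAt
    · have : G =ᶠ[𝓝 z] fun _ => 0 := by
        have ho : IsOpen {z : (ℝ × ℝ) × Eu n | 1 / 2 < ‖z.2‖} :=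
          isOpen_lt continuous_const (by fun_prop)
        filter_upwards [ho.mem_nhds (show 1 / 2 < ‖z.2‖ by linarith [not_lt.1 hz])] with w hw
        simp [hGdef, hψ0 _ hw]
      exact contDiffAt_const.congr_of_eventuallyEq this
  obtain ⟨A, hA, h⟩ := kp_decay (S := Icc (0:ℝ) 1 ×ˢ Icc (-(π / 2)) (π / 2))
    (isCompact_Icc.prod isCompact_Icc) hG (1 / 2)
    (fun p ξ hξ => by simp [hGdef, hψ0 _ hξ]) M
  refine ⟨A, hA, fun ε hε δ hδ x => ?_⟩
  have := h (ε, Real.arcsin δ) ⟨hε, Real.arcsin_mem_Icc δ⟩ x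
  simpa only [hGdef, Real.sin_arcsin (by linarith [hδ.1]) hδ.2] using this

lemma kp_upper {n : ℕ} {ψ : Eu n → ℂ} (hψ : ContDiff ℝ ∞ ψ)
    (hψ0 : ∀ ξ, 1 / 2 < ‖ξ‖ → ψ ξ = 0) {e : Eu n} (he : ‖e‖ = 1) (s : ℝ)
    {q : ℝ≥0∞} (hq : q ≠ 0) {b : ℝ} (hb : 0 ≤ b) :
    ∃ D : ℝ≥0∞, D ≠ ⊤ ∧ ∀ N ν : ℝ, 1 ≤ ν → ν ≤ N →
      wNorm q b (fun x => Complex.exp (Complex.I * ((⟪x, N • e⟫ : ℝ) : ℂ)) *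
        kpIF (fun η => (((1 + ‖N • e + ν • η‖ ^ 2) ^ (s / 2) : ℝ) : ℂ) * ψ η) (ν • x)) ≤
      ENNReal.ofReal (ν ^ (-((n : ℝ) * (1 / q.toReal)))) * (ENNReal.ofReal (N ^ s) * D) := by
  obtain ⟨K, M, hK, hKM⟩ := kp_wNorm_le (n := n) hq hb
  obtain ⟨A, hA, hAM⟩ := kp_family hψ hψ0 he s M
  refine ⟨ENNReal.ofReal A * K, ENNReal.mul_ne_top ENNReal.ofReal_ne_top hK, fun N ν hν hN => ?_⟩
  have hN0 : 0 < N := by linarith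
  have hν0 : 0 < ν := by linarith
  have heq : ∀ x, kpIF (fun η => (((1 + ‖N • e + ν • η‖ ^ 2) ^ (s / 2) : ℝ) : ℂ) * ψ η) x =
      ((N ^ s : ℝ) : ℂ) *
        kpIF (fun η => ((((1 / N) ^ 2 + ‖e + (ν / N) • η‖ ^ 2) ^ (s / 2) : ℝ) : ℂ) * ψ η) x := by
    intro x
    rw [kpIF, kpIF, ← integral_const_mul]
    congr 1; ext η
    have e1 : N • e + ν • η = N • (e + (ν / N) • η) := by
      rw [smul_add, smul_smul, mul_div_cancel₀ _ hN0.ne']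
    have e2 : (1 + ‖N • e + ν • η‖ ^ 2) ^ (s / 2) =
        N ^ s * ((1 / N) ^ 2 + ‖e + (ν / N) • η‖ ^ 2) ^ (s / 2) := by
      rw [e1, norm_smul, Real.norm_of_nonneg hN0.le]
      have : 1 + (N * ‖e + (ν / N) • η‖) ^ 2 =
          N ^ 2 * ((1 / N) ^ 2 + ‖e + (ν / N) • η‖ ^ 2) := by
        field_simp
      rw [this, Real.mul_rpow (by positivity) (by positivity)]
      congr 1
      rw [← Real.rpow_natCast, ← Real.rpow_mul hN0.le]
      congr 1; push_cast; ring
    rw [e2]; push_cast; ring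
  set U : Eu n → ℂ := kpIF (fun η => ((((1 / N) ^ 2 + ‖e + (ν / N) • η‖ ^ 2) ^ (s / 2) : ℝ) : ℂ) * ψ η)
    with hU
  rw [kp_wNorm_congr q b (V := fun x => (fun y => ((N ^ s : ℝ) : ℂ) * U y) (ν • x))]
  · refine (kp_wNorm_scale_le hq hb (fun y => ((N ^ s : ℝ) : ℂ) * U y) hν).trans ?_
    rw [kp_wNorm_const_mul hq b U (by positivity)]
    gcongr
    apply hKM _ _ hA
    intro x
    refine hAM _ ⟨by positivity, ?_⟩ _ ⟨by positivity, ?_⟩ x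
    · rw [div_le_one hN0]; linarith
    · rw [div_le_one hN0]; linarith
  · intro x
    rw [norm_mul, Complex.norm_exp_I_mul_ofReal, one_mul, heq]

lemma kp_core {n : ℕ} (hn : 1 ≤ n) {p p₁ p₂ : ℝ≥0∞} {a a₁ a₂ s : ℝ}
    (hp : 2⁻¹ ≤ p) (hp1 : 1 ≤ p₁) (hp2 : 1 ≤ p₂)
    (ha : 0 ≤ a) (ha1 : 0 ≤ a₁) (ha2 : 0 ≤ a₂)
    (hexp : 1 / p = 1 / p₁ + 1 / p₂) {C : ℝ}
    (hC : ∀ f g : SchwartzMap (Eu n) ℂ,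
      wNorm p a (Js s (fun x => f x * g x)) ≤
        ENNReal.ofReal C *
          (wNorm p₁ a₁ (Js s ⇑f) * wNorm p₂ a₂ ⇑g +
            wNorm p₁ a₁ ⇑f * wNorm p₂ a₂ (Js s ⇑g)))
    {ψ : Eu n → ℂ} {χ h : Eu n → ℝ} (hψ : ContDiff ℝ ∞ ψ) (hψc : HasCompactSupport ψ)
    (hψ0 : ∀ ξ, 1 / 2 < ‖ξ‖ → ψ ξ = 0) (hχ : ContDiff ℝ ∞ χ) (hχc : HasCompactSupport χ)
    (hχh : ∀ x, kpIF (fun ξ => (χ ξ : ℂ)) x = h x) (hψh : ∀ x, kpIF ψ x * kpIF ψ x = h x) :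
    ∃ D : ℝ≥0∞, D ≠ ⊤ ∧ ∀ N ν : ℝ, 1 ≤ ν → ν ≤ N →
      wNorm p 0 (kpIF (fun η => ((((1 / ν) ^ 2 + ‖η‖ ^ 2) ^ (s / 2) : ℝ) : ℂ) * (χ η : ℂ))) ≤
        ENNReal.ofReal ((N / ν) ^ s) * D := by
  have hp0 : p ≠ 0 := by
    rintro rfl
    simp at hp
  have hp10 : p₁ ≠ 0 := by rintro rfl; simp at hp1
  have hp20 : p₂ ≠ 0 := by rintro rfl; simp at hp2
  have hr : 1 / p.toReal = 1 / p₁.toReal + 1 / p₂.toReal := by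
    have h1 := congrArg ENNReal.toReal hexp
    rw [ENNReal.toReal_add (by simp [hp10]) (by simp [hp20])] at h1
    simpa [ENNReal.toReal_div] using h1
  set e : Eu n := EuclideanSpace.single ⟨0, hn⟩ 1 with he'
  have he : ‖e‖ = 1 := by simp [he']
  have hen : ‖-e‖ = 1 := by rw [norm_neg, he]
  obtain ⟨D1, hD1, H1⟩ := kp_upper hψ hψ0 he s hp10 ha1
  obtain ⟨D1', hD1', H1'⟩ := kp_upper hψ hψ0 he 0 hp10 ha1
  obtain ⟨D2, hD2, H2⟩ := kp_upper hψ hψ0 hen s hp20 ha2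
  obtain ⟨D2', hD2', H2'⟩ := kp_upper hψ hψ0 hen 0 hp20 ha2
  refine ⟨ENNReal.ofReal C * (D1 * D2' + D1' * D2), ?_, fun N ν hν hN => ?_⟩
  · exact ENNReal.mul_ne_top ENNReal.ofReal_ne_top (ENNReal.add_ne_top.2
      ⟨ENNReal.mul_ne_top hD1 hD2', ENNReal.mul_ne_top hD1' hD2⟩)
  have hν0 : 0 < ν := by linarith
  have hN0 : 0 < N := by linarith
  obtain ⟨f, hf, hJf⟩ := kp_schwartz hψ hψc (N • e) hν0
  obtain ⟨g, hg, hJg⟩ := kp_schwartz hψ hψc (N • (-e)) hν0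
  have hχs : ContDiff ℝ ∞ (fun ξ => (χ ξ : ℂ)) := Complex.ofRealCLM.contDiff.comp hχ
  have hχcc : HasCompactSupport (fun ξ => (χ ξ : ℂ)) :=
    hχc.comp_left (g := fun r : ℝ => (r : ℂ)) Complex.ofReal_zero
  obtain ⟨k, hk, hJk⟩ := kp_schwartz hχs hχcc 0 hν0
  have hfg : (fun x => f x * g x) = ⇑k := by
    ext x
    rw [hf, hg, hk, hχh, ← hψh]
    have : Complex.exp (Complex.I * ((⟪x, N • e⟫ : ℝ) : ℂ)) *
        Complex.exp (Complex.I * ((⟪x, N • (-e)⟫ : ℝ) : ℂ)) = 1 := by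
      rw [← Complex.exp_add, smul_neg, inner_neg_right]
      simp
    simp only [inner_zero_right, Complex.ofReal_zero, mul_zero, Complex.exp_zero]
    linear_combination (kpIF ψ (ν • x) * kpIF ψ (ν • x)) * this
  have hin := hC f g
  rw [hfg] at hin
  have hJf' : Js s ⇑f = _ := funext (hJf s)
  have hJg' : Js s ⇑g = _ := funext (hJg s)
  have b1 := H1 N ν hν hN
  rw [← hJf'] at b1
  have b2 := H2 N ν hν hN
  rw [← hJg'] at b2
  have b1' := H1' N ν hν hN
  have b2' := H2' N ν hν hN
  simp only [zero_div, Real.rpow_zero, Complex.ofReal_one, one_mul, ENNReal.ofReal_one] at b1' b2'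
  have hf' : ⇑f = _ := funext hf
  have hg' : ⇑g = _ := funext hg
  rw [show (fun η => ψ η) = ψ from rfl, ← hf'] at b1'
  rw [show (fun η => ψ η) = ψ from rfl, ← hg'] at b2'
  set T := kpIF (fun η => ((((1 / ν) ^ 2 + ‖η‖ ^ 2) ^ (s / 2) : ℝ) : ℂ) * (χ η : ℂ)) with hT
  have hlow : ENNReal.ofReal (ν ^ (-((n : ℝ) * (1 / p.toReal)))) * (ENNReal.ofReal (ν ^ s) * wNorm p 0 T) ≤
      wNorm p a (Js s ⇑k) := by
    have : Js s ⇑k = fun x => (fun y => ((ν ^ s : ℝ) : ℂ) * T y) (ν • x) := by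
      ext x
      rw [hJk]
      simp only [inner_zero_right, Complex.ofReal_zero, mul_zero, Complex.exp_zero, one_mul, zero_add]
      rw [hT, kpIF, kpIF, ← integral_const_mul]
      congr 1; ext η
      have e2 : (1 + ‖ν • η‖ ^ 2) ^ (s / 2) = ν ^ s * ((1 / ν) ^ 2 + ‖η‖ ^ 2) ^ (s / 2) := by
        rw [norm_smul, Real.norm_of_nonneg hν0.le]
        have : 1 + (ν * ‖η‖) ^ 2 = ν ^ 2 * ((1 / ν) ^ 2 + ‖η‖ ^ 2) := by
          field_simp
        rw [this, Real.mul_rpow (by positivity) (by positivity)]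
        congr 1
        rw [← Real.rpow_natCast, ← Real.rpow_mul hν0.le]
        congr 1; push_cast; ring
      rw [e2]; push_cast; ring
    rw [this, ← kp_wNorm_const_mul hp0 0 T (by positivity)]
    exact kp_wNorm_scale_ge hp0 ha _ hν
  have hfin := hlow.trans (hin.trans (mul_le_mul' le_rfl
    (add_le_add (mul_le_mul' b1 b2') (mul_le_mul' b1' b2))))
  set c := ENNReal.ofReal (ν ^ (-((n : ℝ) * (1 / p.toReal)))) with hc
  set c1 := ENNReal.ofReal (ν ^ (-((n : ℝ) * (1 / p₁.toReal)))) with hc1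
  set c2 := ENNReal.ofReal (ν ^ (-((n : ℝ) * (1 / p₂.toReal)))) with hc2
  have hcc : c1 * c2 = c := by
    rw [hc, hc1, hc2, ← ENNReal.ofReal_mul (by positivity), ← Real.rpow_add hν0, hr]
    congr 2; ring
  have hc0 : c ≠ 0 := by
    rw [hc, ne_eq, ENNReal.ofReal_eq_zero, not_le]; positivity
  have hct : c ≠ ⊤ := ENNReal.ofReal_ne_top
  have hs0 : ENNReal.ofReal (ν ^ s) ≠ 0 := by
    rw [ne_eq, ENNReal.ofReal_eq_zero, not_le]; positivity
  have hNs : ENNReal.ofReal (N ^ s) = ENNReal.ofReal (ν ^ s) * ENNReal.ofReal ((N / ν) ^ s) := by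
    rw [← ENNReal.ofReal_mul (by positivity), Real.div_rpow hN0.le hν0.le]
    congr 1; field_simp
  rw [hNs] at hfin
  have hfin2 : (c * ENNReal.ofReal (ν ^ s)) * wNorm p 0 T ≤ (c * ENNReal.ofReal (ν ^ s)) *
      (ENNReal.ofReal ((N / ν) ^ s) * (ENNReal.ofReal C * (D1 * D2' + D1' * D2))) := by
    refine le_trans (le_of_eq (by ring)) (hfin.trans (le_of_eq ?_))
    rw [← hcc]
    ring
  exact (ENNReal.mul_le_mul_iff_right (mul_ne_zero hc0 hs0) (ENNReal.mul_ne_top hct ENNReal.ofReal_ne_top)).1 hfin2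


/-- Gaussian identity. -/
lemma kp_gauss {n : ℕ} {t : ℝ} (ht : 0 < t) (η : Eu n) :
    ((Real.exp (-t * ‖η‖ ^ 2) : ℝ) : ℂ) = (((4 * π * t) ^ (-(n : ℝ) / 2) : ℝ) : ℂ) *
      ∫ y : Eu n, cexp (-((1 / (4 * t) : ℝ) : ℂ) * ‖y‖ ^ 2 + I * ((⟪η, y⟫ : ℝ) : ℂ)) := by
  have hb : 0 < (((1 / (4 * t) : ℝ) : ℂ)).re := by
    rw [Complex.ofReal_re]; positivity
  rw [GaussianFourier.integral_cexp_neg_mul_sq_norm_add hb I η]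
  have h1 : ((π : ℂ) / ((1 / (4 * t) : ℝ) : ℂ)) = ((4 * π * t : ℝ) : ℂ) := by
    rw [← Complex.ofReal_div]; congr 1; field_simp
  have h2 : ((Module.finrank ℝ (Eu n) : ℂ) / 2) = (((n : ℝ) / 2 : ℝ) : ℂ) := by
    simp
  rw [h1, h2, ← Complex.ofReal_cpow (by positivity), ← mul_assoc, ← Complex.ofReal_mul,
    ← Real.rpow_add (by positivity), Complex.ofReal_exp]
  have h3 : -(n : ℝ) / 2 + (n : ℝ) / 2 = 0 := by ring
  rw [h3, Real.rpow_zero, Complex.ofReal_one, one_mul, Complex.I_sq]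
  congr 1
  have : (t : ℂ) ≠ 0 := by exact_mod_cast ht.ne'
  push_cast
  field_simp

lemma kp_heat {n : ℕ} {χ h : Eu n → ℝ} (hχ : ContDiff ℝ ∞ χ) (hχc : HasCompactSupport χ)
    (hχh : ∀ x, kpIF (fun ξ => (χ ξ : ℂ)) x = h x) {t : ℝ} (ht : 0 < t) (x : Eu n) :
    kpIF (fun η => ((Real.exp (-t * ‖η‖ ^ 2) : ℝ) : ℂ) * (χ η : ℂ)) x =
      (((4 * π * t) ^ (-(n : ℝ) / 2) *
        ∫ y, Real.exp (-(1 / (4 * t)) * ‖y - x‖ ^ 2) * h y : ℝ) : ℂ) := by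
  set b : ℝ := 1 / (4 * t) with hbdef
  have hb : 0 < b := by positivity
  have hχi : Integrable (fun ξ => (χ ξ : ℂ)) :=
    (hχ.continuous.integrable_of_hasCompactSupport hχc).ofReal
  have hg : Integrable (fun y : Eu n => cexp (-(b : ℂ) * ‖y‖ ^ 2)) := by
    simpa using GaussianFourier.integrable_cexp_neg_mul_sq_norm_add (V := Eu n) (b := (b : ℂ))
      (by simpa using hb) 0 0
  have e1 : ∀ η : Eu n, ((Real.exp (-t * ‖η‖ ^ 2) : ℝ) : ℂ) * (χ η : ℂ) *
      cexp (I * ((⟪x, η⟫ : ℝ) : ℂ)) = (((4 * π * t) ^ (-(n : ℝ) / 2) : ℝ) : ℂ) *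
      ∫ y : Eu n, (χ η : ℂ) * cexp (-(b : ℂ) * ‖y‖ ^ 2) * cexp (I * ((⟪x + y, η⟫ : ℝ) : ℂ)) := by
    intro η
    rw [kp_gauss ht, ← hbdef, mul_assoc, mul_assoc, ← integral_mul_const]
    congr 2
    ext y
    rw [Complex.exp_add, inner_add_left, real_inner_comm η y]
    push_cast
    rw [mul_add, Complex.exp_add]
    ring
  unfold kpIF at hχh ⊢
  simp_rw [e1]
  rw [integral_const_mul, integral_integral_swap]
  · have e2 : ∀ y : Eu n, ∫ η, (χ η : ℂ) * cexp (-(b : ℂ) * ‖y‖ ^ 2) *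
        cexp (I * ((⟪x + y, η⟫ : ℝ) : ℂ)) = ((Real.exp (-b * ‖y‖ ^ 2) * h (x + y) : ℝ) : ℂ) := by
      intro y
      push_cast
      rw [← hχh, ← integral_const_mul]
      congr 1
      ext η
      ring
    simp_rw [e2]
    rw [integral_complex_ofReal, ← Complex.ofReal_mul]
    congr 2
    rw [← integral_sub_right_eq_self (fun y => Real.exp (-b * ‖y‖ ^ 2) * h (x + y)) x]
    simp
  · have := hχi.mul_prod hg
    refine this.mono ?_ (ae_of_all _ fun z => ?_)
    · have := hχ.continuous
      apply Continuous.aestronglyMeasurable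
      unfold Function.uncurry
      fun_prop
    · simp only [Function.uncurry]
      rw [norm_mul _ (cexp (I * _)), mul_comm I, Complex.norm_exp_ofReal_mul_I, mul_one]

lemma kp_swap {n : ℕ} {χ : Eu n → ℝ} (hχ : ContDiff ℝ ∞ χ) (hχc : HasCompactSupport χ)
    {α : ℝ} (hα : 0 < α) (x : Eu n) :
    Integrable (Function.uncurry fun (η : Eu n) (t : ℝ) => (((Real.exp (-t * ‖η‖ ^ 2) * t ^ (-α - 1) : ℝ) : ℂ)) * (χ η : ℂ) *
        cexp (I * ((⟪x, η⟫ : ℝ) : ℂ))) (volume.prod (volume.restrict (Ioi 1))) := by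
  have hχi : Integrable (fun ξ => (χ ξ : ℂ)) :=
    (hχ.continuous.integrable_of_hasCompactSupport hχc).ofReal
  have ht : Integrable (fun t : ℝ => ((t ^ (-α - 1) : ℝ) : ℂ)) (volume.restrict (Ioi 1)) :=
    (integrableOn_Ioi_rpow_of_lt (by linarith) one_pos).ofReal
  have := hχi.mul_prod ht
  refine this.mono ?_ ?_
  · have := hχ.continuous
    apply Measurable.aestronglyMeasurable
    unfold Function.uncurry
    fun_prop
  · have : ∀ᵐ z ∂((volume : Measure (Eu n)).prod (volume.restrict (Ioi (1:ℝ)))), z.2 ∈ Ioi (1:ℝ) := by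
      have h0 : ∀ᵐ t ∂(volume.restrict (Ioi (1:ℝ))), t ∈ Ioi (1:ℝ) := ae_restrict_mem measurableSet_Ioi
      exact Measure.quasiMeasurePreserving_snd.ae h0
    filter_upwards [this] with z hz
    simp only [Function.uncurry]
    rw [norm_mul _ (cexp (I * _)), mul_comm I, Complex.norm_exp_ofReal_mul_I, mul_one,
      norm_mul, norm_mul, mul_comm]
    gcongr
    rw [Complex.norm_real, Complex.norm_real, norm_mul]
    have hz' : (1:ℝ) < z.2 := hz
    have : ‖Real.exp (-z.2 * ‖z.1‖ ^ 2)‖ ≤ 1 := by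
      rw [Real.norm_eq_abs, Real.abs_exp]
      apply Real.exp_le_one_iff.2
      have : 0 ≤ z.2 * ‖z.1‖ ^ 2 := by positivity
      linarith
    exact mul_le_of_le_one_left (norm_nonneg _) this

lemma kp_identity {n : ℕ} (hn : 1 ≤ n) {χ : Eu n → ℝ} (hχ : ContDiff ℝ ∞ χ) (hχc : HasCompactSupport χ)
    {α : ℝ} (hα : 0 < α) {c : ℝ} {W : ℝ → ℝ} (hW : ContDiff ℝ ∞ W)
    (hcW : ∀ y > 0, c * y ^ α = W y + kpI α y) (x : Eu n) :
    (c : ℂ) * kpIF (fun η => (((‖η‖ ^ 2) ^ α : ℝ) : ℂ) * (χ η : ℂ)) x =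
      kpIF (fun η => ((W (‖η‖ ^ 2) : ℝ) : ℂ) * (χ η : ℂ)) x +
      ∫ t in Ioi (1:ℝ), ((t ^ (-α - 1) : ℝ) : ℂ) *
        kpIF (fun η => ((Real.exp (-t * ‖η‖ ^ 2) : ℝ) : ℂ) * (χ η : ℂ)) x := by
  have hsw := kp_swap hχ hχc hα x
  have : Nontrivial (Eu n) := by
    have : Nonempty (Fin n) := ⟨⟨0, hn⟩⟩
    infer_instance
  have e3 : ∫ t in Ioi (1:ℝ), ((t ^ (-α - 1) : ℝ) : ℂ) *
        kpIF (fun η => ((Real.exp (-t * ‖η‖ ^ 2) : ℝ) : ℂ) * (χ η : ℂ)) x =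
      ∫ η, ∫ t in Ioi (1:ℝ), (((Real.exp (-t * ‖η‖ ^ 2) * t ^ (-α - 1) : ℝ) : ℂ)) * (χ η : ℂ) *
        cexp (I * ((⟪x, η⟫ : ℝ) : ℂ)) := by
    rw [integral_integral_swap hsw]
    congr 1
    ext t
    unfold kpIF
    rw [← integral_const_mul]
    congr 1
    ext η
    push_cast
    ring
  rw [e3]
  unfold kpIF
  rw [← integral_const_mul, ← integral_add]
  · apply integral_congr_ae
    have h0 : ∀ᵐ η : Eu n, η ≠ 0 := by
      simp [ae_iff, measure_singleton]
    filter_upwards [h0] with η hη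
    have hpos : 0 < ‖η‖ ^ 2 := by positivity
    have := hcW _ hpos
    rw [integral_mul_const, integral_mul_const, integral_complex_ofReal]
    have e4 : ∫ t in Ioi (1:ℝ), Real.exp (-t * ‖η‖ ^ 2) * t ^ (-α - 1) = kpI α (‖η‖ ^ 2) := rfl
    rw [e4, ← mul_assoc, ← mul_assoc, ← Complex.ofReal_mul, this]
    push_cast
    ring
  · have hc := hχ.continuous
    have hw := hW.continuous
    apply Continuous.integrable_of_hasCompactSupport
    · fun_prop
    · have : HasCompactSupport (fun η => (χ η : ℂ)) := hχc.comp_left (g := fun r : ℝ => (r:ℂ)) (by simp)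
      exact (this.mul_left).mul_right
  · exact hsw.integral_prod_left


lemma kp_tail {n : ℕ} {χ h : Eu n → ℝ} (hχ : ContDiff ℝ ∞ χ) (hχc : HasCompactSupport χ)
    (hh : Continuous h) (hh0 : ∀ x, 0 ≤ h x) (hhp : 0 < h 0)
    (hχh : ∀ x, kpIF (fun ξ => (χ ξ : ℂ)) x = h x) {α : ℝ} (hα : 0 < α) :
    ∃ c' : ℝ, 0 < c' ∧ ∀ x : Eu n, 1 ≤ ‖x‖ → c' * ‖x‖ ^ (-((n : ℝ) + 2 * α)) ≤
      ‖∫ t in Ioi (1:ℝ), ((t ^ (-α - 1) : ℝ) : ℂ) *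
        kpIF (fun η => ((Real.exp (-t * ‖η‖ ^ 2) : ℝ) : ℂ) * (χ η : ℂ)) x‖ := by
  obtain ⟨B, hB⟩ : ∃ B, ∀ y, ‖h y‖ ≤ B := by
    refine ⟨∫ ξ, ‖(χ ξ : ℂ)‖, fun y => ?_⟩
    have := kpIF_norm_le (fun ξ => (χ ξ : ℂ)) y
    rw [hχh, Complex.norm_real] at this
    exact this
  have hgi : ∀ b : ℝ, 0 < b → ∀ x : Eu n, Integrable (fun y : Eu n => Real.exp (-b * ‖y - x‖ ^ 2) * h y) := by
    intro b hb x
    have hg : Integrable (fun y : Eu n => Real.exp (-b * ‖y‖ ^ 2)) := by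
      have := (GaussianFourier.integrable_cexp_neg_mul_sq_norm_add (V := Eu n) (b := (b : ℂ))
        (by simpa using hb) 0 0).norm
      refine this.congr (ae_of_all _ fun y => ?_)
      simp only [zero_mul, add_zero]
      rw [Complex.norm_exp]
      congr 1
      rw [← Complex.ofReal_pow, ← Complex.ofReal_neg, ← Complex.ofReal_mul, Complex.ofReal_re]
    exact (hg.comp_sub_right x).mul_bdd (c := B) hh.aestronglyMeasurable (ae_of_all _ hB)
  set c0 : ℝ := Real.exp (-1/2) * ∫ y, Real.exp (-(1/2) * ‖y - 0‖ ^ 2) * h y with hc0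
  have hc0p : 0 < c0 := by
    apply mul_pos (Real.exp_pos _)
    refine integral_pos_of_integrable_nonneg_nonzero (x := 0) (by fun_prop) (hgi _ (by norm_num) 0) (fun y => mul_nonneg (Real.exp_pos _).le (hh0 y)) ?_
    simp [hhp.ne']
  set e : ℝ → Eu n → ℝ := fun t x => (4 * π * t) ^ (-(n : ℝ) / 2) *
        ∫ y, Real.exp (-(1 / (4 * t)) * ‖y - x‖ ^ 2) * h y with he
  have he0 : ∀ t > 0, ∀ x, 0 ≤ e t x := by
    intro t ht x
    apply mul_nonneg (by positivity)
    exact integral_nonneg fun y => mul_nonneg (Real.exp_pos _).le (hh0 y)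
  have helow : ∀ (x : Eu n) (t : ℝ), 1 ≤ t → ‖x‖ ^ 2 ≤ t → (4 * π * t) ^ (-(n : ℝ) / 2) * c0 ≤ e t x := by
    intro x t ht hxt
    simp only [he, hc0]
    gcongr
    rw [← integral_const_mul]
    refine integral_mono ((hgi _ (by norm_num) 0).const_mul _) (hgi _ (by positivity) x) fun y => ?_
    simp only
    rw [← mul_assoc, ← Real.exp_add]
    apply mul_le_mul_of_nonneg_right _ (hh0 y)
    apply Real.exp_le_exp.2
    have h1 : ‖y - x‖ ^ 2 ≤ 2 * ‖y‖ ^ 2 + 2 * ‖x‖ ^ 2 := by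
      have := norm_sub_le y x
      nlinarith [norm_nonneg (y - x), sq_nonneg (‖y‖ - ‖x‖), norm_nonneg y, norm_nonneg x]
    have h2 : 1 / (4 * t) * ‖y - x‖ ^ 2 ≤ 1 / 2 + 1 / 2 * ‖y‖ ^ 2 := by
      rw [div_mul_eq_mul_div, div_le_iff₀ (by positivity)]
      nlinarith [sq_nonneg ‖y‖]
    rw [sub_zero]
    linarith
  refine ⟨2 ^ (-α - 1) * (8 * π) ^ (-(n : ℝ) / 2) * c0, by positivity, fun x hx => ?_⟩
  have hx0 : 0 < ‖x‖ := by linarith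
  have hx2 : 1 ≤ ‖x‖ ^ 2 := by nlinarith
  have e1 : ∫ t in Ioi (1:ℝ), ((t ^ (-α - 1) : ℝ) : ℂ) *
        kpIF (fun η => ((Real.exp (-t * ‖η‖ ^ 2) : ℝ) : ℂ) * (χ η : ℂ)) x =
      ((∫ t in Ioi (1:ℝ), t ^ (-α - 1) * e t x : ℝ) : ℂ) := by
    rw [← integral_complex_ofReal]
    apply setIntegral_congr_fun measurableSet_Ioi
    intro t ht
    simp only
    rw [kp_heat hχ hχc hχh (by linarith [show (1:ℝ) < t from ht]), ← Complex.ofReal_mul]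
  have hint : IntegrableOn (fun t => t ^ (-α - 1) * e t x) (Ioi 1) := by
    have h1 := (kp_swap hχ hχc hα x).integral_prod_right
    have h2 := h1.re
    refine h2.congr ?_
    filter_upwards [ae_restrict_mem measurableSet_Ioi] with t ht
    have : ∫ η, (((Real.exp (-t * ‖η‖ ^ 2) * t ^ (-α - 1) : ℝ) : ℂ)) * (χ η : ℂ) *
        cexp (I * ((⟪x, η⟫ : ℝ) : ℂ)) = ((t ^ (-α - 1) * e t x : ℝ) : ℂ) := by
      rw [Complex.ofReal_mul, he]
      simp only
      rw [← kp_heat hχ hχc hχh (by linarith [show (1:ℝ) < t from ht])]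
      unfold kpIF
      rw [← integral_const_mul]
      congr 1
      ext η
      push_cast
      ring
    simp only [Function.uncurry]
    rw [this]
    exact Complex.ofReal_re _
  rw [e1, Complex.norm_real]
  refine le_trans ?_ (Real.le_norm_self _)
  have hsub : Ioc (‖x‖ ^ 2) (2 * ‖x‖ ^ 2) ⊆ Ioi 1 := fun t ht => lt_of_le_of_lt hx2 ht.1
  have hnn : ∀ᵐ t ∂(volume.restrict (Ioi (1:ℝ))), 0 ≤ t ^ (-α - 1) * e t x := by
    filter_upwards [ae_restrict_mem measurableSet_Ioi] with t ht
    have : (0:ℝ) < t := by linarith [show (1:ℝ) < t from ht]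
    exact mul_nonneg (by positivity) (he0 t this x)
  refine le_trans ?_ (setIntegral_mono_set hint hnn hsub.eventuallyLE)
  have hlow : ∀ t ∈ Ioc (‖x‖ ^ 2) (2 * ‖x‖ ^ 2),
      (2 * ‖x‖ ^ 2) ^ (-α - 1) * ((4 * π * (2 * ‖x‖ ^ 2)) ^ (-(n : ℝ) / 2) * c0) ≤ t ^ (-α - 1) * e t x := by
    intro t ht
    have ht0 : 1 < t := lt_of_le_of_lt hx2 ht.1
    have ht00 : 0 < t := by linarith
    apply mul_le_mul
    · exact Real.rpow_le_rpow_of_nonpos ht00 ht.2 (by linarith)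
    · refine le_trans ?_ (helow x t ht0.le ht.1.le)
      apply mul_le_mul_of_nonneg_right _ hc0p.le
      apply Real.rpow_le_rpow_of_nonpos (by positivity)
      · have := ht.2; gcongr
      · have : (0:ℝ) ≤ n := by positivity
        linarith
    · positivity
    · positivity
  have h5 := setIntegral_mono_on (μ := volume) (f := fun _ => (2 * ‖x‖ ^ 2) ^ (-α - 1) * ((4 * π * (2 * ‖x‖ ^ 2)) ^ (-(n : ℝ) / 2) * c0))
    (integrableOn_const (by simp)) (hint.mono_set hsub) measurableSet_Ioc hlow
  refine le_trans (le_of_eq ?_) h5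
  rw [setIntegral_const, Measure.real, Real.volume_Ioc, ENNReal.toReal_ofReal (by nlinarith), smul_eq_mul]
  have e6 : (2 * ‖x‖ ^ 2) ^ (-α - 1) = 2 ^ (-α - 1) * ‖x‖ ^ (2 * (-α - 1)) := by
    rw [Real.mul_rpow (by norm_num) (by positivity), ← Real.rpow_natCast, ← Real.rpow_mul hx0.le]
    norm_num
  have e7 : (4 * π * (2 * ‖x‖ ^ 2)) ^ (-(n : ℝ) / 2) = (8 * π) ^ (-(n : ℝ) / 2) * ‖x‖ ^ (-(n:ℝ)) := by
    rw [show 4 * π * (2 * ‖x‖ ^ 2) = (8 * π) * ‖x‖ ^ 2 by ring,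
      Real.mul_rpow (by positivity) (by positivity), ← Real.rpow_natCast ‖x‖, ← Real.rpow_mul hx0.le]
    congr 2
    push_cast; ring
  have e8 : 2 * ‖x‖ ^ 2 - ‖x‖ ^ 2 = ‖x‖ ^ (2:ℝ) := by
    rw [Real.rpow_two]; ring
  have e9 : ‖x‖ ^ (-((n : ℝ) + 2 * α)) = ‖x‖ ^ (2:ℝ) * ‖x‖ ^ (2 * (-α - 1)) * ‖x‖ ^ (-(n:ℝ)) := by
    rw [← Real.rpow_add hx0, ← Real.rpow_add hx0]
    congr 1; ring
  rw [e6, e7, e8, e9]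
  ring

lemma kp_lower {n : ℕ} (hn : 1 ≤ n) {χ h : Eu n → ℝ} (hχ : ContDiff ℝ ∞ χ) (hχc : HasCompactSupport χ)
    (hh : Continuous h) (hh0 : ∀ x, 0 ≤ h x) (hhp : 0 < h 0)
    (hχh : ∀ x, kpIF (fun ξ => (χ ξ : ℂ)) x = h x) {α : ℝ} (hα : 0 < α) (hk : ∀ k : ℕ, α ≠ k) :
    ∃ c' R : ℝ, 0 < c' ∧ 1 ≤ R ∧ ∀ x : Eu n, R ≤ ‖x‖ → c' * ‖x‖ ^ (-((n : ℝ) + 2 * α)) ≤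
      ‖kpIF (fun η => (((‖η‖ ^ 2) ^ α : ℝ) : ℂ) * (χ η : ℂ)) x‖ := by
  obtain ⟨c, W, hW, hcW⟩ := kp_key α hk
  obtain ⟨c', hc', htail⟩ := kp_tail hχ hχc hh hh0 hhp hχh hα
  obtain ⟨R0, hR0⟩ : ∃ R0 : ℝ, ∀ ξ, R0 < ‖ξ‖ → χ ξ = 0 := by
    obtain ⟨R0, hR0⟩ := hχc.isCompact.isBounded.exists_norm_le
    refine ⟨R0, fun ξ hξ => ?_⟩
    by_contra hne
    have := hR0 ξ (subset_tsupport _ hne)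
    linarith
  obtain ⟨M, hM⟩ := exists_nat_gt ((n : ℝ) + 2 * α)
  obtain ⟨A, hA, hdec⟩ := kp_decay (P := ℝ) (S := {0}) isCompact_singleton
    (G := fun z : ℝ × Eu n => ((W (‖z.2‖ ^ 2) : ℝ) : ℂ) * (χ z.2 : ℂ))
    (by
      have h1 : ContDiff ℝ ∞ fun z : ℝ × Eu n => W (‖z.2‖ ^ 2) := hW.comp (contDiff_snd.norm_sq ℝ)
      have h2 : ContDiff ℝ ∞ fun z : ℝ × Eu n => χ z.2 := hχ.comp contDiff_snd
      exact (Complex.ofRealCLM.contDiff.comp h1).mul (Complex.ofRealCLM.contDiff.comp h2)) R0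
    (by intro p ξ hξ; simp [hR0 ξ hξ]) M
  have hdec' : ∀ x : Eu n, ‖kpIF (fun η => ((W (‖η‖ ^ 2) : ℝ) : ℂ) * (χ η : ℂ)) x‖ ≤ A * ((1 + ‖x‖) ^ M)⁻¹ :=
    hdec 0 rfl
  have hlim : Tendsto (fun r : ℝ => A * r ^ (-((M:ℝ) - ((n : ℝ) + 2 * α)))) atTop (𝓝 (A * 0)) :=
    (tendsto_rpow_neg_atTop (by linarith)).const_mul A
  rw [mul_zero] at hlim
  obtain ⟨R1, hR1⟩ := eventually_atTop.1 (hlim.eventually (gt_mem_nhds (show 0 < c' / 2 by linarith)))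
  refine ⟨c' / 2 / (|c| + 1), max R1 1, by positivity, le_max_right _ _, fun x hx => ?_⟩
  have hx1 : 1 ≤ ‖x‖ := (le_max_right _ _).trans hx
  have hx0 : 0 < ‖x‖ := by linarith
  have hid := kp_identity hn hχ hχc hα hW hcW x
  have ht := htail x hx1
  have hd := hdec' x
  have hr := hR1 ‖x‖ ((le_max_left _ _).trans hx)
  have hd2 : A * ((1 + ‖x‖) ^ M)⁻¹ ≤ c' / 2 * ‖x‖ ^ (-((n : ℝ) + 2 * α)) := by
    have h1 : ((1 + ‖x‖) ^ M)⁻¹ ≤ ‖x‖ ^ (-(M:ℝ)) := by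
      rw [Real.rpow_neg hx0.le, Real.rpow_natCast]
      gcongr
      linarith
    have h2 : ‖x‖ ^ (-(M:ℝ)) = ‖x‖ ^ (-((M:ℝ) - ((n : ℝ) + 2 * α))) * ‖x‖ ^ (-((n : ℝ) + 2 * α)) := by
      rw [← Real.rpow_add hx0]; congr 1; ring
    calc _ ≤ A * ‖x‖ ^ (-(M:ℝ)) := by gcongr
      _ = (A * ‖x‖ ^ (-((M:ℝ) - ((n : ℝ) + 2 * α)))) * ‖x‖ ^ (-((n : ℝ) + 2 * α)) := by rw [h2]; ring
      _ ≤ _ := by gcongr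
  set T := kpIF (fun η => (((‖η‖ ^ 2) ^ α : ℝ) : ℂ) * (χ η : ℂ)) x
  set U := kpIF (fun η => ((W (‖η‖ ^ 2) : ℝ) : ℂ) * (χ η : ℂ)) x
  set V := ∫ t in Ioi (1:ℝ), ((t ^ (-α - 1) : ℝ) : ℂ) *
        kpIF (fun η => ((Real.exp (-t * ‖η‖ ^ 2) : ℝ) : ℂ) * (χ η : ℂ)) x
  have hV : ‖V‖ ≤ |c| * ‖T‖ + ‖U‖ := by
    have : V = c * T - U := by rw [hid]; ring
    rw [this]
    refine (norm_sub_le _ _).trans ?_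
    rw [norm_mul, Complex.norm_real, Real.norm_eq_abs]
  rw [div_mul_eq_mul_div, div_le_iff₀ (by positivity)]
  nlinarith [norm_nonneg T]

lemma kp_not_integrable {n : ℕ} (hn : 1 ≤ n) {c R : ℝ} (hc : 0 < c) (hR : 1 ≤ R) {F : Eu n → ℝ≥0∞}
    (hF : ∀ x, R ≤ ‖x‖ → ENNReal.ofReal (c * ‖x‖ ^ (-(n : ℝ))) ≤ F x) : ∫⁻ x, F x = ⊤ := by
  by_contra hne
  have : Nontrivial (Eu n) := by
    have : Nonempty (Fin n) := ⟨⟨0, hn⟩⟩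
    infer_instance
  set f : ℝ → ℝ := (Ici R).indicator fun r => c * r ^ (-(n : ℝ)) with hf
  have hfm : Measurable f := by
    apply Measurable.indicator _ measurableSet_Ici
    fun_prop
  have hf0 : ∀ r, 0 ≤ f r := by
    intro r
    apply indicator_nonneg
    intro r hr
    have : 0 ≤ r := by linarith [show R ≤ r from hr]
    positivity
  have hint : Integrable (fun x : Eu n => f ‖x‖) := by
    refine ⟨(hfm.comp measurable_norm).aestronglyMeasurable, ?_⟩
    rw [hasFiniteIntegral_iff_ofReal (ae_of_all _ fun x => hf0 _)]
    refine lt_of_le_of_lt (lintegral_mono fun x => ?_) (lt_top_iff_ne_top.2 hne)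
    by_cases hx : R ≤ ‖x‖
    · simpa [hf, indicator, hx] using hF x hx
    · simp [hf, indicator, hx]
  rw [integrable_fun_norm_addHaar] at hint
  have h2 : IntegrableOn (fun y : ℝ => c * y⁻¹) (Ioi R) := by
    refine (hint.mono_set (Ioi_subset_Ioi (by linarith : (0:ℝ) ≤ R))).congr_fun (fun y hy => ?_) measurableSet_Ioi
    have hy0 : 0 < y := by linarith [show R < y from hy]
    have hRy : R ≤ y := le_of_lt hy
    simp only [hf, indicator, mem_Ici, hRy, if_true, smul_eq_mul, finrank_euclideanSpace, Fintype.card_fin]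
    rw [Real.rpow_neg hy0.le, Real.rpow_natCast]
    obtain ⟨m, rfl⟩ : ∃ m, n = m + 1 := ⟨n - 1, by omega⟩
    simp only [Nat.add_sub_cancel]
    rw [pow_succ]
    field_simp
  have h3 : IntegrableOn (fun y : ℝ => y⁻¹) (Ioi R) := by
    refine IntegrableOn.congr_fun (Integrable.const_mul h2 c⁻¹) (fun y _ => ?_) measurableSet_Ioi
    field_simp
  exact not_integrableOn_Ioi_inv h3


lemma kp_wNorm_zero {n : ℕ} {p : ℝ≥0∞} (hp : p ≠ 0) {U : Eu n → ℂ} (hU : Continuous U)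
    (h : wNorm p 0 U = 0) : ∀ x, U x = 0 := by
  have hae : U =ᵐ[volume] fun _ => 0 := by
    by_cases hpt : p = ⊤
    · subst hpt
      rw [kp_wNorm_top, ENNReal.essSup_eq_zero_iff] at h
      filter_upwards [h] with x hx
      simpa using hx
    · have hr : 0 < p.toReal := ENNReal.toReal_pos hp hpt
      rw [kp_wNorm_ne_top hpt, ENNReal.rpow_eq_zero_iff_of_pos (by positivity)] at h
      simp only [jweight, zero_div, Real.rpow_zero, ENNReal.ofReal_one, mul_one] at h
      rw [lintegral_eq_zero_iff (by fun_prop)] at h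
      filter_upwards [h] with x hx
      simp only [Pi.zero_apply, ENNReal.rpow_eq_zero_iff_of_pos hr] at hx
      simpa using hx
  have := (hU.ae_eq_iff_eq volume continuous_const).1 hae
  intro x
  rw [this]

lemma kp_neg_case {n : ℕ} {p : ℝ≥0∞} (hp : p ≠ 0) {s : ℝ} (hs : s < 0) {χ h : Eu n → ℝ}
    (hχ : ContDiff ℝ ∞ χ) (hχc : HasCompactSupport χ) (hχ0 : ∀ ξ, 0 ≤ χ ξ) (hhp : 0 < h 0)
    (hχh : ∀ x, kpIF (fun ξ => (χ ξ : ℂ)) x = h x) {D : ℝ≥0∞} (hD : D ≠ ⊤)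
    (H : ∀ N ν : ℝ, 1 ≤ ν → ν ≤ N →
      wNorm p 0 (kpIF (fun η => ((((1 / ν) ^ 2 + ‖η‖ ^ 2) ^ (s / 2) : ℝ) : ℂ) * (χ η : ℂ))) ≤
        ENNReal.ofReal ((N / ν) ^ s) * D) : False := by
  have hc := hχ.continuous
  have hcw : Continuous fun η : Eu n => (((1:ℝ) / 1) ^ 2 + ‖η‖ ^ 2) ^ (s / 2) := by
    apply Continuous.rpow_const (by fun_prop)
    intro η
    left; positivity
  have hcomp : HasCompactSupport (fun η : Eu n => (((1:ℝ) / 1) ^ 2 + ‖η‖ ^ 2) ^ (s / 2) * χ η) :=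
    hχc.mul_left
  have hz : wNorm p 0 (kpIF (fun η => ((((1 / 1) ^ 2 + ‖η‖ ^ 2) ^ (s / 2) : ℝ) : ℂ) * (χ η : ℂ))) = 0 := by
    have hlim : Tendsto (fun N : ℝ => ENNReal.ofReal ((N / 1) ^ s) * D) atTop (𝓝 (0 * D)) := by
      apply ENNReal.Tendsto.mul_const _ (Or.inr hD)
      rw [← ENNReal.ofReal_zero]
      apply ENNReal.tendsto_ofReal
      have := tendsto_rpow_neg_atTop (y := -s) (by linarith)
      simpa using this
    rw [zero_mul] at hlim
    refine le_antisymm (ge_of_tendsto hlim ?_) zero_le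
    filter_upwards [eventually_ge_atTop (1:ℝ)] with N hN
    exact H N 1 le_rfl hN
  have hi : Integrable (fun η : Eu n => (((1:ℝ) / 1) ^ 2 + ‖η‖ ^ 2) ^ (s / 2) * χ η) :=
    (hcw.mul hc).integrable_of_hasCompactSupport hcomp
  have hi' : Integrable (fun η : Eu n => ((((1 / 1) ^ 2 + ‖η‖ ^ 2) ^ (s / 2) : ℝ) : ℂ) * (χ η : ℂ)) := by
    refine hi.ofReal.congr (ae_of_all _ fun η => ?_)
    simp only
    push_cast
    rfl
  have h0 := kp_wNorm_zero hp (kpIF_continuous hi') hz 0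
  obtain ⟨ξ, hξ⟩ : ∃ ξ, χ ξ ≠ 0 := by
    by_contra! hall
    have := hχh 0
    simp [hall, kpIF] at this
    exact hhp.ne (by exact_mod_cast this)
  have hpos : 0 < ∫ η : Eu n, (((1:ℝ) / 1) ^ 2 + ‖η‖ ^ 2) ^ (s / 2) * χ η := by
    refine integral_pos_of_integrable_nonneg_nonzero (x := ξ) (hcw.mul hc) hi
      (fun y => mul_nonneg (by positivity) (hχ0 y)) ?_
    exact mul_ne_zero (by positivity) hξ
  have : kpIF (fun η : Eu n => ((((1 / 1) ^ 2 + ‖η‖ ^ 2) ^ (s / 2) : ℝ) : ℂ) * (χ η : ℂ)) 0 =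
      ((∫ η : Eu n, (((1:ℝ) / 1) ^ 2 + ‖η‖ ^ 2) ^ (s / 2) * χ η : ℝ) : ℂ) := by
    rw [← integral_complex_ofReal, kpIF]
    congr 1
    ext η
    simp only [inner_zero_left, Complex.ofReal_zero, mul_zero, Complex.exp_zero, mul_one,
      Complex.ofReal_mul]
  rw [this] at h0
  exact hpos.ne' (by exact_mod_cast h0)

lemma kp_pos_case {n : ℕ} (hn : 1 ≤ n) {p : ℝ≥0∞} (hp : p ≠ 0) {s : ℝ} (hs : 0 < s)
    (hsn : s ≤ (n : ℝ) * (1 / p.toReal - 1)) (hk : ∀ k : ℕ, s / 2 ≠ k) {χ h : Eu n → ℝ}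
    (hχ : ContDiff ℝ ∞ χ) (hχc : HasCompactSupport χ)
    (hh : Continuous h) (hh0 : ∀ x, 0 ≤ h x) (hhp : 0 < h 0)
    (hχh : ∀ x, kpIF (fun ξ => (χ ξ : ℂ)) x = h x) {D : ℝ≥0∞} (hD : D ≠ ⊤)
    (H : ∀ N ν : ℝ, 1 ≤ ν → ν ≤ N →
      wNorm p 0 (kpIF (fun η => ((((1 / ν) ^ 2 + ‖η‖ ^ 2) ^ (s / 2) : ℝ) : ℂ) * (χ η : ℂ))) ≤
        ENNReal.ofReal ((N / ν) ^ s) * D) : False := by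
  have hn0 : (1:ℝ) ≤ n := by exact_mod_cast hn
  have hpt : p ≠ ⊤ := by
    rintro rfl
    simp at hsn
    linarith
  set q := p.toReal with hq
  have hq0 : 0 < q := ENNReal.toReal_pos hp hpt
  have hsq : ((n : ℝ) + s) * q ≤ n := by
    have : (n : ℝ) + s ≤ n / q := by
      have : (n : ℝ) * (1 / q - 1) = n / q - n := by ring
      linarith
    rwa [le_div_iff₀ hq0] at this
  have hc := hχ.continuous
  set T : ℝ → Eu n → ℂ := fun ε =>
    kpIF (fun η => (((ε ^ 2 + ‖η‖ ^ 2) ^ (s / 2) : ℝ) : ℂ) * (χ η : ℂ)) with hT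
  have hcw : ∀ ε : ℝ, Continuous fun η : Eu n => (ε ^ 2 + ‖η‖ ^ 2) ^ (s / 2) := by
    intro ε
    apply Continuous.rpow_const (by fun_prop)
    intro η
    right; linarith
  have hci : ∀ ε : ℝ, Integrable fun η : Eu n => (((ε ^ 2 + ‖η‖ ^ 2) ^ (s / 2) : ℝ) : ℂ) * (χ η : ℂ) := by
    intro ε
    have := hcw ε
    apply Continuous.integrable_of_hasCompactSupport
    · fun_prop
    · have : HasCompactSupport (fun η => (χ η : ℂ)) := hχc.comp_left (g := fun r : ℝ => (r:ℂ)) (by simp)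
      exact this.mul_left
  have hTc : ∀ ε, Continuous (T ε) := fun ε => kpIF_continuous (hci ε)
  set ε : ℕ → ℝ := fun k => 1 / ((k : ℝ) + 1) with hε
  have hε0 : Tendsto ε atTop (𝓝 0) := tendsto_one_div_add_atTop_nhds_zero_nat
  have hε1 : ∀ k, 0 < ε k ∧ ε k ≤ 1 := by
    intro k
    refine ⟨by simp only [hε]; positivity, ?_⟩
    simp only [hε]
    rw [div_le_one (by positivity)]
    have : (0:ℝ) ≤ k := by positivity
    linarith
  have hbd : ∀ k, ∫⁻ x, (‖T (ε k) x‖₊ : ℝ≥0∞) ^ q ≤ D ^ q := by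
    intro k
    have h1 : (1:ℝ) ≤ (k : ℝ) + 1 := by
      have : (0:ℝ) ≤ k := by positivity
      linarith
    have := H ((k:ℝ) + 1) ((k:ℝ) + 1) h1 le_rfl
    rw [div_self (by positivity), Real.one_rpow, ENNReal.ofReal_one, one_mul, kp_wNorm_ne_top hpt] at this
    simp only [jweight, zero_div, Real.rpow_zero, ENNReal.ofReal_one, mul_one] at this
    have h2 := ENNReal.rpow_le_rpow this hq0.le
    rw [← ENNReal.rpow_mul, one_div_mul_cancel hq0.ne', ENNReal.rpow_one] at h2
    exact h2
  have hptw : ∀ x, Tendsto (fun k => T (ε k) x) atTop (𝓝 (T 0 x)) := by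
    intro x
    simp only [hT, kpIF]
    apply tendsto_integral_of_dominated_convergence
      (fun η => ‖((((1:ℝ) ^ 2 + ‖η‖ ^ 2) ^ (s / 2) : ℝ) : ℂ) * (χ η : ℂ)‖)
    · intro k
      exact (hci _).1.mul (Continuous.aestronglyMeasurable (by fun_prop))
    · exact (hci 1).norm
    · intro k
      refine ae_of_all _ fun η => ?_
      rw [norm_mul _ (cexp (I * _)), mul_comm I, Complex.norm_exp_ofReal_mul_I, mul_one,
        norm_mul, norm_mul]
      gcongr
      rw [Complex.norm_real, Complex.norm_real, Real.norm_of_nonneg (by positivity),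
        Real.norm_of_nonneg (by positivity)]
      have := hε1 k
      have h3 : (0:ℝ) ≤ ε k := this.1.le
      gcongr
      exact this.2
    · refine ae_of_all _ fun η => ?_
      apply Tendsto.mul_const
      apply Tendsto.mul_const
      apply (Complex.continuous_ofReal.tendsto _).comp
      apply Tendsto.rpow_const
      · exact (hε0.pow 2).add_const _
      · right; linarith
  have hfatou : ∫⁻ x, (‖T 0 x‖₊ : ℝ≥0∞) ^ q ≤ D ^ q := by
    have hl : ∀ x, (‖T 0 x‖₊ : ℝ≥0∞) ^ q = liminf (fun k => (‖T (ε k) x‖₊ : ℝ≥0∞) ^ q) atTop := by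
      intro x
      symm
      apply Tendsto.liminf_eq
      have h1 : Tendsto (fun k => (‖T (ε k) x‖₊ : ℝ≥0∞)) atTop (𝓝 (‖T 0 x‖₊ : ℝ≥0∞)) :=
        ENNReal.tendsto_coe.2 (hptw x).nnnorm
      exact (ENNReal.continuous_rpow_const.tendsto _).comp h1
    simp_rw [hl]
    refine (lintegral_liminf_le fun k => ?_).trans ?_
    · have := hTc (ε k)
      fun_prop
    · exact liminf_le_of_le (by isBoundedDefault) fun b hb => by
        obtain ⟨k, hk⟩ := hb.exists
        exact hk.trans (hbd k)
  obtain ⟨c', R, hc', hR, hlow⟩ := kp_lower hn hχ hχc hh hh0 hhp hχh (α := s / 2) (by linarith) hk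
  have hT0 : T 0 = kpIF (fun η => (((‖η‖ ^ 2) ^ (s / 2) : ℝ) : ℂ) * (χ η : ℂ)) := by
    simp [hT]
  have htop := kp_not_integrable hn (c := c' ^ q) (R := R) (by positivity) hR
    (F := fun x => (‖T 0 x‖₊ : ℝ≥0∞) ^ q) (by
      intro x hx
      have hx0 : 0 < ‖x‖ := by linarith
      have h1 := hlow x hx
      rw [← hT0] at h1
      have h2 : (‖T 0 x‖₊ : ℝ≥0∞) ^ q = ENNReal.ofReal (‖T 0 x‖ ^ q) := by
        rw [← ENNReal.ofReal_rpow_of_nonneg (norm_nonneg _) hq0.le, ofReal_norm]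
        rfl
      rw [h2]
      apply ENNReal.ofReal_le_ofReal
      calc c' ^ q * ‖x‖ ^ (-(n:ℝ)) ≤ c' ^ q * ‖x‖ ^ (-((n : ℝ) + 2 * (s / 2)) * q) := by
            gcongr
            · linarith
            · nlinarith
        _ = (c' * ‖x‖ ^ (-((n : ℝ) + 2 * (s / 2)))) ^ q := by
            rw [Real.mul_rpow hc'.le (by positivity), ← Real.rpow_mul hx0.le]
        _ ≤ _ := by gcongr)
  rw [htop] at hfatou
  exact (ENNReal.rpow_ne_top_of_nonneg hq0.le hD) (top_le_iff.1 hfatou)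


/-- **Sharpness of the range of `s` in the weighted Kato–Ponce inequality**
(Theorem 1.1, negative direction). -/
theorem weighted_kato_ponce_sharp (n : ℕ) (hn : 1 ≤ n) (p p₁ p₂ : ℝ≥0∞) (a a₁ a₂ s : ℝ)
    (hp : 2⁻¹ ≤ p) (hp1 : 1 ≤ p₁) (hp2 : 1 ≤ p₂)
    (ha : 0 ≤ a) (ha1 : 0 ≤ a₁) (ha2 : 0 ≤ a₂)
    (hexp : 1 / p = 1 / p₁ + 1 / p₂)
    (hwexp : ENNReal.ofReal a / p = ENNReal.ofReal a₁ / p₁ + ENNReal.ofReal a₂ / p₂)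
    (hs : s ≤ max 0 ((n : ℝ) * (1 / p.toReal - 1)))
    (hnev : ¬ ∃ m : ℕ, s = 2 * m) :
    ¬ ∃ C : ℝ, 0 < C ∧ ∀ f g : SchwartzMap (Eu n) ℂ,
      wNorm p a (Js s (fun x => f x * g x)) ≤
        ENNReal.ofReal C *
          (wNorm p₁ a₁ (Js s ⇑f) * wNorm p₂ a₂ ⇑g +
            wNorm p₁ a₁ ⇑f * wNorm p₂ a₂ (Js s ⇑g)) := by
  rintro ⟨C, hC0, hC⟩
  obtain ⟨ψ, χ, h, hψ, hψc, hψ0, hχ, hχc, hχ0, hh, hh0, hhp, hχh, hψh⟩ := kp_bump n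
  obtain ⟨D, hD, H⟩ := kp_core hn hp hp1 hp2 ha ha1 ha2 hexp hC hψ hψc hψ0 hχ hχc hχh hψh
  have hp0 : p ≠ 0 := by
    rintro rfl
    simp at hp
  have hk : ∀ k : ℕ, s / 2 ≠ k := by
    intro k hk
    exact hnev ⟨k, by linarith⟩
  have hs0 : s ≠ 0 := by
    intro h0
    exact hnev ⟨0, by simp [h0]⟩
  rcases lt_or_gt_of_ne hs0 with hneg | hpos
  · exact kp_neg_case hp0 hneg hχ hχc hχ0 hhp hχh hD H
  · refine kp_pos_case hn hp0 hpos ?_ hk hχ hχc hh hh0 hhp hχh hD H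
    rcases le_max_iff.1 hs with h1 | h1
    · linarith
    · exact h1
end
end

section
/- Let n ≥ 1, p ∈ [1/2,∞], p₁,p₂ ∈ [1,∞], and a,a₁,a₂ ≥ 0 satisfy 1/p = 1/p₁ + 1/p₂ and a/p = a₁/p₁ + a₂/p₂, and let s ∈ ℝ satisfy 0 < s ≤ n(1/p − 1) and s ∉ 2ℕ. Then neither of the following holds: (a) there exists C > 0 such that for all f,g ∈ 𝒮(ℝⁿ), ‖J^s(fg) − f·(J^s g)‖_{L^p_{⟨x⟩^a}} ≤ C ( ‖J^s f‖_{L^{p₁}_{⟨x⟩^{a₁}}} ‖g‖_{L^{p₂}_{⟨x⟩^{a₂}}} + ‖∇f‖_{L^{p₁}_{⟨x⟩^{a₁}}} ‖J^{s−1} g‖_{L^{p₂}_{⟨x⟩^{a₂}}} ); (b) there exists C > 0 such that for all f,g ∈ 𝒮(ℝⁿ), ‖J^s(fg) − f·(J^s g) + s∇f·∇(J^{s−2} g)‖_{L^p_{⟨x⟩^a}} ≤ C ( ‖J^s f‖_{L^{p₁}_{⟨x⟩^{a₁}}} ‖g‖_{L^{p₂}_{⟨x⟩^{a₂}}} + ‖∇f‖_{L^{p₁}_{⟨x⟩^{a₁}}}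 ‖J^{s−1} g‖_{L^{p₂}_{⟨x⟩^{a₂}}} ). -/
open MeasureTheory Real Complex
open scoped ENNReal NNReal RealInnerProductSpace

noncomputable section

/-- The Euclidean norm `|∇f|(x)` of the gradient of a complex-valued function. -/
def gradNorm {n : ℕ} (f : Eu n → ℂ) (x : Eu n) : ℝ :=
  Real.sqrt (∑ j : Fin n, ‖fderiv ℝ f x (EuclideanSpace.single j 1)‖ ^ 2)

/-- The "dot product" of gradients `∇f·∇g = Σ_j (∂_j f)(∂_j g)`. -/
def gradDot {n : ℕ} (f g : Eu n → ℂ) (x : Eu n) : ℂ :=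
  ∑ j : Fin n, fderiv ℝ f x (EuclideanSpace.single j 1) *
    fderiv ℝ g x (EuclideanSpace.single j 1)

open FourierTransform in
/-- multiplier operator at scale `ε` -/
def TT {n : ℕ} (r ε : ℝ) (ψ : Eu n → ℂ) (x : Eu n) : ℂ :=
  𝓕⁻ (fun η : Eu n => (((ε ^ 2 + (2 * π * ‖η‖) ^ 2) ^ (r / 2) : ℝ) : ℂ) * ψ η) x

open FourierTransform

lemma Mfun_contDiff {n : ℕ} (r : ℝ) (φ : Eu n → ℂ) (hφ : ContDiff ℝ (⊤ : ℕ∞) φ)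
    (h0 : (0 : Eu n) ∉ tsupport φ) :
    ContDiff ℝ (⊤ : ℕ∞) (fun q : ℝ × Eu n =>
      (((q.1 ^ 2 + (2 * π * ‖q.2‖) ^ 2) ^ (r / 2) : ℝ) : ℂ) * φ q.2) := by
  rw [contDiff_iff_contDiffAt]
  rintro ⟨ε, η⟩
  by_cases hη : η = 0
  · subst hη
    have : (fun q : ℝ × Eu n =>
      (((q.1 ^ 2 + (2 * π * ‖q.2‖) ^ 2) ^ (r / 2) : ℝ) : ℂ) * φ q.2) =ᶠ[nhds (ε, 0)] fun _ => 0 := by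
      have h1 : φ =ᶠ[nhds 0] 0 := notMem_tsupport_iff_eventuallyEq.mp h0
      have h2 : Filter.Tendsto (fun q : ℝ × Eu n => q.2) (nhds (ε, 0)) (nhds 0) :=
        continuous_snd.tendsto' _ _ rfl
      filter_upwards [h2.eventually h1] with q hq
      simp [hq]
    exact contDiffAt_const.congr_of_eventuallyEq this
  · apply ContDiffAt.mul
    · have h1 : ContDiffAt ℝ (⊤ : ℕ∞) (fun q : ℝ × Eu n => (q.1 ^ 2 + (2 * π * ‖q.2‖) ^ 2) ^ (r / 2))
          (ε, η) := by
        have e : (fun q : ℝ × Eu n => (q.1 ^ 2 + (2 * π * ‖q.2‖) ^ 2) ^ (r / 2))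
          = fun q : ℝ × Eu n => (q.1 ^ 2 + (2 * π) ^ 2 * ‖q.2‖ ^ 2) ^ (r / 2) := by
          ext q; rw [mul_pow]
        rw [e]
        apply ContDiffAt.rpow_const_of_ne
        · exact (contDiff_fst.pow 2 |>.add (contDiff_const.mul (contDiff_snd.norm_sq ℝ))).contDiffAt
        · have := norm_pos_iff.mpr hη
          have := Real.pi_pos
          simp only
          positivity
      exact Complex.ofRealCLM.contDiff.contDiffAt.comp _ h1
    · exact (hφ.comp contDiff_snd).contDiffAt

lemma slice_bound {n : ℕ} (M : ℝ × Eu n → ℂ) (hM : ContDiff ℝ (⊤ : ℕ∞) M) (K : Set (Eu n))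
    (hK : IsCompact K) (hMK : ∀ ε η, η ∉ K → M (ε, η) = 0) (k : ℕ) :
    ∃ C : ℝ, 0 ≤ C ∧ ∀ ε ∈ Set.Icc (0:ℝ) 1,
      ContDiff ℝ (⊤ : ℕ∞) (fun η => M (ε, η)) ∧
      ∀ η, ‖iteratedFDeriv ℝ k (fun η => M (ε, η)) η‖ ≤ K.indicator (fun _ => C) η := by
  have hcomp : IsCompact ((Set.Icc (0:ℝ) 1) ×ˢ K) := isCompact_Icc.prod hK
  obtain ⟨C, hC⟩ := hcomp.exists_bound_of_continuousOn
    (f := iteratedFDeriv ℝ k M) (hM.continuous_iteratedFDeriv (by exact_mod_cast le_top)).continuousOn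
  refine ⟨|C| * ‖ContinuousLinearMap.inr ℝ ℝ (Eu n)‖ ^ k, by positivity, fun ε hε => ⟨hM.comp (by fun_prop), fun η => ?_⟩⟩
  by_cases hη : η ∈ K
  · rw [Set.indicator_of_mem hη]
    have e : (fun η => M (ε, η)) = (fun q => M (q + (ε, 0))) ∘ (ContinuousLinearMap.inr ℝ ℝ (Eu n)) := by
      ext; simp
    have h1 : ContDiff ℝ (⊤ : ℕ∞) (fun q => M (q + (ε, 0))) := hM.comp (by fun_prop)
    rw [e, ContinuousLinearMap.iteratedFDeriv_comp_right _ h1 _ (i := k) (by exact_mod_cast le_top)]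
    refine (ContinuousMultilinearMap.norm_compContinuousLinearMap_le _ _).trans ?_
    rw [iteratedFDeriv_comp_add_right]
    simp only [Finset.prod_const, Finset.card_univ, Fintype.card_fin]
    gcongr
    refine le_trans ?_ (le_abs_self C)
    have := hC (ε, η) ⟨hε, hη⟩
    simpa using this
  · rw [Set.indicator_of_notMem hη]
    have h2 : (fun η => M (ε, η)) =ᶠ[nhds η] fun _ => 0 := by
      filter_upwards [hK.isClosed.isOpen_compl.mem_nhds hη] with y hy using hMK _ _ hy
    rw [(h2.iteratedFDeriv ℝ k).eq_of_nhds]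
    simp [iteratedFDeriv_fun_zero]

lemma slice_decay {n : ℕ} (M : ℝ × Eu n → ℂ) (hM : ContDiff ℝ (⊤ : ℕ∞) M) (K : Set (Eu n))
    (hK : IsCompact K) (hMK : ∀ ε η, η ∉ K → M (ε, η) = 0) (N : ℕ) :
    ∃ C : ℝ, 0 ≤ C ∧ ∀ ε ∈ Set.Icc (0:ℝ) 1, ∀ x,
      ‖x‖ ^ N * ‖𝓕⁻ (fun η => M (ε, η)) x‖ ≤ C := by
  choose C hC0 hC using slice_bound M hM K hK hMK
  refine ⟨2 ^ N * ∑ p ∈ Finset.range 1 ×ˢ Finset.range (N+1), ∫ v, K.indicator (fun _ => C p.2) v, ?_, ?_⟩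
  · refine mul_nonneg (by positivity) (Finset.sum_nonneg fun p _ => integral_nonneg fun v => ?_)
    exact Set.indicator_nonneg (fun _ _ => hC0 _) _
  intro ε hε x
  have hint : ∀ k, Integrable (K.indicator (fun _ => C k)) (volume : Measure (Eu n)) := fun k =>
    (integrable_indicator_iff hK.measurableSet).mpr (integrableOn_const hK.measure_lt_top.ne)
  have hsm : ∀ k, ContDiff ℝ (⊤ : ℕ∞) (fun η => M (ε, η)) := fun k => (hC k ε hε).1
  have hint2 : ∀ k : ℕ, Integrable (fun v => ‖iteratedFDeriv ℝ k (fun η => M (ε, η)) v‖) := fun k => by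
    refine (hint k).mono' ((hsm 0).continuous_iteratedFDeriv (by exact_mod_cast le_top)).norm.aestronglyMeasurable ?_
    filter_upwards with v
    simpa using (hC k ε hε).2 v
  have := Real.pow_mul_norm_iteratedFDeriv_fourier_le (f := fun η => M (ε, η)) (K := 0) (N := ⊤) (hsm 0)
    (fun k n hk _ => by
      have : k = 0 := by simpa using hk
      subst this
      simpa using hint2 n) (k := 0) (n := N) le_rfl le_top (-x)
  rw [Real.fourierInv_eq_fourier_neg]
  simp only [norm_neg, norm_iteratedFDeriv_zero] at this
  refine this.trans ?_
  simp only [CharP.cast_eq_zero, mul_zero, zero_add, pow_zero, one_mul]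
  gcongr with p hp
  · exact hint2 p.2 |>.congr (by
      have : p.1 = 0 := by
        rw [Finset.mem_product] at hp
        simpa using hp.1
      simp [this])
  · exact hint _
  · have : p.1 = 0 := by
        rw [Finset.mem_product] at hp
        simpa using hp.1
    intro v
    simpa [this] using (hC p.2 ε hε).2 v

lemma TT_decay {n : ℕ} (r : ℝ) (φ : Eu n → ℂ) (hφ : ContDiff ℝ (⊤ : ℕ∞) φ)
    (hc : HasCompactSupport φ) (h0 : (0 : Eu n) ∉ tsupport φ) (N : ℕ) :
    ∃ C : ℝ, 0 ≤ C ∧ ∀ ε ∈ Set.Icc (0:ℝ) 1, ∀ x, ‖x‖ ^ N * ‖TT r ε φ x‖ ≤ C :=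
  slice_decay _ (Mfun_contDiff r φ hφ h0) (tsupport φ) hc
    (fun ε η h => by simp [image_eq_zero_of_notMem_tsupport h]) N

open FourierTransform

lemma FT_scale {n : ℕ} (u : Eu n → ℂ) (ε : ℝ) (hε : 0 < ε) (ξ : Eu n) :
    FT (fun y => u (ε⁻¹ • y)) ξ = (ε ^ n : ℝ) * 𝓕 u ((ε / (2 * π)) • ξ) := by
  have h := Measure.integral_comp_smul (volume : Measure (Eu n))
    (fun z => u z * Complex.exp (-(Complex.I * ((⟪ε • z, ξ⟫ : ℝ) : ℂ)))) ε⁻¹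
  unfold FT
  have e : (fun x : Eu n => u (ε⁻¹ • x) * Complex.exp (-(Complex.I * ((⟪x, ξ⟫ : ℝ) : ℂ)))) =
    fun x => u (ε⁻¹ • x) * Complex.exp (-(Complex.I * ((⟪ε • ε⁻¹ • x, ξ⟫ : ℝ) : ℂ))) := by
    ext x; rw [smul_smul, mul_inv_cancel₀ hε.ne', one_smul]
  rw [e, h, Real.fourier_eq']
  simp only [finrank_euclideanSpace, Fintype.card_fin, inv_pow, inv_inv]
  rw [abs_of_pos (by positivity), Complex.real_smul]
  congr 2
  ext z
  rw [smul_eq_mul, mul_comm]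
  congr 2
  rw [inner_smul_left, inner_smul_right]
  simp only [conj_trivial]
  push_cast
  have := Real.pi_ne_zero
  field_simp

lemma Js_scale {n : ℕ} (r : ℝ) (u : Eu n → ℂ) (ε : ℝ) (hε : 0 < ε) (x : Eu n) :
    Js r (fun y => u (ε⁻¹ • y)) x = ((ε ^ (-r) : ℝ) : ℂ) * TT r ε (𝓕 u) (ε⁻¹ • x) := by
  have hπ := Real.pi_pos
  have h := Measure.integral_comp_smul (volume : Measure (Eu n))
    (fun η => (((1 + ‖(2 * π / ε) • η‖ ^ 2) ^ (r / 2) : ℝ) : ℂ) * ((ε ^ n : ℝ) * 𝓕 u η) *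
      Complex.exp (Complex.I * ((⟪x, (2 * π / ε) • η⟫ : ℝ) : ℂ))) (ε / (2 * π))
  unfold Js TT
  simp only [FT_scale u ε hε]
  have e : ∀ ξ : Eu n, (2 * π / ε) • (ε / (2 * π)) • ξ = ξ := fun ξ => by
    rw [smul_smul]; convert one_smul ℝ ξ using 2; field_simp
  simp only [e] at h
  rw [h, Real.fourierInv_eq']
  simp only [finrank_euclideanSpace, Fintype.card_fin]
  rw [abs_of_pos (by positivity), Complex.real_smul, ← mul_assoc, ← integral_const_mul, ← integral_const_mul]
  congr 1
  ext η
  have e2 : (1 + ‖(2 * π / ε) • η‖ ^ 2) ^ (r / 2) = ε ^ (-r) * (ε ^ 2 + (2 * π * ‖η‖) ^ 2) ^ (r / 2) := by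
    have : 1 + ‖(2 * π / ε) • η‖ ^ 2 = (ε ^ 2)⁻¹ * (ε ^ 2 + (2 * π * ‖η‖) ^ 2) := by
      rw [norm_smul, Real.norm_of_nonneg (by positivity)]
      field_simp
    rw [this, Real.mul_rpow (by positivity) (by positivity)]
    congr 1
    rw [← Real.rpow_natCast, ← Real.rpow_neg hε.le, ← Real.rpow_mul hε.le]
    congr 1; push_cast; ring
  have e3 : Complex.I * ((⟪x, (2 * π / ε) • η⟫ : ℝ) : ℂ) = ((2 * π * ⟪η, ε⁻¹ • x⟫ : ℝ) : ℂ) * Complex.I := by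
    rw [inner_smul_right, inner_smul_right, real_inner_comm]
    push_cast
    have := hε.ne'
    field_simp
  rw [e2, e3, smul_eq_mul]
  push_cast
  have := hε.ne'
  have hπ' : (π : ℂ) ≠ 0 := by exact_mod_cast hπ.ne'
  have hε' : (ε : ℂ) ≠ 0 := by exact_mod_cast this
  rw [div_pow]
  field_simp

/-- the heat semigroup on the Fourier side -/
def HT {n : ℕ} (t : ℝ) (ψ : Eu n → ℂ) (x : Eu n) : ℂ :=
  𝓕⁻ (fun η : Eu n => ((rexp (-(t * (2 * π * ‖η‖) ^ 2)) : ℝ) : ℂ) * ψ η) x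

lemma gauss_integrable {n : ℕ} {b : ℝ} (hb : 0 < b) :
    Integrable (fun w : Eu n => rexp (-b * ‖w‖ ^ 2)) := by
  have h := (GaussianFourier.integrable_cexp_neg_mul_sq_norm_add (V := Eu n) (b := (b : ℂ)) (by simpa using hb) 0 0).norm
  refine h.congr (Filter.Eventually.of_forall fun w => ?_)
  simp only [Complex.norm_exp]
  norm_cast
  simp

lemma gauss_pow_integrable {n : ℕ} (N : ℕ) :
    Integrable (fun w : Eu n => rexp (-(1/4) * ‖w‖ ^ 2) * ‖w‖ ^ N) := by
  refine (((gauss_integrable (n := n) (b := 1/4) (by norm_num)).add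
    ((gauss_integrable (n := n) (b := 1/8) (by norm_num)).const_mul (8 ^ N * N.factorial)))).mono'
    (by fun_prop) (Filter.Eventually.of_forall fun w => ?_)
  have h1 : ‖w‖ ^ N ≤ 1 + ‖w‖ ^ (2 * N) := by
    rw [mul_comm, pow_mul]
    nlinarith [sq_nonneg (‖w‖ ^ N - 1), pow_nonneg (norm_nonneg w) N]
  have h2 : (‖w‖ ^ 2 / 8) ^ N / N.factorial ≤ rexp (‖w‖ ^ 2 / 8) :=
    Real.pow_div_factorial_le_exp _ (by positivity) N
  have h3 : ‖w‖ ^ (2 * N) ≤ 8 ^ N * N.factorial * rexp (‖w‖ ^ 2 / 8) := by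
    rw [div_pow, div_div, div_le_iff₀ (by positivity), ← pow_mul] at h2
    linarith
  rw [Real.norm_of_nonneg (by positivity)]
  have h4 : rexp (-(1/8) * ‖w‖ ^ 2) = rexp (-(1/4) * ‖w‖ ^ 2) * rexp (‖w‖ ^ 2 / 8) := by
    rw [← Real.exp_add]; congr 1; ring
  simp only [Pi.add_apply]
  rw [h4]
  have := Real.exp_pos (-(1/4) * ‖w‖ ^ 2)
  nlinarith

lemma HT_eq {n : ℕ} : ∃ κ : ℝ, 0 < κ ∧ ∀ (H : SchwartzMap (Eu n) ℂ) (t : ℝ) (x : Eu n), 0 ≤ t →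
    HT t (𝓕 (H : Eu n → ℂ)) x =
      κ * ∫ w : Eu n, ((rexp (-(1/4) * ‖w‖ ^ 2) : ℝ) : ℂ) * H (x - √t • w) := by
  refine ⟨((π / (1/4)) ^ ((n : ℝ) / 2))⁻¹, by positivity, fun H t x ht => ?_⟩
  have hinv : ∀ y, H y = ∫ η, cexp (↑(2 * π * ⟪η, y⟫) * I) * 𝓕 (H : Eu n → ℂ) η := fun y => by
    have h1 : 𝓕⁻ (𝓕 (H : Eu n → ℂ)) y = H y := by
      have : 𝓕⁻ (𝓕 H) = H := FourierTransform.fourierInv_fourier_eq H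
      rw [← SchwartzMap.fourier_coe, ← SchwartzMap.fourierInv_coe, this]
    rw [← h1, Real.fourierInv_eq']
    rfl
  have hFint : Integrable (𝓕 (H : Eu n → ℂ)) := by
    rw [← SchwartzMap.fourier_coe]; exact (𝓕 H).integrable
  have hG : ∀ η : Eu n, ∫ w : Eu n, ((rexp (-(1/4) * ‖w‖ ^ 2) : ℝ) : ℂ) *
      cexp (↑(2 * π * ⟪η, x - √t • w⟫) * I) =
      cexp (↑(2 * π * ⟪η, x⟫) * I) * (((π / (1/4)) ^ ((n : ℝ) / 2) : ℝ) * ((rexp (-(t * (2 * π * ‖η‖) ^ 2)) : ℝ) : ℂ)) := by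
    intro η
    have h := fourier_gaussian_innerProductSpace (V := Eu n) (b := (1/4 : ℂ)) (by norm_num) (√t • η)
    rw [Real.fourier_eq'] at h
    have e1 : (((π / (1/4)) ^ ((n : ℝ) / 2) : ℝ) : ℂ) * ((rexp (-(t * (2 * π * ‖η‖) ^ 2)) : ℝ) : ℂ) =
       (π / (1/4 : ℂ)) ^ (Module.finrank ℝ (Eu n) / 2 : ℂ) * cexp (-π ^ 2 * ‖√t • η‖ ^ 2 / (1/4 : ℂ)) := by
      rw [Complex.ofReal_cpow (by positivity)]
      congr 1
      · simp
      · rw [norm_smul, Real.norm_of_nonneg (by positivity)]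
        have : (√t : ℂ) ^ 2 = t := by exact_mod_cast Real.sq_sqrt ht
        push_cast
        congr 1
        rw [mul_pow (√t : ℂ), this]; ring
    rw [e1, ← h, ← integral_const_mul]
    congr 1; ext w
    rw [smul_eq_mul, ← mul_assoc, ← Complex.exp_add, mul_comm]
    push_cast
    congr 2
    · simp only [inner_sub_right, inner_smul_right, real_inner_comm w η]
      push_cast; ring
  simp only [hinv (_ - _)]
  simp only [← integral_const_mul]
  rw [integral_integral_swap]
  · unfold HT
    rw [Real.fourierInv_eq', ]
    congr 1; ext η
    have : ∀ w : Eu n, (((((π / (1/4)) ^ ((n : ℝ) / 2))⁻¹ : ℝ)) : ℂ) * (((rexp (-(1/4) * ‖w‖ ^ 2) : ℝ) : ℂ) *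
      (cexp (↑(2 * π * ⟪η, x - √t • w⟫) * I) * 𝓕 (H : Eu n → ℂ) η)) =
       (((((π / (1/4)) ^ ((n : ℝ) / 2))⁻¹ : ℝ)) * 𝓕 (H : Eu n → ℂ) η) * (((rexp (-(1/4) * ‖w‖ ^ 2) : ℝ) : ℂ) *
      cexp (↑(2 * π * ⟪η, x - √t • w⟫) * I)) := fun w => by ring
    simp only [this]
    rw [integral_const_mul, hG, smul_eq_mul, Complex.ofReal_inv]
    have hne : (((π / (1/4)) ^ ((n : ℝ) / 2) : ℝ) : ℂ) ≠ 0 := by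
      rw [Complex.ofReal_ne_zero]; positivity
    generalize (((π / (1/4)) ^ ((n : ℝ) / 2) : ℝ) : ℂ) = k at hne ⊢
    field_simp
  · refine Integrable.const_mul ?_ _
    have h1 : Integrable (fun q : Eu n × Eu n => ((rexp (-(1/4) * ‖q.1‖ ^ 2) : ℝ) : ℂ) * 𝓕 (H : Eu n → ℂ) q.2) (volume.prod volume) :=
      (gauss_integrable (n := n) (b := 1/4) (by norm_num)).ofReal.mul_prod hFint
    refine h1.congr' ?_ (Filter.Eventually.of_forall fun q => ?_) |>.congr (Filter.Eventually.of_forall fun q => rfl)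
    · refine AEStronglyMeasurable.mul ?_ (AEStronglyMeasurable.mul ?_ ?_)
      · exact Continuous.aestronglyMeasurable (by fun_prop)
      · exact Continuous.aestronglyMeasurable (by fun_prop)
      · exact (hFint.aestronglyMeasurable.comp_snd)
    · simp only [norm_mul, Complex.norm_exp_ofReal_mul_I, one_mul]

lemma HT_decay {n : ℕ} (H : SchwartzMap (Eu n) ℂ) (N : ℕ) :
    ∃ C : ℝ, 0 ≤ C ∧ ∀ t ∈ Set.Icc (0:ℝ) 1, ∀ x, ‖x‖ ^ N * ‖HT t (𝓕 (H : Eu n → ℂ)) x‖ ≤ C := by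
  obtain ⟨κ, hκ, hH⟩ := HT_eq (n := n)
  obtain ⟨A, hA⟩ : ∃ A, ∀ y, ‖y‖ ^ N * ‖H y‖ ≤ A := by
    obtain ⟨A, hA⟩ := H.decay N 0
    exact ⟨A, by simpa using hA.2⟩
  obtain ⟨B, hB⟩ : ∃ B, ∀ y, ‖H y‖ ≤ B := by
    obtain ⟨A, hA⟩ := H.decay 0 0
    exact ⟨A, by simpa using hA.2⟩
  have hA0 : 0 ≤ A := (by positivity : (0:ℝ) ≤ ‖(0 : Eu n)‖ ^ N * ‖H 0‖).trans (hA 0)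
  have hB0 : 0 ≤ B := (norm_nonneg _).trans (hB 0)
  refine ⟨κ * ∫ w : Eu n, (2 ^ N * A) * rexp (-(1/4) * ‖w‖ ^ 2) + (2 ^ N * B) * (rexp (-(1/4) * ‖w‖ ^ 2) * ‖w‖ ^ N),
    mul_nonneg hκ.le (integral_nonneg fun w => by simp only [Pi.zero_apply]; positivity), fun t ht x => ?_⟩
  rw [hH H t x ht.1, norm_mul, Complex.norm_real, Real.norm_of_nonneg hκ.le, mul_left_comm]
  gcongr
  have h1 : ‖x‖ ^ N * ‖∫ w : Eu n, ((rexp (-(1/4) * ‖w‖ ^ 2) : ℝ) : ℂ) * H (x - √t • w)‖ =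
    ‖∫ w : Eu n, ((‖x‖ ^ N : ℝ) : ℂ) * (((rexp (-(1/4) * ‖w‖ ^ 2) : ℝ) : ℂ) * H (x - √t • w))‖ := by
    rw [integral_const_mul, norm_mul, Complex.norm_real, Real.norm_of_nonneg (by positivity)]
  rw [h1]
  refine norm_integral_le_of_norm_le (((gauss_integrable (by norm_num)).const_mul _).add ((gauss_pow_integrable N).const_mul _))
    (Filter.Eventually.of_forall fun w => ?_)
  rw [norm_mul, norm_mul, Complex.norm_real, Complex.norm_real, Real.norm_of_nonneg (by positivity),
    Real.norm_of_nonneg (by positivity)]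
  have hst : √t ≤ 1 := Real.sqrt_le_one.mpr ht.2
  have h2 : ‖x‖ ≤ ‖x - √t • w‖ + ‖w‖ := by
    calc ‖x‖ = ‖(x - √t • w) + √t • w‖ := by simp
      _ ≤ ‖x - √t • w‖ + ‖√t • w‖ := norm_add_le _ _
      _ ≤ ‖x - √t • w‖ + ‖w‖ := by
        gcongr
        rw [norm_smul, Real.norm_of_nonneg (by positivity)]
        nlinarith [norm_nonneg w]
  have h3 : ‖x‖ ^ N ≤ 2 ^ N * (‖x - √t • w‖ ^ N + ‖w‖ ^ N) := by
    refine (pow_le_pow_left₀ (norm_nonneg _) h2 N).trans ((add_pow_le (norm_nonneg _) (norm_nonneg _) N).trans ?_)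
    gcongr
    · norm_num
    · omega
  have h4 : ‖x‖ ^ N * ‖H (x - √t • w)‖ ≤ 2 ^ N * A + 2 ^ N * B * ‖w‖ ^ N := by
    calc ‖x‖ ^ N * ‖H (x - √t • w)‖ ≤ 2 ^ N * (‖x - √t • w‖ ^ N + ‖w‖ ^ N) * ‖H (x - √t • w)‖ := by gcongr
      _ = 2 ^ N * (‖x - √t • w‖ ^ N * ‖H (x - √t • w)‖) + 2 ^ N * ‖H (x - √t • w)‖ * ‖w‖ ^ N := by ring
      _ ≤ _ := by
        gcongr
        · exact hA _
        · exact hB _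
  have := Real.exp_pos (-(1/4) * ‖w‖ ^ 2)
  nlinarith

lemma HT_lower {n : ℕ} (h : SchwartzMap (Eu n) ℂ) (ρ : Eu n → ℝ) (hρ : ∀ y, h y = ρ y)
    (hρ0 : ∀ y, 0 ≤ ρ y) (hρ1 : 0 < ρ 0) :
    ∃ c : ℝ, 0 < c ∧ ∀ (t : ℝ) (x : Eu n), 0 < t →
      ∃ v : ℝ, 0 ≤ v ∧ HT t (𝓕 (h : Eu n → ℂ)) x = v ∧
      (1 ≤ ‖x‖ → ‖x‖ ^ 2 ≤ t → c * t ^ (-(n : ℝ) / 2) ≤ v) := by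
  obtain ⟨κ, hκ, hH⟩ := HT_eq (n := n)
  have hρc : Continuous ρ := by
    have : ρ = fun y => (h y).re := by ext y; simp [hρ]
    rw [this]; exact Complex.continuous_re.comp h.continuous
  have hρi : Integrable ρ := by
    have : ρ = fun y => (h y).re := by ext y; simp [hρ]
    rw [this]; exact h.integrable.re
  have hpos : 0 < ∫ y in Metric.ball (0 : Eu n) 1, ρ y := by
    rw [setIntegral_pos_iff_support_of_nonneg_ae (Filter.Eventually.of_forall hρ0) hρi.integrableOn]
    refine IsOpen.measure_pos _ (hρc.isOpen_support.inter Metric.isOpen_ball) ⟨0, ?_, by simp⟩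
    exact hρ1.ne'
  refine ⟨κ * (rexp (-1) * ∫ y in Metric.ball (0 : Eu n) 1, ρ y), by positivity, fun t x ht => ?_⟩
  have hst : 0 < √t := Real.sqrt_pos.mpr ht
  have e1 : ∫ w : Eu n, rexp (-(1/4) * ‖w‖ ^ 2) * ρ (x - √t • w) =
     t ^ (-(n : ℝ) / 2) * ∫ y : Eu n, rexp (-(1/4) * ‖(√t)⁻¹ • (x - y)‖ ^ 2) * ρ y := by
    have a1 := Measure.integral_comp_smul (volume : Measure (Eu n))
      (fun z => rexp (-(1/4) * ‖(√t)⁻¹ • z‖ ^ 2) * ρ (x - z)) (√t)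
    have a2 := integral_sub_left_eq_self (fun z => rexp (-(1/4) * ‖(√t)⁻¹ • (x - z)‖ ^ 2) * ρ z) (volume : Measure (Eu n)) x
    simp only [smul_smul, inv_mul_cancel₀ hst.ne', one_smul] at a1
    simp only [sub_sub_cancel] at a2
    rw [a1, a2, smul_eq_mul]
    congr 1
    simp only [finrank_euclideanSpace, Fintype.card_fin]
    rw [abs_of_pos (by positivity), Real.sqrt_eq_rpow, ← Real.rpow_natCast, ← Real.rpow_mul ht.le, ← Real.rpow_neg ht.le]
    congr 1; ring
  refine ⟨κ * ∫ w : Eu n, rexp (-(1/4) * ‖w‖ ^ 2) * ρ (x - √t • w), ?_, ?_, ?_⟩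
  · exact mul_nonneg hκ.le (integral_nonneg fun w => mul_nonneg (Real.exp_pos _).le (hρ0 _))
  · rw [hH h t x ht.le]
    simp only [hρ]
    push_cast
    rw [← integral_complex_ofReal]
    push_cast
    rfl
  · intro hx1 hx2
    rw [e1, mul_assoc, mul_comm (t ^ _)]
    gcongr
    rw [← integral_const_mul, ← integral_indicator measurableSet_ball]
    have hint : Integrable (fun y : Eu n => rexp (-(1/4) * ‖(√t)⁻¹ • (x - y)‖ ^ 2) * ρ y) := by
      refine hρi.mono' (by fun_prop) (Filter.Eventually.of_forall fun y => ?_)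
      rw [norm_mul, Real.norm_of_nonneg (Real.exp_pos _).le, Real.norm_of_nonneg (hρ0 _)]
      refine mul_le_of_le_one_left (hρ0 _) (Real.exp_le_one_iff.mpr ?_)
      nlinarith [sq_nonneg ‖(√t)⁻¹ • (x - y)‖]
    refine integral_mono ((hρi.const_mul _).indicator measurableSet_ball) hint fun y => ?_
    by_cases hy : y ∈ Metric.ball (0 : Eu n) 1
    · rw [Set.indicator_of_mem hy]
      refine mul_le_mul_of_nonneg_right (Real.exp_le_exp.mpr ?_) (hρ0 _)
      have b1 : ‖x - y‖ ≤ 2 * ‖x‖ := by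
        have : ‖y‖ < 1 := by simpa using hy
        linarith [norm_sub_le x y]
      rw [norm_smul, mul_pow, norm_inv, inv_pow, Real.norm_of_nonneg hst.le, Real.sq_sqrt ht.le]
      have b2 : ‖x - y‖ ^ 2 ≤ 4 * t := by nlinarith [norm_nonneg (x - y)]
      have b3 : t⁻¹ * ‖x - y‖ ^ 2 ≤ 4 := by
        rw [inv_mul_le_iff₀ ht]; linarith
      linarith
    · rw [Set.indicator_of_notMem hy]
      exact mul_nonneg (Real.exp_pos _).le (hρ0 _)

lemma intOn_rpow_exp (a y : ℝ) (hy : 0 < y) :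
    IntegrableOn (fun t : ℝ => t ^ a * rexp (-(y * t))) (Set.Ioi 1) := by
  refine integrable_of_isBigO_exp_neg (b := y / 2) (by positivity) ?_ ?_
  · refine ContinuousOn.mul (fun t ht => ?_) (by fun_prop)
    exact (Real.continuousAt_rpow_const _ _ (Or.inl (by
      have : (1:ℝ) ≤ t := ht
      positivity))).continuousWithinAt
  · have h := (isLittleO_rpow_exp_pos_mul_atTop a (b := y / 2) (by positivity)).isBigO
    have h2 := h.mul (Asymptotics.isBigO_refl (fun t : ℝ => rexp (-(y * t))) Filter.atTop)
    refine h2.trans (Asymptotics.isBigO_of_le _ fun t => ?_)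
    rw [← Real.exp_add]
    apply le_of_eq
    congr 2
    ring

lemma I_step (σ y : ℝ) (hy : 0 < y) (k : ℕ) :
    ∫ t in Set.Ioi (1:ℝ), y ^ (k+1) * (t ^ (((k + 1 : ℕ) : ℝ) - σ - 1) * rexp (-(y * t))) =
      y ^ k * rexp (-y) + (k - σ) * ∫ t in Set.Ioi (1:ℝ), y ^ k * (t ^ ((k : ℝ) - σ - 1) * rexp (-(y * t))) := by
  have hd : ∀ t ∈ Set.Ici (1:ℝ), HasDerivAt (fun t : ℝ => t ^ ((k : ℝ) - σ) * rexp (-(y * t)))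
      ((k - σ) * (t ^ ((k : ℝ) - σ - 1) * rexp (-(y * t))) - y * (t ^ ((k : ℝ) - σ) * rexp (-(y * t)))) t := by
    intro t ht
    have ht0 : (0:ℝ) < t := lt_of_lt_of_le one_pos ht
    have h1 := Real.hasDerivAt_rpow_const (x := t) (p := (k : ℝ) - σ) (Or.inl ht0.ne')
    have h2 : HasDerivAt (fun t : ℝ => rexp (-(y * t))) (rexp (-(y * t)) * (-y)) t := by
      have := ((hasDerivAt_id t).const_mul y).neg.exp
      simpa using this
    refine (h1.mul h2).congr_deriv ?_
    ring
  have hi1 := intOn_rpow_exp (k - σ) y hy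
  have hi2 := intOn_rpow_exp (k - σ - 1) y hy
  have hlim : Filter.Tendsto (fun t : ℝ => t ^ ((k : ℝ) - σ) * rexp (-(y * t))) Filter.atTop (nhds 0) := by
    simpa using tendsto_rpow_mul_exp_neg_mul_atTop_nhds_zero ((k : ℝ) - σ) y hy
  have hint := integral_Ioi_of_hasDerivAt_of_tendsto' hd ((hi2.const_mul _).sub (hi1.const_mul _)) hlim
  have e3 : ∫ t in Set.Ioi (1:ℝ), ((k - σ) * (t ^ ((k : ℝ) - σ - 1) * rexp (-(y * t))) - y * (t ^ ((k : ℝ) - σ) * rexp (-(y * t)))) =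
    (k - σ) * (∫ t in Set.Ioi (1:ℝ), (t ^ ((k : ℝ) - σ - 1) * rexp (-(y * t)))) - y * ∫ t in Set.Ioi (1:ℝ), (t ^ ((k : ℝ) - σ) * rexp (-(y * t))) := by
    rw [← integral_const_mul, ← integral_const_mul]
    exact integral_sub (hi2.const_mul _) (hi1.const_mul _)
  rw [e3] at hint
  simp only [Real.one_rpow, mul_one, one_mul] at hint
  have e : ((k + 1 : ℕ) : ℝ) - σ - 1 = k - σ := by push_cast; ring
  rw [e, integral_const_mul, integral_const_mul]
  rw [pow_succ]
  linear_combination (-y ^ k) * hint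

lemma I_poly (σ : ℝ) (k : ℕ) : ∃ P : Polynomial ℝ, ∀ y : ℝ, 0 < y →
    ∫ t in Set.Ioi (1:ℝ), y ^ k * (t ^ ((k : ℝ) - σ - 1) * rexp (-(y * t))) =
      P.eval y * rexp (-y) + (∏ j ∈ Finset.range k, ((j : ℝ) - σ)) *
        ∫ t in Set.Ioi (1:ℝ), t ^ (- σ - 1) * rexp (-(y * t)) := by
  induction k with
  | zero => exact ⟨0, fun y hy => by simp⟩
  | succ k ih =>
    obtain ⟨P, hP⟩ := ih
    refine ⟨Polynomial.X ^ k + Polynomial.C (k - σ) * P, fun y hy => ?_⟩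
    rw [I_step σ y hy k, hP y hy, Finset.prod_range_succ]
    simp
    ring

lemma scalar_id (σ : ℝ) (m : ℕ) (hm : σ < m) : ∃ P : Polynomial ℝ, ∀ y : ℝ, 0 < y →
    Real.Gamma (m - σ) * y ^ σ =
      (∫ t in Set.Ioc (0:ℝ) 1, t ^ ((m : ℝ) - σ - 1) * rexp (-(y * t))) * y ^ m +
      rexp (-y) * P.eval y + (∏ j ∈ Finset.range m, ((j : ℝ) - σ)) *
        ∫ t in Set.Ioi (1:ℝ), t ^ (- σ - 1) * rexp (-(y * t)) := by
  obtain ⟨P, hP⟩ := I_poly σ m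
  refine ⟨P, fun y hy => ?_⟩
  have hg := Real.integral_rpow_mul_exp_neg_mul_Ioi (a := m - σ) (r := y) (by linarith) hy
  have hi1 : IntegrableOn (fun t : ℝ => t ^ ((m : ℝ) - σ - 1) * rexp (-(y * t))) (Set.Ioc 0 1) := by
    have h0 : IntegrableOn (fun t : ℝ => t ^ ((m : ℝ) - σ - 1)) (Set.Ioc 0 1) := by
      rw [← intervalIntegrable_iff_integrableOn_Ioc_of_le zero_le_one]
      exact intervalIntegral.intervalIntegrable_rpow' (by linarith)
    refine h0.mono' (by fun_prop) ?_
    filter_upwards [ae_restrict_mem measurableSet_Ioc] with t ht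
    have ht0 : 0 < t := ht.1
    rw [Real.norm_of_nonneg (by positivity)]
    refine mul_le_of_le_one_right (by positivity) (Real.exp_le_one_iff.mpr ?_)
    have := mul_pos hy ht0
    linarith
  have hi2 := intOn_rpow_exp (m - σ - 1) y hy
  rw [← Set.Ioc_union_Ioi_eq_Ioi zero_le_one, setIntegral_union (Set.Ioc_disjoint_Ioi le_rfl) measurableSet_Ioi hi1 hi2] at hg
  have := hP y hy
  rw [integral_const_mul] at this
  have e : y ^ m * ((1 / y) ^ ((m : ℝ) - σ)) = y ^ σ := by
    rw [one_div, Real.inv_rpow hy.le, ← Real.rpow_neg hy.le, ← Real.rpow_natCast, ← Real.rpow_add hy]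
    congr 1; ring
  rw [← e]
  linear_combination this - y ^ m * hg

lemma fi_conv {n : ℕ} {u : Eu n → ℂ} (hu : Integrable u) (x : Eu n) :
    Integrable (fun v : Eu n => 𝐞 ⟪v, x⟫ • u v) := by
  have := (Real.fourierIntegral_convergent_iff (μ := volume) (f := u) (-x)).mpr hu
  simpa using this

lemma fi_add {n : ℕ} {u v : Eu n → ℂ} (hu : Integrable u) (hv : Integrable v) (x : Eu n) :
    𝓕⁻ (fun η => u η + v η) x = 𝓕⁻ u x + 𝓕⁻ v x := by
  simp only [Real.fourierInv_eq]
  rw [← integral_add (fi_conv hu x) (fi_conv hv x)]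
  simp only [smul_add]

lemma fi_const_mul {n : ℕ} (c : ℂ) (u : Eu n → ℂ) (x : Eu n) :
    𝓕⁻ (fun η => c * u η) x = c * 𝓕⁻ u x := by
  simp only [Real.fourierInv_eq]
  rw [← integral_const_mul]
  simp only [mul_smul_comm]

lemma fubini_HT {n : ℕ} (S : Set ℝ) (hS : MeasurableSet S) (hS0 : ∀ t ∈ S, 0 ≤ t) (a : ℝ)
    (ha : IntegrableOn (fun t : ℝ => t ^ a) S) (ψ : Eu n → ℂ) (hψ : Integrable ψ) (x : Eu n) :
    IntegrableOn (fun t : ℝ => ((t ^ a : ℝ) : ℂ) * HT t ψ x) S ∧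
    Integrable (fun η : Eu n => ((∫ t in S, t ^ a * rexp (-((2 * π * ‖η‖) ^ 2 * t)) : ℝ) : ℂ) * ψ η) ∧
    𝓕⁻ (fun η : Eu n => ((∫ t in S, t ^ a * rexp (-((2 * π * ‖η‖) ^ 2 * t)) : ℝ) : ℂ) * ψ η) x =
      ∫ t in S, ((t ^ a : ℝ) : ℂ) * HT t ψ x := by
  have hbase : Integrable (fun z : ℝ × Eu n => ((z.1 ^ a : ℝ) : ℂ) * ψ z.2)
      ((volume.restrict S).prod volume) :=
    Integrable.mul_prod (f := fun t : ℝ => ((t ^ a : ℝ) : ℂ)) (g := ψ) (Integrable.ofReal ha) hψ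
  have key : ∀ x : Eu n, Integrable (fun z : ℝ × Eu n => (𝐞 ⟪z.2, x⟫ : ℂ) * ((rexp (-((2 * π * ‖z.2‖) ^ 2 * z.1)) : ℝ) : ℂ)
      * (((z.1 ^ a : ℝ) : ℂ) * ψ z.2)) ((volume.restrict S).prod volume) := by
    intro x
    refine hbase.bdd_mul (c := 1) ?_ ?_
    · refine Continuous.aestronglyMeasurable ?_
      have : Continuous fun z : ℝ × Eu n => (𝐞 ⟪z.2, x⟫ : ℂ) :=
        continuous_subtype_val.comp (Real.continuous_fourierChar.comp (by fun_prop))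
      fun_prop
    · have h1 : ∀ᵐ t ∂(volume.restrict S), 0 ≤ t := by
        filter_upwards [ae_restrict_mem hS] with t ht using hS0 t ht
      have h2 := Measure.quasiMeasurePreserving_fst (μ := volume.restrict S) (ν := (volume : Measure (Eu n))) |>.ae h1
      filter_upwards [h2] with z hz
      rw [norm_mul, Circle.norm_coe, one_mul, Complex.norm_real, Real.norm_of_nonneg (Real.exp_pos _).le]
      refine Real.exp_le_one_iff.mpr ?_
      have : 0 ≤ (2 * π * ‖z.2‖) ^ 2 * z.1 := by positivity
      linarith
  have eL : ∀ t η, (𝐞 ⟪η, x⟫ : ℂ) * ((rexp (-((2 * π * ‖η‖) ^ 2 * t)) : ℝ) : ℂ) * (((t ^ a : ℝ) : ℂ) * ψ η) =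
     ((t ^ a : ℝ) : ℂ) * (𝐞 ⟪η, x⟫ • (((rexp (-(t * (2 * π * ‖η‖) ^ 2)) : ℝ) : ℂ) * ψ η)) := by
    intro t η
    rw [Circle.smul_def, smul_eq_mul, mul_comm t]
    ring
  have eL2 : ∀ t, ∫ η : Eu n, (𝐞 ⟪η, x⟫ : ℂ) * ((rexp (-((2 * π * ‖η‖) ^ 2 * t)) : ℝ) : ℂ) * (((t ^ a : ℝ) : ℂ) * ψ η) =
     ((t ^ a : ℝ) : ℂ) * HT t ψ x := by
    intro t
    simp only [eL]
    rw [integral_const_mul, HT, Real.fourierInv_eq]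
  have eR2 : ∀ (x η : Eu n), ∫ t in S, (𝐞 ⟪η, x⟫ : ℂ) * ((rexp (-((2 * π * ‖η‖) ^ 2 * t)) : ℝ) : ℂ) * (((t ^ a : ℝ) : ℂ) * ψ η) =
      𝐞 ⟪η, x⟫ • (((∫ t in S, t ^ a * rexp (-((2 * π * ‖η‖) ^ 2 * t)) : ℝ) : ℂ) * ψ η) := by
    intro x η
    rw [← integral_complex_ofReal, ← integral_mul_const, Circle.smul_def, smul_eq_mul, ← integral_const_mul]
    congr 1
    ext t
    push_cast
    ring
  refine ⟨?_, ?_, ?_⟩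
  · have := (key x).integral_prod_left
    simp only [eL2] at this
    exact this
  · have := (key 0).integral_prod_right
    simp only [eR2] at this
    simpa using this
  · have := integral_integral_swap (f := fun (t : ℝ) (η : Eu n) => (𝐞 ⟪η, x⟫ : ℂ) * ((rexp (-((2 * π * ‖η‖) ^ 2 * t)) : ℝ) : ℂ) * (((t ^ a : ℝ) : ℂ) * ψ η)) (key x)
    simp only [eL2] at this
    rw [this, Real.fourierInv_eq]
    simp only [eR2]

lemma poly_schwartz {n : ℕ} (P : Polynomial ℝ) (h : SchwartzMap (Eu n) ℂ) :
    ∃ H : SchwartzMap (Eu n) ℂ, ∀ η, 𝓕 (H : Eu n → ℂ) η =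
      ((P.eval ((2 * π * ‖η‖) ^ 2) : ℝ) : ℂ) * 𝓕 (h : Eu n → ℂ) η := by
  have hsq : (fun η : Eu n => (2 * π * ‖η‖) ^ 2).HasTemperateGrowth := by
    have e : (fun η : Eu n => (2 * π * ‖η‖) ^ 2) = (fun η : Eu n => (2 * π) ^ 2 * ‖η‖ ^ 2) := by
      ext η; ring
    rw [e]
    exact (Function.HasTemperateGrowth.const _).mul (Function.hasTemperateGrowth_norm_sq (H := Eu n))
  have hP : (fun η : Eu n => P.eval ((2 * π * ‖η‖) ^ 2)).HasTemperateGrowth := by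
    induction P using Polynomial.induction_on' with
    | add p q hp hq => 
      simp only [Polynomial.eval_add]
      exact hp.add hq
    | monomial k c =>
      simp only [Polynomial.eval_monomial]
      exact (Function.HasTemperateGrowth.const _).mul (hsq.pow k)
  have hP2 : (fun η : Eu n => ((P.eval ((2 * π * ‖η‖) ^ 2) : ℝ) : ℂ)).HasTemperateGrowth :=
    Function.HasTemperateGrowth.comp Function.Complex.hasTemperateGrowth_ofReal hP
  refine ⟨𝓕⁻ (SchwartzMap.smulLeftCLM ℂ (fun η : Eu n => ((P.eval ((2 * π * ‖η‖) ^ 2) : ℝ) : ℂ)) (𝓕 h)), fun η => ?_⟩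
  rw [← SchwartzMap.fourier_coe, FourierTransform.fourier_fourierInv_eq, SchwartzMap.smulLeftCLM_apply_apply hP2,
    SchwartzMap.fourier_coe, smul_eq_mul]

lemma TT0_lower {n : ℕ} (hn : 1 ≤ n) (s : ℝ) (hs : 0 < s) (hnev : ¬ ∃ m : ℕ, s = 2 * m)
    (h : SchwartzMap (Eu n) ℂ) (ρ : Eu n → ℝ) (hρ : ∀ y, h y = ρ y)
    (hρ0 : ∀ y, 0 ≤ ρ y) (hρ1 : 0 < ρ 0) :
    ∃ c R : ℝ, 0 < c ∧ 1 ≤ R ∧ ∀ x : Eu n, R ≤ ‖x‖ →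
      c * ‖x‖ ^ (-((n : ℝ) + s)) ≤ ‖TT s 0 (𝓕 (h : Eu n → ℂ)) x‖ := by
  obtain ⟨c0, hc0, hlow⟩ := HT_lower h ρ hρ hρ0 hρ1
  set σ := s / 2 with hσ
  have hσ0 : 0 < σ := by positivity
  set m := ⌊σ⌋₊ + 1 with hm
  have hmσ : σ < m := by rw [hm]; exact_mod_cast Nat.lt_floor_add_one σ
  obtain ⟨P, hP⟩ := scalar_id σ m hmσ
  obtain ⟨H1, hH1⟩ := poly_schwartz (Polynomial.X ^ m) h
  obtain ⟨H2, hH2⟩ := poly_schwartz P h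
  set N := n + ⌈s⌉₊ + 1 with hN
  obtain ⟨C1, hC1, hd1⟩ := HT_decay H1 N
  obtain ⟨C2, hC2, hd2⟩ := HT_decay H2 N
  set A := ∏ j ∈ Finset.range m, ((j : ℝ) - σ) with hA
  have hA0 : A ≠ 0 := by
    rw [hA, Finset.prod_ne_zero_iff]
    intro j _ hj
    exact hnev ⟨j, by rw [hσ] at hj; linarith⟩
  have hΓ : 0 < Real.Gamma (m - σ) := Real.Gamma_pos_of_pos (by linarith)
  have hFh : Integrable (𝓕 (h : Eu n → ℂ)) := by
    rw [← SchwartzMap.fourier_coe]; exact (𝓕 h).integrable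
  have hFH1 : Integrable (𝓕 (H1 : Eu n → ℂ)) := by
    rw [← SchwartzMap.fourier_coe]; exact (𝓕 H1).integrable
  have hFH2 : Integrable (𝓕 (H2 : Eu n → ℂ)) := by
    rw [← SchwartzMap.fourier_coe]; exact (𝓕 H2).integrable
  have hi1 : IntegrableOn (fun t : ℝ => t ^ ((m : ℝ) - σ - 1)) (Set.Ioc 0 1) := by
    rw [← intervalIntegrable_iff_integrableOn_Ioc_of_le zero_le_one]
    exact intervalIntegral.intervalIntegrable_rpow' (by linarith)
  have hi3 : IntegrableOn (fun t : ℝ => t ^ (-σ - 1)) (Set.Ioi 1) :=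
    integrableOn_Ioi_rpow_of_lt (by linarith) one_pos
  have hid : ∀ x : Eu n, ((Real.Gamma (m - σ) : ℝ) : ℂ) * TT s 0 (𝓕 (h : Eu n → ℂ)) x =
      (∫ t in Set.Ioc (0:ℝ) 1, ((t ^ ((m : ℝ) - σ - 1) : ℝ) : ℂ) * HT t (𝓕 (H1 : Eu n → ℂ)) x) +
      HT 1 (𝓕 (H2 : Eu n → ℂ)) x +
      (A : ℂ) * ∫ t in Set.Ioi (1:ℝ), ((t ^ (-σ - 1) : ℝ) : ℂ) * HT t (𝓕 (h : Eu n → ℂ)) x := by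
    intro x
    obtain ⟨_, b1, d1⟩ := fubini_HT (Set.Ioc (0:ℝ) 1) measurableSet_Ioc (fun t ht => ht.1.le) _ hi1 _ hFH1 x
    obtain ⟨_, b3, d3⟩ := fubini_HT (Set.Ioi (1:ℝ)) measurableSet_Ioi (fun t ht => zero_le_one.trans (le_of_lt ht)) _ hi3 _ hFh x
    have b2 : Integrable (fun η : Eu n => ((rexp (-(1 * (2 * π * ‖η‖) ^ 2)) : ℝ) : ℂ) * 𝓕 (H2 : Eu n → ℂ) η) := by
      refine hFH2.bdd_mul (c := 1) (Continuous.aestronglyMeasurable (by fun_prop)) (Filter.Eventually.of_forall fun η => ?_)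
      rw [Complex.norm_real, Real.norm_of_nonneg (Real.exp_pos _).le]
      refine Real.exp_le_one_iff.mpr ?_
      have : 0 ≤ 1 * (2 * π * ‖η‖) ^ 2 := by positivity
      linarith
    have b12 : Integrable (fun η : Eu n => ((∫ t in Set.Ioc (0:ℝ) 1, t ^ ((m : ℝ) - σ - 1) * rexp (-((2 * π * ‖η‖) ^ 2 * t)) : ℝ) : ℂ) * 𝓕 (H1 : Eu n → ℂ) η +
      ((rexp (-(1 * (2 * π * ‖η‖) ^ 2)) : ℝ) : ℂ) * 𝓕 (H2 : Eu n → ℂ) η) := b1.add b2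
    rw [← d1, ← d3, HT, ← fi_const_mul, ← fi_add b1 b2, ← fi_add b12 (b3.const_mul _), TT, ← fi_const_mul]
    refine Real.fourierInv_congr_ae ?_ x
    have : Nonempty (Fin n) := ⟨⟨0, hn⟩⟩
    have hne : ∀ᵐ η : Eu n, η ≠ 0 := by
      simp [ae_iff, measure_singleton]
    filter_upwards [hne] with η hη
    have hy : 0 < (2 * π * ‖η‖) ^ 2 := by have := norm_pos_iff.mpr hη; positivity
    have := congrArg (fun r : ℝ => (r : ℂ)) (hP _ hy)
    rw [hH1, hH2]
    have e0 : (0:ℝ) ^ 2 + (2 * π * ‖η‖) ^ 2 = (2 * π * ‖η‖) ^ 2 := by ring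
    rw [e0, ← mul_assoc, ← Complex.ofReal_mul, hP _ hy]
    simp only [Polynomial.eval_pow, Polynomial.eval_X, one_mul]
    push_cast
    ring
  have hK : 0 ≤ ∫ t in Set.Ioc (0:ℝ) 1, t ^ ((m : ℝ) - σ - 1) :=
    setIntegral_nonneg measurableSet_Ioc fun t ht => Real.rpow_nonneg ht.1.le _
  set K := ∫ t in Set.Ioc (0:ℝ) 1, t ^ ((m : ℝ) - σ - 1) with hKdef
  have hp1 : ∀ x : Eu n, 1 ≤ ‖x‖ → ‖∫ t in Set.Ioc (0:ℝ) 1, ((t ^ ((m : ℝ) - σ - 1) : ℝ) : ℂ) * HT t (𝓕 (H1 : Eu n → ℂ)) x‖ ≤ K * (C1 / ‖x‖ ^ N) := by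
    intro x hx
    rw [hKdef, ← integral_mul_const]
    refine norm_integral_le_of_norm_le (hi1.mul_const _) ?_
    filter_upwards [ae_restrict_mem measurableSet_Ioc] with t ht
    rw [norm_mul, Complex.norm_real, Real.norm_of_nonneg (Real.rpow_nonneg ht.1.le _)]
    refine mul_le_mul_of_nonneg_left ?_ (Real.rpow_nonneg ht.1.le _)
    rw [le_div_iff₀ (by positivity), mul_comm]
    exact hd1 t ⟨ht.1.le, ht.2⟩ x
  have hp2 : ∀ x : Eu n, 1 ≤ ‖x‖ → ‖HT 1 (𝓕 (H2 : Eu n → ℂ)) x‖ ≤ C2 / ‖x‖ ^ N := by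
    intro x hx
    rw [le_div_iff₀ (by positivity), mul_comm]
    exact hd2 1 ⟨zero_le_one, le_rfl⟩ x
  set q := σ + (n : ℝ) / 2 with hq
  have hq0 : 0 < q := by positivity
  have hp3 : ∀ x : Eu n, 1 ≤ ‖x‖ → c0 / q * ‖x‖ ^ (-((n : ℝ) + s)) ≤
      ‖∫ t in Set.Ioi (1:ℝ), ((t ^ (-σ - 1) : ℝ) : ℂ) * HT t (𝓕 (h : Eu n → ℂ)) x‖ := by
    intro x hx
    obtain ⟨b3, _, _⟩ := fubini_HT (Set.Ioi (1:ℝ)) measurableSet_Ioi (fun t ht => zero_le_one.trans (le_of_lt ht)) _ hi3 _ hFh x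
    have hre : ∀ t : ℝ, 0 < t → 0 ≤ (HT t (𝓕 (h : Eu n → ℂ)) x).re ∧
        (‖x‖ ^ 2 ≤ t → c0 * t ^ (-(n : ℝ) / 2) ≤ (HT t (𝓕 (h : Eu n → ℂ)) x).re) := by
      intro t ht
      obtain ⟨v, v0, v1, v2⟩ := hlow t x ht
      rw [v1, Complex.ofReal_re]
      exact ⟨v0, v2 hx⟩
    refine le_trans ?_ (Complex.re_le_norm _)
    rw [← RCLike.re_eq_complex_re, ← integral_re b3]
    have hx2 : 1 ≤ ‖x‖ ^ 2 := one_le_pow₀ hx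
    have e1 : c0 / q * ‖x‖ ^ (-((n : ℝ) + s)) = ∫ t in Set.Ioi (‖x‖ ^ 2), c0 * t ^ (-q - 1) := by
      rw [integral_const_mul, integral_Ioi_rpow_of_lt (by linarith) (by positivity)]
      have : (‖x‖ ^ 2) ^ (-q - 1 + 1) = ‖x‖ ^ (-((n : ℝ) + s)) := by
        rw [← Real.rpow_natCast, ← Real.rpow_mul (norm_nonneg _)]
        congr 1
        rw [hq, hσ]; push_cast; ring
      rw [this, show -q - 1 + 1 = -q by ring, neg_div_neg_eq]
      ring
    rw [e1]
    refine le_trans ?_ (setIntegral_mono_set (s := Set.Ioi (‖x‖ ^ 2)) b3.re ?_ (Filter.Eventually.of_forall (Set.Ioi_subset_Ioi hx2)))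
    · refine setIntegral_mono_on ((integrableOn_Ioi_rpow_of_lt (by linarith) (by positivity)).const_mul _)
        (IntegrableOn.mono_set (t := Set.Ioi 1) b3.re (Set.Ioi_subset_Ioi hx2)) measurableSet_Ioi fun t ht => ?_
      have ht' : ‖x‖ ^ 2 < t := ht
      have ht0 : 0 < t := by linarith
      have := (hre t ht0).2 ht'.le
      rw [RCLike.re_eq_complex_re, Complex.re_ofReal_mul]
      calc c0 * t ^ (-q - 1) = t ^ (-σ - 1) * (c0 * t ^ (-(n : ℝ) / 2)) := by
            rw [mul_left_comm, ← Real.rpow_add ht0]; congr 2; rw [hq]; ring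
        _ ≤ _ := by gcongr
    · filter_upwards [ae_restrict_mem measurableSet_Ioi] with t ht
      have ht0 : (0:ℝ) < t := lt_trans one_pos ht
      have := (hre t ht0).1
      simp only [Pi.zero_apply]
      rw [RCLike.re_eq_complex_re, Complex.re_ofReal_mul]
      positivity
  set D := K * C1 + C2 with hD
  have hD0 : 0 ≤ D := by positivity
  set B := |A| * (c0 / q) with hB
  have hB0 : 0 < B := by have := abs_pos.mpr hA0; positivity
  refine ⟨B / 2 / Real.Gamma (m - σ), max 1 (2 * D / B), by positivity, le_max_left _ _, fun x hx => ?_⟩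
  have hx1 : 1 ≤ ‖x‖ := (le_max_left _ _).trans hx
  have hxD : 2 * D / B ≤ ‖x‖ := (le_max_right _ _).trans hx
  have hx0 : 0 < ‖x‖ := by linarith
  set z := ‖x‖ ^ (-((n : ℝ) + s)) with hz
  have hz0 : 0 < z := Real.rpow_pos_of_pos hx0 _
  have hNz : D / ‖x‖ ^ N ≤ B / 2 * z := by
    have e2 : 1 / ‖x‖ ^ N ≤ z / ‖x‖ := by
      rw [hz, one_div, ← Real.rpow_natCast, ← Real.rpow_neg hx0.le]
      nth_rewrite 3 [← Real.rpow_one ‖x‖]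
      rw [← Real.rpow_sub hx0]
      refine Real.rpow_le_rpow_of_exponent_le hx1 ?_
      rw [hN]; push_cast
      linarith [Nat.le_ceil s]
    rw [div_le_iff₀ hB0] at hxD
    calc D / ‖x‖ ^ N = D * (1 / ‖x‖ ^ N) := by ring
      _ ≤ D * (z / ‖x‖) := by gcongr
      _ ≤ B / 2 * z := by
        rw [mul_div_assoc', div_le_iff₀ hx0]
        nlinarith
  have h1 := congrArg norm (hid x)
  rw [norm_mul, Complex.norm_real, Real.norm_of_nonneg hΓ.le] at h1
  have h3 := hp3 x hx1
  set T1 := ∫ t in Set.Ioc (0:ℝ) 1, ((t ^ ((m : ℝ) - σ - 1) : ℝ) : ℂ) * HT t (𝓕 (H1 : Eu n → ℂ)) x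
  set T3 := ∫ t in Set.Ioi (1:ℝ), ((t ^ (-σ - 1) : ℝ) : ℂ) * HT t (𝓕 (h : Eu n → ℂ)) x
  have h2 : ‖(A : ℂ) * T3‖ ≤ ‖T1 + HT 1 (𝓕 (H2 : Eu n → ℂ)) x + (A : ℂ) * T3‖ + (‖T1‖ + ‖HT 1 (𝓕 (H2 : Eu n → ℂ)) x‖) := by
    refine (norm_le_add_norm_add' (T1 + HT 1 (𝓕 (H2 : Eu n → ℂ)) x) ((A : ℂ) * T3)).trans ?_
    gcongr
    exact norm_add_le _ _
  rw [← h1, norm_mul, Complex.norm_real, Real.norm_eq_abs] at h2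
  have h4 : B * z ≤ |A| * ‖T3‖ := by
    rw [hB, mul_assoc]; gcongr
  have h5 := hp1 x hx1
  have h6 := hp2 x hx1
  have h7 : K * (C1 / ‖x‖ ^ N) + C2 / ‖x‖ ^ N = D / ‖x‖ ^ N := by rw [hD]; ring
  rw [div_mul_eq_mul_div, div_le_iff₀ hΓ]
  linarith

lemma fi_continuous {n : ℕ} {u : Eu n → ℂ} (hu : Integrable u) : Continuous (𝓕⁻ u) := by
  have h : Continuous (𝓕 u) :=
    VectorFourier.fourierIntegral_continuous Real.continuous_fourierChar (by simpa using continuous_inner) hu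
  have e : 𝓕⁻ u = fun x => 𝓕 u (-x) := by
    ext x; exact Real.fourierInv_eq_fourier_neg u x
  rw [e]; exact h.comp continuous_neg

lemma mult_dom {n : ℕ} (s : ℝ) (hs : 0 ≤ s) (h : SchwartzMap (Eu n) ℂ) :
    ∃ G : Eu n → ℝ, Integrable G ∧ ∀ ε ∈ Set.Icc (0:ℝ) 1, ∀ η,
      ‖(((ε ^ 2 + (2 * π * ‖η‖) ^ 2) ^ (s / 2) : ℝ) : ℂ) * 𝓕 (h : Eu n → ℂ) η‖ ≤ G η := by
  obtain ⟨H, hH⟩ := poly_schwartz ((1 + Polynomial.X) ^ ⌈s / 2⌉₊) h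
  refine ⟨fun η => ‖𝓕 (H : Eu n → ℂ) η‖, ?_, fun ε hε η => ?_⟩
  · rw [← SchwartzMap.fourier_coe]; exact (𝓕 H).integrable.norm
  · show _ ≤ ‖𝓕 (H : Eu n → ℂ) η‖
    rw [hH, norm_mul, norm_mul]
    refine mul_le_mul_of_nonneg_right ?_ (norm_nonneg _)
    simp only [Polynomial.eval_pow, Polynomial.eval_add, Polynomial.eval_one, Polynomial.eval_X]
    rw [Complex.norm_real, Complex.norm_real, Real.norm_of_nonneg (by positivity), Real.norm_of_nonneg (by positivity)]
    have h1 : ε ^ 2 ≤ 1 := pow_le_one₀ hε.1 hε.2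
    calc (ε ^ 2 + (2 * π * ‖η‖) ^ 2) ^ (s / 2) ≤ (1 + (2 * π * ‖η‖) ^ 2) ^ (s / 2) := by gcongr
      _ ≤ (1 + (2 * π * ‖η‖) ^ 2) ^ ((⌈s / 2⌉₊ : ℕ) : ℝ) :=
        Real.rpow_le_rpow_of_exponent_le (by nlinarith [sq_nonneg (2 * π * ‖η‖)]) (Nat.le_ceil _)
      _ = _ := Real.rpow_natCast _ _

lemma mult_continuous {n : ℕ} (s : ℝ) (hs : 0 ≤ s) (h : SchwartzMap (Eu n) ℂ) (ε : ℝ) :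
    Continuous (fun η : Eu n => (((ε ^ 2 + (2 * π * ‖η‖) ^ 2) ^ (s / 2) : ℝ) : ℂ) * 𝓕 (h : Eu n → ℂ) η) := by
  refine Continuous.mul ?_ ?_
  · refine Complex.continuous_ofReal.comp ?_
    exact Continuous.rpow_const (by fun_prop) fun η => Or.inr (by positivity)
  · rw [← SchwartzMap.fourier_coe]; exact (𝓕 h).continuous

lemma TT_continuous {n : ℕ} (s : ℝ) (hs : 0 ≤ s) (h : SchwartzMap (Eu n) ℂ) (ε : ℝ) (hε : ε ∈ Set.Icc (0:ℝ) 1) :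
    Continuous (TT s ε (𝓕 (h : Eu n → ℂ))) := by
  obtain ⟨G, hG, hb⟩ := mult_dom s hs h
  exact fi_continuous (hG.mono' (mult_continuous s hs h ε).aestronglyMeasurable (Filter.Eventually.of_forall (hb ε hε)))

lemma TT_tendsto {n : ℕ} (s : ℝ) (hs : 0 ≤ s) (h : SchwartzMap (Eu n) ℂ) (ε : ℕ → ℝ)
    (hε : ∀ k, ε k ∈ Set.Icc (0:ℝ) 1) (hlim : Filter.Tendsto ε Filter.atTop (nhds 0)) (x : Eu n) :
    Filter.Tendsto (fun k => TT s (ε k) (𝓕 (h : Eu n → ℂ)) x) Filter.atTop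
      (nhds (TT s 0 (𝓕 (h : Eu n → ℂ)) x)) := by
  obtain ⟨G, hG, hb⟩ := mult_dom s hs h
  simp only [TT, Real.fourierInv_eq]
  refine tendsto_integral_of_dominated_convergence G (fun k => ?_) hG (fun k => ?_) ?_
  · exact (fi_conv (hG.mono' (mult_continuous s hs h _).aestronglyMeasurable
      (Filter.Eventually.of_forall (hb _ (hε k)))) x).aestronglyMeasurable
  · refine Filter.Eventually.of_forall fun η => ?_
    rw [Circle.norm_smul]
    exact hb _ (hε k) η
  · refine Filter.Eventually.of_forall fun η => ?_
    refine Filter.Tendsto.const_smul (Filter.Tendsto.mul_const _ ?_) _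
    refine (Complex.continuous_ofReal.tendsto _).comp ?_
    refine Filter.Tendsto.rpow_const ?_ (Or.inr (by positivity))
    exact (hlim.pow 2).add_const _

lemma not_intOn_pow (n : ℕ) (hn : 1 ≤ n) (b R : ℝ) (hR : 1 ≤ R) (hb : b ≤ n) :
    ∫⁻ x : Eu n, (Set.Ici R).indicator (fun r => ENNReal.ofReal (r ^ (-b))) ‖x‖ = ∞ := by
  by_contra hne
  have : Nonempty (Fin n) := ⟨⟨0, hn⟩⟩
  set F : ℝ → ℝ := (Set.Ici R).indicator (fun r => r ^ (-b)) with hF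
  have hFm : Measurable F := (by fun_prop : Measurable fun r : ℝ => r ^ (-b)).indicator measurableSet_Ici
  have hF0 : ∀ r, 0 ≤ F r := fun r => Set.indicator_nonneg (fun r hr => Real.rpow_nonneg (by linarith [Set.mem_Ici.mp hr]) _) r
  have e : ∀ x : Eu n, (Set.Ici R).indicator (fun r => ENNReal.ofReal (r ^ (-b))) ‖x‖ = ENNReal.ofReal (F ‖x‖) := by
    intro x
    by_cases hx : ‖x‖ ∈ Set.Ici R
    · rw [hF, Set.indicator_of_mem hx, Set.indicator_of_mem hx]
    · rw [hF, Set.indicator_of_notMem hx, Set.indicator_of_notMem hx, ENNReal.ofReal_zero]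
  have hint : Integrable (fun x : Eu n => F ‖x‖) := by
    refine ⟨(hFm.comp measurable_norm).aestronglyMeasurable, ?_⟩
    rw [hasFiniteIntegral_iff_ofReal (Filter.Eventually.of_forall fun x => hF0 _)]
    simp only [← e]
    exact lt_top_iff_ne_top.mpr hne
  rw [integrable_fun_norm_addHaar (volume : Measure (Eu n)) (f := F)] at hint
  have h2 := hint.mono_set (Set.Ioi_subset_Ioi (by linarith : (0:ℝ) ≤ R))
  have h3 : IntegrableOn (fun r : ℝ => r ^ ((n : ℝ) - 1 - b)) (Set.Ioi R) := by
    refine h2.congr_fun (fun r hr => ?_) measurableSet_Ioi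
    have hr' : R < r := hr
    have hr0 : 0 < r := by linarith
    simp only [hF, finrank_euclideanSpace, Fintype.card_fin, smul_eq_mul]
    rw [Set.indicator_of_mem (Set.mem_Ici.mpr hr'.le), ← Real.rpow_natCast, ← Real.rpow_add hr0]
    congr 1
    push_cast [Nat.cast_sub hn]
    ring
  rw [integrableOn_Ioi_rpow_iff (by linarith)] at h3
  linarith

lemma blowup {n : ℕ} (hn : 1 ≤ n) (s : ℝ) (hs : 0 < s) (hnev : ¬ ∃ m : ℕ, s = 2 * m)
    (h : SchwartzMap (Eu n) ℂ) (ρ : Eu n → ℝ) (hρ : ∀ y, h y = ρ y)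
    (hρ0 : ∀ y, 0 ≤ ρ y) (hρ1 : 0 < ρ 0) (p : ℝ) (hp : 0 < p) (hps : ((n : ℝ) + s) * p ≤ n)
    (B : ℝ≥0∞) (hB : B ≠ ∞)
    (hle : ∀ ε ∈ Set.Ioc (0:ℝ) 1, ∫⁻ x, (‖TT s ε (𝓕 (h : Eu n → ℂ)) x‖₊ : ℝ≥0∞) ^ p ≤ B) : False := by
  obtain ⟨c, R, hc, hR, hlow⟩ := TT0_lower hn s hs hnev h ρ hρ hρ0 hρ1
  have hε : ∀ k : ℕ, (1 / ((k : ℝ) + 1)) ∈ Set.Ioc (0:ℝ) 1 := fun k =>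
    ⟨by positivity, by rw [div_le_one (by positivity)]; linarith [(Nat.cast_nonneg k : (0:ℝ) ≤ k)]⟩
  have hpt : ∀ x, Filter.Tendsto (fun k : ℕ => (‖TT s (1 / ((k : ℝ) + 1)) (𝓕 (h : Eu n → ℂ)) x‖₊ : ℝ≥0∞) ^ p)
      Filter.atTop (nhds ((‖TT s 0 (𝓕 (h : Eu n → ℂ)) x‖₊ : ℝ≥0∞) ^ p)) := by
    intro x
    have := TT_tendsto s hs.le h (fun k : ℕ => 1 / ((k : ℝ) + 1)) (fun k => ⟨(hε k).1.le, (hε k).2⟩)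
      tendsto_one_div_add_atTop_nhds_zero_nat x
    refine ((ENNReal.continuous_rpow_const (y := p)).tendsto _).comp ?_
    exact (ENNReal.continuous_coe.tendsto _).comp this.nnnorm
  have hfatou : ∫⁻ x, (‖TT s 0 (𝓕 (h : Eu n → ℂ)) x‖₊ : ℝ≥0∞) ^ p ≤ B := by
    have h1 := lintegral_liminf_le (u := Filter.atTop) (μ := (volume : Measure (Eu n)))
      (f := fun (k : ℕ) x => (‖TT s (1 / ((k : ℝ) + 1)) (𝓕 (h : Eu n → ℂ)) x‖₊ : ℝ≥0∞) ^ p) (fun k => by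
        have := (TT_continuous s hs.le h _ ⟨(hε k).1.le, (hε k).2⟩).measurable
        fun_prop)
    simp only [(hpt _).liminf_eq] at h1
    refine h1.trans ?_
    refine (Filter.liminf_le_liminf (v := fun _ => B) (Filter.Eventually.of_forall fun k => hle _ (hε k))).trans ?_
    simp
  have h2 : ∫⁻ x : Eu n, ENNReal.ofReal (c ^ p) * (Set.Ici R).indicator (fun r => ENNReal.ofReal (r ^ (-(((n : ℝ) + s) * p)))) ‖x‖ ≤ B := by
    refine le_trans (lintegral_mono fun x => ?_) hfatou
    by_cases hx : ‖x‖ ∈ Set.Ici R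
    · have hx' : R ≤ ‖x‖ := hx
      rw [Set.indicator_of_mem hx, ← ENNReal.ofReal_mul (by positivity), ← enorm_eq_nnnorm, ← ofReal_norm,
        ENNReal.ofReal_rpow_of_nonneg (norm_nonneg _) hp.le]
      refine ENNReal.ofReal_le_ofReal ?_
      have hx0 : 0 ≤ ‖x‖ := norm_nonneg x
      calc c ^ p * ‖x‖ ^ (-(((n : ℝ) + s) * p)) = (c * ‖x‖ ^ (-((n : ℝ) + s))) ^ p := by
            rw [Real.mul_rpow hc.le (by positivity), ← Real.rpow_mul hx0, neg_mul]
        _ ≤ _ := by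
          refine Real.rpow_le_rpow (by positivity) (hlow x hx') hp.le
    · rw [Set.indicator_of_notMem hx, mul_zero]; exact zero_le
  rw [lintegral_const_mul' _ _ ENNReal.ofReal_ne_top, not_intOn_pow n hn _ R hR hps, ENNReal.mul_top] at h2
  · exact hB (top_le_iff.mp h2)
  · simp only [ne_eq, ENNReal.ofReal_eq_zero, not_le]; positivity

lemma exists_f {n : ℕ} (hn : 1 ≤ n) : ∃ f : SchwartzMap (Eu n) ℂ,
    ContDiff ℝ (⊤ : ℕ∞) (𝓕 (f : Eu n → ℂ)) ∧ HasCompactSupport (𝓕 (f : Eu n → ℂ)) ∧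
    (0 : Eu n) ∉ tsupport (𝓕 (f : Eu n → ℂ)) ∧
    ∃ r : Eu n → ℝ, (∀ y, f y = r y) ∧ r 0 ≠ 0 := by
  let b : ContDiffBump (2:ℝ) := ⟨1/2, 1, by norm_num, by norm_num⟩
  set β : Eu n → ℝ := fun η => b (‖η‖ ^ 2) with hβ
  have hβs : ContDiff ℝ (⊤ : ℕ∞) β := b.contDiff.comp (contDiff_norm_sq ℝ)
  have hβ0 : ∀ η, 0 ≤ β η := fun η => b.nonneg
  have hz : ∀ η : Eu n, 1 ≤ |‖η‖ ^ 2 - 2| → β η = 0 := fun η h => by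
    refine b.zero_of_le_dist ?_
    rw [Real.dist_eq]; exact h
  have hβc : HasCompactSupport β := by
    refine HasCompactSupport.intro (isCompact_closedBall (0 : Eu n) 2) fun η hη => hz η ?_
    have : 2 < ‖η‖ := by simpa using hη
    rw [abs_of_nonneg (by nlinarith)]
    nlinarith
  set φ : Eu n → ℂ := fun η => (β η : ℂ) with hφ
  have hφs : ContDiff ℝ (⊤ : ℕ∞) φ := Complex.ofRealCLM.contDiff.comp hβs
  have hφc : HasCompactSupport φ := hβc.comp_left (g := fun r : ℝ => (r : ℂ)) Complex.ofReal_zero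
  have hφ0 : (0 : Eu n) ∉ tsupport φ := by
    rw [notMem_tsupport_iff_eventuallyEq]
    filter_upwards [Metric.ball_mem_nhds (0 : Eu n) (by norm_num : (0:ℝ) < 1)] with η hη
    have h1 : ‖η‖ < 1 := by simpa using hη
    have : β η = 0 := hz η (by
      have := norm_nonneg η
      rw [abs_of_nonpos (by nlinarith)]; nlinarith)
    simp [hφ, this]
  set Φ : SchwartzMap (Eu n) ℂ := hφc.toSchwartzMap hφs with hΦ
  have hΦc : (Φ : Eu n → ℂ) = φ := rfl
  have hF : 𝓕 ((𝓕⁻ Φ : SchwartzMap (Eu n) ℂ) : Eu n → ℂ) = φ := by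
    rw [← SchwartzMap.fourier_coe, FourierTransform.fourier_fourierInv_eq, hΦc]
  refine ⟨𝓕⁻ Φ, ?_, ?_, ?_, fun y => ((𝓕⁻ Φ : SchwartzMap (Eu n) ℂ) y).re, ?_, ?_⟩
  · rw [hF]; exact hφs
  · rw [hF]; exact hφc
  · rw [hF]; exact hφ0
  · intro y
    symm
    rw [← Complex.conj_eq_iff_re, SchwartzMap.fourierInv_coe, hΦc, Real.fourierInv_eq, ← integral_conj,
      ← integral_neg_eq_self]
    congr 1
    ext v
    simp only [Circle.smul_def, smul_eq_mul, map_mul, hφ, Complex.conj_ofReal, hβ, norm_neg]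
    rw [inner_neg_left, AddChar.map_neg_eq_inv, Circle.coe_inv_eq_conj, Complex.conj_conj]
  · show ((𝓕⁻ Φ : SchwartzMap (Eu n) ℂ) 0).re ≠ 0
    rw [SchwartzMap.fourierInv_coe, hΦc, Real.fourierInv_eq]
    simp only [inner_zero_right, AddChar.map_zero_eq_one, one_smul, hφ]
    rw [integral_complex_ofReal, Complex.ofReal_re]
    refine (Continuous.integral_pos_of_hasCompactSupport_nonneg_nonzero (x := EuclideanSpace.single ⟨0, hn⟩ (√2)) hβs.continuous hβc hβ0 ?_).ne'
    have : β (EuclideanSpace.single ⟨0, hn⟩ (√2)) = b 2 := by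
      simp [hβ]
    rw [this, b.one_of_mem_closedBall (by simp; norm_num)]
    exact one_ne_zero

lemma TT_deriv {n : ℕ} (r : ℝ) (φ : Eu n → ℂ) (hφ : ContDiff ℝ (⊤ : ℕ∞) φ)
    (hc : HasCompactSupport φ) (h0 : (0 : Eu n) ∉ tsupport φ) (ε : ℝ) :
    Differentiable ℝ (TT r ε φ) ∧ ∀ x e, fderiv ℝ (TT r ε φ) x e =
      TT r ε (fun η => (2 * π * I * (⟪η, e⟫ : ℝ)) * φ η) x := by
  set u : Eu n → ℂ := fun η => (((ε ^ 2 + (2 * π * ‖η‖) ^ 2) ^ (r / 2) : ℝ) : ℂ) * φ η with hu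
  have huc : Continuous u :=
    (Mfun_contDiff r φ hφ h0).continuous.comp (by fun_prop : Continuous fun η : Eu n => (ε, η))
  have hus : HasCompactSupport u := hc.mul_left
  have hui : Integrable u := huc.integrable_of_hasCompactSupport hus
  have hui2 : Integrable (fun v => ‖v‖ * ‖u v‖) :=
    (by fun_prop : Continuous fun v => ‖v‖ * ‖u v‖).integrable_of_hasCompactSupport hus.norm.mul_left
  have hsm : Integrable (VectorFourier.fourierSMulRight (innerSL ℝ) u) := by
    refine (hui2.const_mul (2 * π * ‖(innerSL ℝ : Eu n →L[ℝ] Eu n →L[ℝ] ℝ)‖)).mono' ?_ (Filter.Eventually.of_forall fun v => ?_)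
    · exact hui.aestronglyMeasurable.fourierSMulRight
    · refine (VectorFourier.norm_fourierSMulRight_le (innerSL ℝ) u v).trans (le_of_eq (by ring))
  have hd : ∀ x, HasFDerivAt (TT r ε φ) (-(𝓕 (VectorFourier.fourierSMulRight (innerSL ℝ) u) (-x))) x := by
    intro x
    have h1 := Real.hasFDerivAt_fourier hui hui2 (-x)
    have e : TT r ε φ = fun y => 𝓕 u (-y) := by
      ext y; exact Real.fourierInv_eq_fourier_neg u y
    rw [e]
    have := h1.comp x (hasFDerivAt_id x).neg
    refine HasFDerivAt.congr_fderiv this ?_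
    ext v
    simp
  refine ⟨fun x => (hd x).differentiableAt, fun x e => ?_⟩
  rw [(hd x).fderiv, neg_apply, Real.fourier_continuousLinearMap_apply hsm, TT,
    Real.fourierInv_eq_fourier_neg, Real.fourier_eq, Real.fourier_eq, ← integral_neg]
  congr 1
  ext v
  simp only [VectorFourier.fourierSMulRight_apply, Circle.smul_def, smul_eq_mul, hu, Complex.real_smul]
  have hin : ((innerSL ℝ) v) e = ⟪v, e⟫ := rfl
  rw [hin]
  ring

lemma TT_grad_bound {n : ℕ} (r : ℝ) (φ : Eu n → ℂ) (hφ : ContDiff ℝ (⊤ : ℕ∞) φ)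
    (hc : HasCompactSupport φ) (h0 : (0 : Eu n) ∉ tsupport φ) :
    ∃ C : ℝ, 0 ≤ C ∧ ∀ ε ∈ Set.Icc (0:ℝ) 1, ∀ x (j : Fin n),
      ‖fderiv ℝ (TT r ε φ) x (EuclideanSpace.single j 1)‖ ≤ C := by
  have hj : ∀ j : Fin n, ∃ C : ℝ, 0 ≤ C ∧ ∀ ε ∈ Set.Icc (0:ℝ) 1, ∀ x,
      ‖fderiv ℝ (TT r ε φ) x (EuclideanSpace.single j 1)‖ ≤ C := by
    intro j
    obtain ⟨C, hC, hb⟩ := TT_decay r (fun η => (2 * π * I * (⟪η, EuclideanSpace.single j (1:ℝ)⟫ : ℝ)) * φ η)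
      (ContDiff.mul (contDiff_const.mul (Complex.ofRealCLM.contDiff.comp (contDiff_id.inner ℝ contDiff_const))) hφ) hc.mul_left
      (fun h => h0 (tsupport_mul_subset_right h)) 0
    refine ⟨C, hC, fun ε hε x => ?_⟩
    rw [(TT_deriv r φ hφ hc h0 ε).2]
    simpa using hb ε hε x
  choose C hC hb using hj
  refine ⟨∑ j, C j, Finset.sum_nonneg fun j _ => hC j, fun ε hε x j => ?_⟩
  exact (hb j ε hε x).trans (Finset.single_le_sum (fun i _ => hC i) (Finset.mem_univ j))

lemma lint_scale {n : ℕ} (ε : ℝ) (hε : 0 < ε) (F : Eu n → ℝ≥0∞) :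
    ∫⁻ x, F (ε⁻¹ • x) = ENNReal.ofReal (ε ^ n) * ∫⁻ x, F x := by
  have hne : ε⁻¹ ≠ 0 := (inv_pos.2 hε).ne'
  have hme : MeasurableEmbedding (fun x : Eu n => ε⁻¹ • x) := measurableEmbedding_const_smul₀ hne
  rw [← hme.lintegral_map (μ := volume) F, Measure.map_addHaar_smul _ hne, lintegral_smul_measure]
  have : |((ε⁻¹ : ℝ) ^ Module.finrank ℝ (Eu n))⁻¹| = ε ^ n := by
    rw [finrank_euclideanSpace_fin, inv_pow, inv_inv, abs_of_pos (by positivity)]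
  rw [this, smul_eq_mul]

lemma jweight_mono {n : ℕ} (a : ℝ) (ha : 0 ≤ a) (ε : ℝ) (hε : 0 < ε) (hε1 : ε ≤ 1) (x : Eu n) :
    jweight a x ≤ jweight a (ε⁻¹ • x) := by
  refine ENNReal.ofReal_le_ofReal (Real.rpow_le_rpow (by positivity) ?_ (by positivity))
  have h1 : 1 ≤ ε⁻¹ := (one_le_inv₀ hε).2 hε1
  have : ‖x‖ ≤ ‖ε⁻¹ • x‖ := by
    rw [norm_smul, Real.norm_of_nonneg (by positivity)]
    exact le_mul_of_one_le_left (norm_nonneg _) h1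
  gcongr

lemma one_le_jweight {n : ℕ} (a : ℝ) (ha : 0 ≤ a) (x : Eu n) : 1 ≤ jweight a x := by
  rw [jweight, ← ENNReal.ofReal_one]
  refine ENNReal.ofReal_le_ofReal (Real.one_le_rpow ?_ (by positivity))
  nlinarith [sq_nonneg ‖x‖]

lemma jweight_zero {n : ℕ} (x : Eu n) : jweight 0 x = 1 := by
  simp [jweight]

lemma ofReal_pow_aux (n : ℕ) (q c ε : ℝ) (hq : 0 < q) (hc : 0 ≤ c) (hε : 0 < ε) :
    (ENNReal.ofReal c ^ q * ENNReal.ofReal (ε ^ n)) = ENNReal.ofReal (c * ε ^ ((n:ℝ) / q)) ^ q := by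
  rw [ENNReal.ofReal_mul hc, ENNReal.mul_rpow_of_nonneg _ _ hq.le,
    ENNReal.ofReal_rpow_of_nonneg (by positivity : 0 ≤ ε ^ ((n:ℝ) / q)) hq.le, ← Real.rpow_mul hε.le, div_mul_cancel₀ _ hq.ne',
    Real.rpow_natCast]

lemma nn_scale {F G : Type*} [NormedAddCommGroup F] [NormedAddCommGroup G] (c : ℝ) (hc : 0 ≤ c)
    (a : F) (b : G) (h : ‖a‖ = c * ‖b‖) : (‖a‖₊ : ℝ≥0∞) = ENNReal.ofReal c * ‖b‖₊ := by
  rw [← enorm_eq_nnnorm, ← enorm_eq_nnnorm, ← ofReal_norm_eq_enorm, ← ofReal_norm_eq_enorm, h,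
    ENNReal.ofReal_mul hc]

lemma wNorm_scale_le {n : ℕ} {F G : Type*} [NormedAddCommGroup F] [NormedAddCommGroup G]
    (P : ℝ≥0∞) (hP : P ≠ ∞) (hP0 : 0 < P.toReal) (a : ℝ) (ha : 0 ≤ a) (ε : ℝ) (hε : 0 < ε)
    (hε1 : ε ≤ 1) (c : ℝ) (hc : 0 ≤ c) (v : Eu n → F) (u : Eu n → G)
    (h : ∀ x, ‖v x‖ = c * ‖u (ε⁻¹ • x)‖) :
    wNorm P a v ≤ ENNReal.ofReal (c * ε ^ ((n:ℝ) / P.toReal)) * wNorm P a u := by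
  rw [wNorm, wNorm, if_neg hP, if_neg hP]
  set q := P.toReal
  have key : ∫⁻ x, (‖v x‖₊ : ℝ≥0∞) ^ q * jweight a x ≤
      ENNReal.ofReal (c * ε ^ ((n:ℝ) / q)) ^ q * ∫⁻ x, (‖u x‖₊ : ℝ≥0∞) ^ q * jweight a x := by
    rw [← ofReal_pow_aux n q c ε hP0 hc hε, mul_assoc, ← lint_scale ε hε, ← lintegral_const_mul']
    · refine lintegral_mono fun x => ?_
      rw [nn_scale c hc _ _ (h x), ENNReal.mul_rpow_of_nonneg _ _ hP0.le, mul_assoc]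
      gcongr
      exact jweight_mono a ha ε hε hε1 x
    · exact (ENNReal.rpow_lt_top_of_nonneg hP0.le ENNReal.ofReal_ne_top).ne
  refine (ENNReal.rpow_le_rpow key (by positivity)).trans (le_of_eq ?_)
  rw [ENNReal.mul_rpow_of_nonneg _ _ (by positivity), ← ENNReal.rpow_mul, mul_one_div_cancel hP0.ne',
    ENNReal.rpow_one]

lemma wNorm_scale_ge {n : ℕ} {F G : Type*} [NormedAddCommGroup F] [NormedAddCommGroup G]
    (P : ℝ≥0∞) (hP : P ≠ ∞) (hP0 : 0 < P.toReal) (a : ℝ) (ha : 0 ≤ a) (ε : ℝ) (hε : 0 < ε)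
    (c : ℝ) (hc : 0 ≤ c) (v : Eu n → F) (u : Eu n → G)
    (h : ∀ x, ‖v x‖ = c * ‖u (ε⁻¹ • x)‖) :
    ENNReal.ofReal (c * ε ^ ((n:ℝ) / P.toReal)) * (∫⁻ x, (‖u x‖₊ : ℝ≥0∞) ^ P.toReal) ^ (1 / P.toReal)
      ≤ wNorm P a v := by
  rw [wNorm, if_neg hP]
  set q := P.toReal
  have key : ENNReal.ofReal (c * ε ^ ((n:ℝ) / q)) ^ q * ∫⁻ x, (‖u x‖₊ : ℝ≥0∞) ^ q ≤
      ∫⁻ x, (‖v x‖₊ : ℝ≥0∞) ^ q * jweight a x := by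
    rw [← ofReal_pow_aux n q c ε hP0 hc hε, mul_assoc, ← lint_scale ε hε, ← lintegral_const_mul']
    · refine lintegral_mono fun x => ?_
      rw [nn_scale c hc _ _ (h x), ENNReal.mul_rpow_of_nonneg _ _ hP0.le]
      exact le_mul_of_one_le_right' (one_le_jweight a ha x)
    · exact (ENNReal.rpow_lt_top_of_nonneg hP0.le ENNReal.ofReal_ne_top).ne
  refine (le_of_eq ?_).trans (ENNReal.rpow_le_rpow key (by positivity))
  rw [ENNReal.mul_rpow_of_nonneg _ _ (by positivity), ← ENNReal.rpow_mul, mul_one_div_cancel hP0.ne',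
    ENNReal.rpow_one]

/-- Rapid decay, uniformly. -/
def RD {n : ℕ} {ι F : Type*} [NormedAddCommGroup F] (u : ι → Eu n → F) : Prop :=
  ∀ N : ℕ, ∃ D : ℝ, 0 ≤ D ∧ ∀ i x, ‖u i x‖ ≤ D * ((1 + ‖x‖) ^ N)⁻¹

lemma RD_of {n : ℕ} {ι F : Type*} [NormedAddCommGroup F] (u : ι → Eu n → F)
    (h : ∀ N : ℕ, ∃ D : ℝ, 0 ≤ D ∧ ∀ i x, ‖x‖ ^ N * ‖u i x‖ ≤ D) : RD u := by
  intro N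
  obtain ⟨D0, h0, H0⟩ := h 0
  obtain ⟨D1, h1, H1⟩ := h N
  refine ⟨2 ^ N * (D0 + D1), by positivity, fun i x => ?_⟩
  rw [← div_eq_mul_inv, le_div_iff₀ (by positivity)]
  have e0 := H0 i x
  have e1 := H1 i x
  rw [pow_zero, one_mul] at e0
  have h2 : (1 + ‖x‖) ^ N ≤ 2 ^ N * (1 + ‖x‖ ^ N) := by
    rcases le_total ‖x‖ 1 with hx | hx
    · calc (1 + ‖x‖) ^ N ≤ 2 ^ N := by gcongr; linarith
        _ ≤ _ := le_mul_of_one_le_right (by positivity) (by have : 0 ≤ ‖x‖ ^ N := by positivity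
                                                            linarith)
    · calc (1 + ‖x‖) ^ N ≤ (2 * ‖x‖) ^ N := by gcongr; linarith
        _ = 2 ^ N * ‖x‖ ^ N := by rw [mul_pow]
        _ ≤ _ := by gcongr; linarith
  calc ‖u i x‖ * (1 + ‖x‖) ^ N ≤ ‖u i x‖ * (2 ^ N * (1 + ‖x‖ ^ N)) := by gcongr
    _ = 2 ^ N * (‖u i x‖ + ‖x‖ ^ N * ‖u i x‖) := by ring
    _ ≤ _ := by gcongr

lemma dom_finite {n : ℕ} (q : ℝ) (hq : 0 < q) (a : ℝ) (ha : 0 ≤ a) : ∃ N : ℕ, ∀ D : ℝ, 0 ≤ D →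
    ∫⁻ x : Eu n, ENNReal.ofReal (D * ((1 + ‖x‖) ^ N)⁻¹) ^ q * jweight a x < ∞ := by
  obtain ⟨N, hN⟩ := exists_nat_gt ((n + a) / q)
  rw [div_lt_iff₀ hq] at hN
  refine ⟨N, fun D hD => ?_⟩
  have hfin := finite_integral_one_add_norm (E := Eu n) (μ := volume) (r := N * q - a)
    (by rw [finrank_euclideanSpace_fin]; linarith)
  calc ∫⁻ x : Eu n, ENNReal.ofReal (D * ((1 + ‖x‖) ^ N)⁻¹) ^ q * jweight a x
      ≤ ∫⁻ x : Eu n, ENNReal.ofReal (D ^ q) * ENNReal.ofReal ((1 + ‖x‖) ^ (-(N * q - a))) := by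
        refine lintegral_mono fun x => ?_
        have hp : 0 < 1 + ‖x‖ := by positivity
        rw [ENNReal.ofReal_rpow_of_nonneg (by positivity) hq.le, jweight,
          ← ENNReal.ofReal_mul (by positivity), ← ENNReal.ofReal_mul (by positivity)]
        refine ENNReal.ofReal_le_ofReal ?_
        rw [Real.mul_rpow hD (by positivity), mul_assoc]
        refine mul_le_mul_of_nonneg_left ?_ (by positivity)
        have h1 : (((1 + ‖x‖) ^ N)⁻¹) ^ q = (1 + ‖x‖) ^ (-(N * q)) := by
          rw [← Real.rpow_natCast, ← Real.rpow_neg hp.le, ← Real.rpow_mul hp.le]; ring_nf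
        have h2 : (1 + ‖x‖ ^ 2) ^ (a / 2) ≤ (1 + ‖x‖) ^ a := by
          calc (1 + ‖x‖ ^ 2) ^ (a / 2) ≤ ((1 + ‖x‖) ^ 2) ^ (a / 2) := by
                refine Real.rpow_le_rpow (by positivity) ?_ (by positivity)
                nlinarith [norm_nonneg x]
            _ = _ := by rw [← Real.rpow_natCast, ← Real.rpow_mul hp.le]; congr 1; push_cast; ring
        rw [h1, show -((N:ℝ) * q - a) = -(N * q) + a by ring, Real.rpow_add hp]
        gcongr
    _ = ENNReal.ofReal (D ^ q) * ∫⁻ x : Eu n, ENNReal.ofReal ((1 + ‖x‖) ^ (-(N * q - a))) :=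
        lintegral_const_mul' _ _ ENNReal.ofReal_ne_top
    _ < ∞ := ENNReal.mul_lt_top ENNReal.ofReal_lt_top hfin

lemma RD_nn {n : ℕ} {F : Type*} [NormedAddCommGroup F] (a : F) (b : ℝ) (h : ‖a‖ ≤ b) :
    (‖a‖₊ : ℝ≥0∞) ≤ ENNReal.ofReal b := by
  rw [← enorm_eq_nnnorm, ← ofReal_norm_eq_enorm]
  exact ENNReal.ofReal_le_ofReal h

lemma RD_wNorm {n : ℕ} {ι F : Type*} [NormedAddCommGroup F] (u : ι → Eu n → F) (hu : RD u)
    (P : ℝ≥0∞) (hP : P ≠ ∞) (hP0 : 0 < P.toReal) (a : ℝ) (ha : 0 ≤ a) :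
    ∃ K : ℝ≥0∞, K ≠ ∞ ∧ ∀ i, wNorm P a (u i) ≤ K := by
  obtain ⟨N, hN⟩ := dom_finite (n := n) P.toReal hP0 a ha
  obtain ⟨D, hD, hb⟩ := hu N
  refine ⟨_, (ENNReal.rpow_lt_top_of_nonneg (y := 1 / P.toReal) (by positivity) (hN D hD).ne).ne, fun i => ?_⟩
  rw [wNorm, if_neg hP]
  refine ENNReal.rpow_le_rpow (lintegral_mono fun x => ?_) (by positivity)
  refine mul_le_mul_left ?_ _
  exact ENNReal.rpow_le_rpow (RD_nn (n := n) _ _ (hb i x)) hP0.le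

lemma RD_diff {n : ℕ} {ι : Type*} (A L w : ι → Eu n → ℂ) (hw : RD w) (hA : ∀ i x, A i x = L i x + w i x)
    (q : ℝ) (hq : 0 < q) (hq1 : q ≤ 1) (B : ℝ≥0∞) (hB : B ≠ ∞)
    (hL : ∀ i, ∫⁻ x, (‖L i x‖₊ : ℝ≥0∞) ^ q ≤ B) :
    ∃ B' : ℝ≥0∞, B' ≠ ∞ ∧ ∀ i, ∫⁻ x, (‖A i x‖₊ : ℝ≥0∞) ^ q ≤ B' := by
  obtain ⟨N, hN⟩ := dom_finite (n := n) q hq 0 le_rfl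
  obtain ⟨D, hD, hb⟩ := hw N
  refine ⟨_, (ENNReal.add_lt_top.2 ⟨hB.lt_top, hN D hD⟩).ne, fun i => ?_⟩
  simp only [jweight_zero, mul_one]
  calc ∫⁻ x, (‖A i x‖₊ : ℝ≥0∞) ^ q ≤ ∫⁻ x, ((‖L i x‖₊ : ℝ≥0∞) ^ q + ENNReal.ofReal (D * ((1 + ‖x‖) ^ N)⁻¹) ^ q) := by
        refine lintegral_mono fun x => ?_
        refine le_trans (ENNReal.rpow_le_rpow ?_ hq.le) (ENNReal.rpow_add_le_add_rpow _ _ hq.le hq1)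
        rw [hA]
        refine le_trans (b := (‖L i x‖₊ : ℝ≥0∞) + ‖w i x‖₊) ?_ ?_
        · exact_mod_cast nnnorm_add_le _ _
        · gcongr
          exact RD_nn (n := n) _ _ (hb i x)
    _ = _ := lintegral_add_right _ (by fun_prop)
    _ ≤ _ := by gcongr; exact hL i

lemma RD_TT {n : ℕ} (r : ℝ) (φ : Eu n → ℂ) (hφ : ContDiff ℝ (⊤ : ℕ∞) φ)
    (hc : HasCompactSupport φ) (h0 : (0 : Eu n) ∉ tsupport φ) :
    RD (fun (i : Set.Ioc (0:ℝ) 1) => TT r i φ) := by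
  refine RD_of _ fun N => ?_
  obtain ⟨C, hC, hb⟩ := TT_decay r φ hφ hc h0 N
  exact ⟨C, hC, fun i x => hb i ⟨i.2.1.le, i.2.2⟩ x⟩

lemma RD_schwartz {n : ℕ} (ι : Type) (f : SchwartzMap (Eu n) ℂ) : RD (fun _ : ι => (f : Eu n → ℂ)) := by
  refine RD_of _ fun N => ?_
  obtain ⟨C, hb⟩ := f.decay N 0
  refine ⟨max C 0, le_max_right _ _, fun i x => le_trans ?_ (le_max_left _ _)⟩
  simpa using hb.2 x

lemma grad_decay {n : ℕ} (f : SchwartzMap (Eu n) ℂ) (N : ℕ) : ∃ D : ℝ, 0 ≤ D ∧ ∀ x (j : Fin n),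
    ‖fderiv ℝ f x (EuclideanSpace.single j 1)‖ ≤ D * ((1 + ‖x‖) ^ N)⁻¹ := by
  have : RD (fun _ : Unit => fderiv ℝ (f : Eu n → ℂ)) := by
    refine RD_of _ fun N => ?_
    obtain ⟨C, hb⟩ := f.decay N 1
    refine ⟨max C 0, le_max_right _ _, fun i x => le_trans ?_ (le_max_left _ _)⟩
    simpa [norm_iteratedFDeriv_one] using hb.2 x
  obtain ⟨D, hD, hb⟩ := this N
  refine ⟨D, hD, fun x j => le_trans ?_ (hb () x)⟩
  refine ((fderiv ℝ (f : Eu n → ℂ) x).le_opNorm _).trans (le_of_eq ?_)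
  simp

lemma RD_gradNorm {n : ℕ} (ι : Type) (f : SchwartzMap (Eu n) ℂ) : RD (fun _ : ι => gradNorm (f : Eu n → ℂ)) := by
  intro N
  obtain ⟨D, hD, hb⟩ := grad_decay f N
  refine ⟨√n * D, by positivity, fun _ x => ?_⟩
  have h0 : 0 ≤ D * ((1 + ‖x‖) ^ N)⁻¹ := by positivity
  simp only [gradNorm]
  rw [Real.norm_of_nonneg (Real.sqrt_nonneg _), mul_assoc]
  refine Real.sqrt_le_iff.2 ⟨by positivity, ?_⟩
  rw [mul_pow, Real.sq_sqrt (by positivity)]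
  refine (Finset.sum_le_card_nsmul _ _ ((D * ((1 + ‖x‖) ^ N)⁻¹) ^ 2) fun j _ => ?_).trans (by simp)
  have := hb x j
  gcongr

lemma RD_w {n : ℕ} (s : ℝ) (κ : ℂ) (f : SchwartzMap (Eu n) ℂ) (φ : Eu n → ℂ) (hφ : ContDiff ℝ (⊤ : ℕ∞) φ)
    (hc : HasCompactSupport φ) (h0 : (0 : Eu n) ∉ tsupport φ) :
    RD (fun (i : Set.Ioc (0:ℝ) 1) x => f x * TT s i φ x - κ * gradDot f (TT (s - 2) i φ) x) := by
  intro N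
  obtain ⟨D1, hD1, hb1⟩ := RD_schwartz Unit f 0
  obtain ⟨D2, hD2, hb2⟩ := RD_TT s φ hφ hc h0 N
  obtain ⟨D3, hD3, hb3⟩ := grad_decay f N
  obtain ⟨D4, hD4, hb4⟩ := TT_grad_bound (s - 2) φ hφ hc h0
  refine ⟨D1 * D2 + ‖κ‖ * (n * (D3 * D4)), by positivity, fun i x => ?_⟩
  have e1 : ‖f x‖ ≤ D1 := by simpa using hb1 () x
  have e2 := hb2 i x
  have e3 : ‖gradDot f (TT (s - 2) i φ) x‖ ≤ n * (D3 * ((1 + ‖x‖) ^ N)⁻¹ * D4) := by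
    refine (norm_sum_le _ _).trans ?_
    refine (Finset.sum_le_card_nsmul _ _ (D3 * ((1 + ‖x‖) ^ N)⁻¹ * D4) fun j _ => ?_).trans (by simp)
    rw [norm_mul]
    exact mul_le_mul (hb3 x j) (hb4 i ⟨i.2.1.le, i.2.2⟩ x j) (norm_nonneg _) (by positivity)
  calc _ ≤ ‖f x‖ * ‖TT s i φ x‖ + ‖κ‖ * ‖gradDot f (TT (s - 2) i φ) x‖ := by
        refine (norm_sub_le _ _).trans (le_of_eq ?_)
        rw [norm_mul, norm_mul]
    _ ≤ D1 * (D2 * ((1 + ‖x‖) ^ N)⁻¹) + ‖κ‖ * (n * (D3 * ((1 + ‖x‖) ^ N)⁻¹ * D4)) := by gcongr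
    _ = _ := by ring

lemma exists_scaled {n : ℕ} (f : SchwartzMap (Eu n) ℂ) (ε : ℝ) (hε : 0 < ε) :
    ∃ F : SchwartzMap (Eu n) ℂ, (F : Eu n → ℂ) = fun x => f (ε⁻¹ • x) := by
  refine ⟨SchwartzMap.compCLMOfContinuousLinearEquiv ℂ
    (ContinuousLinearEquiv.smulLeft (Units.mk0 ε⁻¹ (inv_pos.2 hε).ne') : Eu n ≃L[ℝ] Eu n) f, ?_⟩
  ext x
  rfl

lemma exists_sq {n : ℕ} (f : SchwartzMap (Eu n) ℂ) :
    ∃ h : SchwartzMap (Eu n) ℂ, (h : Eu n → ℂ) = fun x => f x * f x := by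
  refine ⟨SchwartzMap.smulLeftCLM ℂ (f : Eu n → ℂ) f, ?_⟩
  ext x
  rw [SchwartzMap.smulLeftCLM_apply_apply f.hasTemperateGrowth]
  rfl

lemma gradNorm_scale {n : ℕ} (f : Eu n → ℂ) (ε : ℝ) (hε : 0 < ε) (x : Eu n) :
    gradNorm (fun y => f (ε⁻¹ • y)) x = ε⁻¹ * gradNorm f (ε⁻¹ • x) := by
  have h0 : 0 ≤ ε⁻¹ := by positivity
  rw [gradNorm, gradNorm]
  simp only [fderiv_comp_smul, smul_apply, norm_smul, mul_pow, ← Finset.mul_sum]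
  rw [Real.sqrt_mul (by positivity), Real.norm_of_nonneg h0, Real.sqrt_sq h0]

lemma gradDot_scale {n : ℕ} (f G : Eu n → ℂ) (c : ℂ) (ε : ℝ) (x : Eu n) :
    gradDot (fun y => f (ε⁻¹ • y)) (fun y => c * G (ε⁻¹ • y)) x
      = (ε⁻¹ : ℝ) * (c * (ε⁻¹ : ℝ)) * gradDot f G (ε⁻¹ • x) := by
  have h1 : fderiv ℝ (fun y => c * G (ε⁻¹ • y)) x = c • (ε⁻¹ • fderiv ℝ G (ε⁻¹ • x)) := by
    rw [← fderiv_comp_smul]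
    exact congrFun (fderiv_const_smul_field (𝕜 := ℝ) (f := fun y => G (ε⁻¹ • y)) c) x
  rw [gradDot, gradDot, h1, fderiv_comp_smul, Finset.mul_sum]
  refine Finset.sum_congr rfl fun j _ => ?_
  simp only [smul_apply, smul_eq_mul, Complex.real_smul]
  ring

lemma core (n : ℕ) (hn : 1 ≤ n) (p p₁ p₂ : ℝ≥0∞)
    (a a₁ a₂ s : ℝ)
    (hp : p ≠ ∞) (hp0 : 0 < p.toReal) (hple : p.toReal ≤ 1)
    (hp1 : p₁ ≠ ∞) (hp10 : 0 < p₁.toReal) (hp2 : p₂ ≠ ∞) (hp20 : 0 < p₂.toReal)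
    (ha : 0 ≤ a) (ha1 : 0 ≤ a₁) (ha2 : 0 ≤ a₂)
    (hexp : 1 / p.toReal = 1 / p₁.toReal + 1 / p₂.toReal)
    (hs0 : 0 < s) (hs : ((n : ℝ) + s) * p.toReal ≤ n)
    (hnev : ¬ ∃ m : ℕ, s = 2 * m) (κ : ℂ) (C : ℝ)
    (H : ∀ f g : SchwartzMap (Eu n) ℂ,
      wNorm p a (fun x => Js s (fun y => f y * g y) x - f x * Js s ⇑g x +
          κ * gradDot ⇑f (Js (s - 2) ⇑g) x) ≤
        ENNReal.ofReal C *
          (wNorm p₁ a₁ (Js s ⇑f) * wNorm p₂ a₂ ⇑g +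
            wNorm p₁ a₁ (gradNorm ⇑f) * wNorm p₂ a₂ (Js (s - 1) ⇑g))) : False := by
  obtain ⟨f, hφ, hc, h0, r, hr, hr0⟩ := exists_f hn
  set φ := 𝓕 (f : Eu n → ℂ) with hφdef
  obtain ⟨h, hh⟩ := exists_sq f
  obtain ⟨K1, hK1, hb1⟩ := RD_wNorm _ (RD_TT s φ hφ hc h0) p₁ hp1 hp10 a₁ ha1
  obtain ⟨K2, hK2, hb2⟩ := RD_wNorm _ (RD_schwartz Unit f) p₂ hp2 hp20 a₂ ha2
  obtain ⟨K3, hK3, hb3⟩ := RD_wNorm _ (RD_gradNorm Unit f) p₁ hp1 hp10 a₁ ha1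
  obtain ⟨K4, hK4, hb4⟩ := RD_wNorm _ (RD_TT (s - 1) φ hφ hc h0) p₂ hp2 hp20 a₂ ha2
  set M : ℝ≥0∞ := ENNReal.ofReal C * (K1 * K2 + K3 * K4) with hM
  have hMt : M ≠ ∞ := ENNReal.mul_ne_top ENNReal.ofReal_ne_top
    (ENNReal.add_ne_top.2 ⟨ENNReal.mul_ne_top hK1 hK2, ENNReal.mul_ne_top hK3 hK4⟩)
  let L : Set.Ioc (0:ℝ) 1 → Eu n → ℂ := fun i x =>
    TT s i (𝓕 (h : Eu n → ℂ)) x - f x * TT s i φ x + κ * gradDot f (TT (s - 2) i φ) x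
  have hL : ∀ i, ∫⁻ x, (‖L i x‖₊ : ℝ≥0∞) ^ p.toReal ≤ M ^ p.toReal := by
    rintro ⟨ε, hε, hε1⟩
    obtain ⟨F, hF⟩ := exists_scaled f ε hε
    have HF := H F F
    have hJ : ∀ t, Js t ⇑F = fun x => ((ε ^ (-t) : ℝ) : ℂ) * TT t ε φ (ε⁻¹ • x) := by
      intro t
      rw [hF]; ext x
      exact Js_scale t f ε hε x
    have hJn : ∀ t x, ‖Js t ⇑F x‖ = ε ^ (-t) * ‖TT t ε φ (ε⁻¹ • x)‖ := by
      intro t x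
      rw [hJ, norm_mul, Complex.norm_real, Real.norm_of_nonneg (by positivity)]
    have hJ2 : Js s (fun y => F y * F y) = fun x => ((ε ^ (-s) : ℝ) : ℂ) * TT s ε (𝓕 (h : Eu n → ℂ)) (ε⁻¹ • x) := by
      ext x
      rw [← Js_scale s h ε hε x, hF, hh]
    have hv : ∀ x, Js s (fun y => F y * F y) x - F x * Js s ⇑F x +
          κ * gradDot ⇑F (Js (s - 2) ⇑F) x = ((ε ^ (-s) : ℝ) : ℂ) * L ⟨ε, hε, hε1⟩ (ε⁻¹ • x) := by
      intro x
      have e : ((ε⁻¹ : ℝ) : ℂ) * (((ε ^ (-(s - 2)) : ℝ) : ℂ) * (ε⁻¹ : ℝ)) = ((ε ^ (-s) : ℝ) : ℂ) := by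
        rw [← Complex.ofReal_mul, ← Complex.ofReal_mul]
        congr 1
        rw [show -(s - 2) = -s + 2 by ring, Real.rpow_add hε, Real.rpow_two]
        field_simp
      rw [hJ2, hJ, hJ, hF, gradDot_scale, e]
      simp only [L]
      ring
    have lhs := wNorm_scale_ge p hp hp0 a ha ε hε (ε ^ (-s)) (by positivity)
      (fun x => Js s (fun y => F y * F y) x - F x * Js s ⇑F x + κ * gradDot ⇑F (Js (s - 2) ⇑F) x) (L ⟨ε, hε, hε1⟩)
      (fun x => by simp only [hv]; rw [ norm_mul, Complex.norm_real, Real.norm_of_nonneg (by positivity)])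
    have w1 := (wNorm_scale_le p₁ hp1 hp10 a₁ ha1 ε hε hε1 (ε ^ (-s)) (by positivity) (Js s ⇑F) (TT s ε φ) (hJn s)).trans
      (mul_le_mul_right (hb1 ⟨ε, hε, hε1⟩) _)
    have w2 := (wNorm_scale_le p₂ hp2 hp20 a₂ ha2 ε hε hε1 1 zero_le_one ⇑F ⇑f
      (fun x => by rw [hF, one_mul])).trans (mul_le_mul_right (hb2 ()) _)
    have w3 := (wNorm_scale_le p₁ hp1 hp10 a₁ ha1 ε hε hε1 ε⁻¹ (by positivity) (gradNorm ⇑F) (gradNorm ⇑f)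
      (fun x => by rw [hF, gradNorm_scale _ _ hε, norm_mul, Real.norm_of_nonneg (by positivity : 0 ≤ ε⁻¹)])).trans
      (mul_le_mul_right (hb3 ()) _)
    have w4 := (wNorm_scale_le p₂ hp2 hp20 a₂ ha2 ε hε hε1 (ε ^ (-(s - 1))) (by positivity) (Js (s - 1) ⇑F) (TT (s - 1) ε φ) (hJn (s - 1))).trans
      (mul_le_mul_right (hb4 ⟨ε, hε, hε1⟩) _)
    set c := ε ^ (-s) * ε ^ ((n:ℝ) / p.toReal) with hcdef
    have hcpos : 0 < c := by positivity
    have hnp : (n:ℝ) / p.toReal = n / p₁.toReal + n / p₂.toReal := by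
      have : (n:ℝ) * (1 / p.toReal) = n * (1 / p₁.toReal + 1 / p₂.toReal) := by rw [hexp]
      rw [mul_add] at this
      simpa only [mul_one_div] using this
    have c1 : (ε ^ (-s) * ε ^ ((n:ℝ) / p₁.toReal)) * (1 * ε ^ ((n:ℝ) / p₂.toReal)) = c := by
      rw [hcdef, hnp, Real.rpow_add hε]; ring
    have c2 : (ε⁻¹ * ε ^ ((n:ℝ) / p₁.toReal)) * (ε ^ (-(s - 1)) * ε ^ ((n:ℝ) / p₂.toReal)) = c := by
      rw [hcdef, hnp, Real.rpow_add hε, show -(s - 1) = -s + 1 by ring, Real.rpow_add hε (-s), Real.rpow_one]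
      field_simp
    have tot : ENNReal.ofReal c * (∫⁻ x, (‖L ⟨ε, hε, hε1⟩ x‖₊ : ℝ≥0∞) ^ p.toReal) ^ (1 / p.toReal) ≤
        ENNReal.ofReal c * M := by
      refine lhs.trans (HF.trans ?_)
      refine (mul_le_mul_right (add_le_add (mul_le_mul' w1 w2) (mul_le_mul' w3 w4)) _).trans (le_of_eq ?_)
      rw [mul_mul_mul_comm, mul_mul_mul_comm _ K3, ← ENNReal.ofReal_mul (by positivity),
        ← ENNReal.ofReal_mul (by positivity), c1, c2, ← mul_add, hM]
      ring
    have tot2 := (ENNReal.mul_le_mul_iff_right (ENNReal.ofReal_pos.2 hcpos).ne' ENNReal.ofReal_ne_top).1 tot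
    have := ENNReal.rpow_le_rpow tot2 hp0.le
    rwa [← ENNReal.rpow_mul, one_div_mul_cancel hp0.ne', ENNReal.rpow_one] at this
  obtain ⟨B, hB, hfin⟩ := RD_diff (fun (i : Set.Ioc (0:ℝ) 1) => TT s i (𝓕 (h : Eu n → ℂ))) L _ (RD_w s κ f φ hφ hc h0)
    (fun i x => by simp only [L]; ring) p.toReal hp0 hple (M ^ p.toReal)
    (ENNReal.rpow_lt_top_of_nonneg hp0.le hMt).ne hL
  refine blowup hn s hs0 hnev h (fun y => r y ^ 2) (fun y => ?_) (fun y => sq_nonneg _) (by positivity)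
    p.toReal hp0 hs B hB (fun ε hε => hfin ⟨ε, hε⟩)
  rw [hh]; simp only [hr]; push_cast; ring

theorem weighted_kato_ponce_commutator_sharp (n : ℕ) (hn : 1 ≤ n) (p p₁ p₂ : ℝ≥0∞)
    (a a₁ a₂ s : ℝ)
    (hp : 2⁻¹ ≤ p) (hp1 : 1 ≤ p₁) (hp2 : 1 ≤ p₂)
    (ha : 0 ≤ a) (ha1 : 0 ≤ a₁) (ha2 : 0 ≤ a₂)
    (hexp : 1 / p = 1 / p₁ + 1 / p₂)
    (hwexp : ENNReal.ofReal a / p = ENNReal.ofReal a₁ / p₁ + ENNReal.ofReal a₂ / p₂)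
    (hs0 : 0 < s) (hs : s ≤ (n : ℝ) * (1 / p.toReal - 1))
    (hnev : ¬ ∃ m : ℕ, s = 2 * m) :
    (¬ ∃ C : ℝ, 0 < C ∧ ∀ f g : SchwartzMap (Eu n) ℂ,
      wNorm p a (fun x => Js s (fun y => f y * g y) x - f x * Js s ⇑g x) ≤
        ENNReal.ofReal C *
          (wNorm p₁ a₁ (Js s ⇑f) * wNorm p₂ a₂ ⇑g +
            wNorm p₁ a₁ (gradNorm ⇑f) * wNorm p₂ a₂ (Js (s - 1) ⇑g))) ∧
    (¬ ∃ C : ℝ, 0 < C ∧ ∀ f g : SchwartzMap (Eu n) ℂ,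
      wNorm p a (fun x => Js s (fun y => f y * g y) x - f x * Js s ⇑g x +
          (s : ℂ) * gradDot ⇑f (Js (s - 2) ⇑g) x) ≤
        ENNReal.ofReal C *
          (wNorm p₁ a₁ (Js s ⇑f) * wNorm p₂ a₂ ⇑g +
            wNorm p₁ a₁ (gradNorm ⇑f) * wNorm p₂ a₂ (Js (s - 1) ⇑g))) := by
  have hn0 : (0:ℝ) < n := by exact_mod_cast hn
  have hpos : 0 < 1 / p.toReal - 1 := by
    by_contra hneg
    nlinarith [not_lt.1 hneg]
  have hpt : p ≠ ∞ := by
    rintro rfl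
    norm_num at hpos
  have hpne : p ≠ 0 := by
    rintro rfl
    simp at hp
  have hq : 0 < p.toReal := ENNReal.toReal_pos hpne hpt
  have hq1 : p.toReal < 1 := by
    have : 1 < 1 / p.toReal := by linarith
    rwa [lt_div_iff₀ hq, one_mul] at this
  have h10 : p₁ ≠ 0 := (zero_lt_one.trans_le hp1).ne'
  have h20 : p₂ ≠ 0 := (zero_lt_one.trans_le hp2).ne'
  have hexpR : 1 / p.toReal = 1 / p₁.toReal + 1 / p₂.toReal := by
    have := congrArg ENNReal.toReal hexp
    rw [ENNReal.toReal_add (by simp [h10]) (by simp [h20])] at this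
    simpa [ENNReal.toReal_div] using this
  have le1 : ∀ P : ℝ≥0∞, 1 ≤ P → 1 / P.toReal ≤ 1 := by
    intro P hP
    by_cases ht : P = ∞
    · simp [ht]
    have : 1 ≤ P.toReal := by
      rw [← ENNReal.toReal_one]; exact ENNReal.toReal_mono ht hP
    rw [div_le_one (by linarith)]; exact this
  have hp1t : p₁ ≠ ∞ := by
    rintro rfl
    have := le1 p₂ hp2
    simp only [ENNReal.toReal_top, div_zero, zero_add] at hexpR
    linarith
  have hp2t : p₂ ≠ ∞ := by
    rintro rfl
    have := le1 p₁ hp1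
    simp only [ENNReal.toReal_top, div_zero, add_zero] at hexpR
    linarith
  have hsn : ((n : ℝ) + s) * p.toReal ≤ n := by
    have h1 : s * p.toReal ≤ (n : ℝ) * (1 / p.toReal - 1) * p.toReal := by gcongr
    have h2 : (n : ℝ) * (1 / p.toReal - 1) * p.toReal = n - n * p.toReal := by
      field_simp
    linarith
  have hc := core n hn p p₁ p₂ a a₁ a₂ s hpt hq hq1.le hp1t (ENNReal.toReal_pos h10 hp1t) hp2t
    (ENNReal.toReal_pos h20 hp2t) ha ha1 ha2 hexpR hs0 hsn hnev
  refine ⟨?_, ?_⟩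
  · rintro ⟨C, -, H⟩
    refine hc 0 C fun f g => ?_
    simpa only [zero_mul, add_zero] using H f g
  · rintro ⟨C, -, H⟩
    exact hc s C H
end
end
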